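/- arXiv:2404.06321 — 3 statements merged into one kernel-verified Lean document; each statement's English description precedes it below -/
import Mathlib

section
/- The data (e_0, e_1, e_2, e_3, γ_0, …, γ_3, ε_0, …, ε_3) form a positive geometric crystal for C_3^{(1)}: for all x ∈ ℝ_{>0}^6 and all c, c1, c2 ∈ ℝ_{>0}: (i) e_i^1(x) = x and e_i^{c1·c2}(x) = e_i^{c1}(e_i^{c2}(x)) for i = 0, 1, 2, 3; (ii) γ_j(e_i^c(x)) = c^{a_ij}·γ_j(x) for all i, j ∈ {0, 1, 2, 3}; (iii) ε_i(e_i^c(x)) = c^{−1}·ε_i(x) for all i, and ε_i(e_j^c(x)) = ε_i(x) for each pair with a_ij = a_ji = 0, namely (i, j) ∈ {(0,2), (2,0), (0,3), (3,0), (1,3), (3,1)}; (iv) e_i^{c1} and e_j^{c2} commute for the pairs with a_ij = a_ji = 0; e_1^{c1}(e_2^{c1·c2}(e_1^{c2}(x))) = e_2^{c2}(e_1^{c1·c2}(e_2^{c1}(x))) (since a_12 = a_21 = −1); and for (i, j) ∈ {(1, 0), (2, 3)} (the pairs with a_ij = −2, a_ji = −1): e_i^{c1}(e_j^{c1²·c2}(e_i^{c1·c2}(e_j^{c2}(x))))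 = e_j^{c2}(e_i^{c1·c2}(e_j^{c1²·c2}(e_i^{c1}(x)))). -/
namespace Stmt8

noncomputable section

/-! Coordinates: `x = (x33, x22, x32, x11, x21, x31)` at indices `0, …, 5`. -/

def e1 (c : ℝ) (x : Fin 6 → ℝ) : Fin 6 → ℝ := ![x 0, x 1, x 2, c * x 3, x 4, x 5]

/-- `c2 = (c·x21·x22 + x32·x11)/(x21·x22 + x32·x11)`. -/
def cc2 (c : ℝ) (x : Fin 6 → ℝ) : ℝ :=
  (c * x 4 * x 1 + x 2 * x 3) / (x 4 * x 1 + x 2 * x 3)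

def e2 (c : ℝ) (x : Fin 6 → ℝ) : Fin 6 → ℝ :=
  ![x 0, cc2 c x * x 1, x 2, x 3, (c / cc2 c x) * x 4, x 5]

def c3 (x : Fin 6 → ℝ) : ℝ :=
  x 2 ^ 2 * x 5 * x 0 + x 1 ^ 2 * x 5 * x 2 + x 1 ^ 2 * x 4 ^ 2
def c31 (c : ℝ) (x : Fin 6 → ℝ) : ℝ :=
  c * (x 2 ^ 2 * x 5 * x 0) + x 1 ^ 2 * x 5 * x 2 + x 1 ^ 2 * x 4 ^ 2
def c32 (c : ℝ) (x : Fin 6 → ℝ) : ℝ :=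
  c * (x 2 ^ 2 * x 5 * x 0) + c * (x 1 ^ 2 * x 5 * x 2) + x 1 ^ 2 * x 4 ^ 2

def e3 (c : ℝ) (x : Fin 6 → ℝ) : Fin 6 → ℝ :=
  ![(c31 c x / c3 x) * x 0, x 1, (c32 c x / c31 c x) * x 2, x 3, x 4,
    (c * c3 x / c32 c x) * x 5]

def c2p (x : Fin 6 → ℝ) : ℝ :=
  x 5 + x 4 ^ 2 / x 2 + 2 * x 4 * x 3 / x 1 + x 3 ^ 2 * x 2 / x 1 ^ 2 + x 3 ^ 2 / x 0
def c21p (c : ℝ) (x : Fin 6 → ℝ) : ℝ :=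
  c * x 5 + x 4 ^ 2 / x 2 + 2 * x 4 * x 3 / x 1 + x 3 ^ 2 * x 2 / x 1 ^ 2 + x 3 ^ 2 / x 0
def c24p (c : ℝ) (x : Fin 6 → ℝ) : ℝ :=
  c * x 5 + c * (x 4 ^ 2 / x 2) + c * (2 * x 4 * x 3 / x 1) +
    c * (x 3 ^ 2 * x 2 / x 1 ^ 2) + x 3 ^ 2 / x 0

def e0 (c : ℝ) (x : Fin 6 → ℝ) : Fin 6 → ℝ :=
  ![(c24p c x / (c * c2p x)) * x 0,
    x 1 * (x 4 * x 1 * c24p c x + x 3 * x 2 * c21p c x) /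
      ((x 4 * x 1 + x 3 * x 2) * c * c2p x),
    (c21p c x / c24p c x) * x 2,
    x 3 / c,
    x 4 * (x 4 * x 1 + x 3 * x 2) * c2p x /
      (x 4 * x 1 * c24p c x + x 3 * x 2 * c21p c x),
    (c2p x / c21p c x) * x 5]

def e : Fin 4 → ℝ → (Fin 6 → ℝ) → Fin 6 → ℝ := ![e0, e1, e2, e3]

def γ : Fin 4 → (Fin 6 → ℝ) → ℝ :=
  ![fun x => 1 / x 3 ^ 2,
    fun x => x 3 ^ 2 / (x 4 * x 1),
    fun x => x 4 ^ 2 * x 1 ^ 2 / (x 5 * x 2 * x 0 * x 3),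
    fun x => x 5 ^ 2 * x 2 ^ 2 * x 0 ^ 2 / (x 4 ^ 2 * x 1 ^ 2)]

def ε : Fin 4 → (Fin 6 → ℝ) → ℝ :=
  ![fun x => x 5 + (x 4 * x 1 + x 3 * x 2) ^ 2 / (x 1 ^ 2 * x 2) + x 3 ^ 2 / x 0,
    fun x => x 1 / x 3,
    fun x => (x 0 * x 1 * x 4 + x 0 * x 2 * x 3) / (x 1 ^ 2 * x 4),
    fun x => (x 0 * x 2 ^ 2 * x 5 + x 1 ^ 2 * x 2 * x 5 + x 1 ^ 2 * x 4 ^ 2) /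
      (x 0 ^ 2 * x 2 ^ 2 * x 5)]

/-- The Cartan matrix of `C_3^{(1)}`. -/
def A : Fin 4 → Fin 4 → ℤ :=
  ![![2, -1, 0, 0], ![-2, 2, -1, 0], ![0, -1, 2, -2], ![0, 0, -1, 2]]

theorem vec6_ext {a b : Fin 6 → ℝ} (h0 : a 0 = b 0) (h1 : a 1 = b 1) (h2 : a 2 = b 2)
    (h3 : a 3 = b 3) (h4 : a 4 = b 4) (h5 : a 5 = b 5) : a = b := by
  funext i; fin_cases i <;> assumption
set_option linter.all false

/-- The binary quadratic form attached to `(a, h, d)`, evaluated at `(1, s)`. -/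
def pp (a h d s : ℝ) : ℝ := a + 2 * h * s + d * s ^ 2
/-- Its twisted version. -/
def TT (k a h d s : ℝ) : ℝ := k * a + (k + 1) * h * s + d * s ^ 2
def aa (k a h d s : ℝ) : ℝ :=
  pp a h d s * (k * a * pp a h d s - (k - 1) * (a * d - h ^ 2) * s ^ 2) / TT k a h d s ^ 2
def hh (k a h d s : ℝ) : ℝ := k * h * pp a h d s ^ 2 / TT k a h d s ^ 2
def dd (k a h d s : ℝ) : ℝ :=
  k * pp a h d s * (d * pp a h d s + (k - 1) * (a * d - h ^ 2)) / TT k a h d s ^ 2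

theorem pp_pos {a h d s : ℝ} (ha : 0 < a) (hh : 0 < h) (hd : 0 < d) (hs : 0 < s) :
    0 < pp a h d s := by unfold pp; positivity

theorem TT_pos {k a h d s : ℝ} (hk : 0 < k) (ha : 0 < a) (hh : 0 < h) (hd : 0 < d) (hs : 0 < s) :
    0 < TT k a h d s := by unfold TT; positivity

theorem M_pos {a h d s c1 c2 : ℝ} (ha : 0 < a) (hh : 0 < h) (hd : 0 < d) (hs : 0 < s)
    (h1 : 0 < c1) (h2 : 0 < c2) (hD : 0 < a * d - h ^ 2) :
    0 < c2 * pp a h d s * pp a h d (c1 * s) + (c2 - 1) * (c1 ^ 2 * c2 - 1) *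
      (a * d - h ^ 2) * s ^ 2 := by
  have e : c2 * pp a h d s * pp a h d (c1 * s) + (c2 - 1) * (c1 ^ 2 * c2 - 1) *
      (a * d - h ^ 2) * s ^ 2 = c2 * (a + h * s) ^ 2 + (a * d - h ^ 2) * s ^ 2 +
      2 * c2 * h * pp a h d s * (c1 * s) + c2 * (c2 * (a * d - h ^ 2) + (h + d * s) ^ 2) *
      (c1 * s) ^ 2 := by unfold pp; ring
  have := pp_pos ha hh hd hs
  rw [e]; positivity

theorem pp_step (a h d s k l : ℝ) (hT : TT k a h d s ≠ 0) :
    pp (aa k a h d s) (hh k a h d s) (dd k a h d s) (l * s) = pp a h d s *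
      (k * pp a h d s * pp a h d (l * s) + (k - 1) * (l ^ 2 * k - 1) *
        (a * d - h ^ 2) * s ^ 2) / TT k a h d s ^ 2 := by
  rw [pp, aa, hh, dd]
  field_simp
  unfold pp
  ring

theorem TT_step (a h d s k l K : ℝ) (hT : TT k a h d s ≠ 0) :
    TT K (aa k a h d s) (hh k a h d s) (dd k a h d s) (l * s) = pp a h d s *
      (K * (k * a * pp a h d s - (k - 1) * (a * d - h ^ 2) * s ^ 2) +
        (K + 1) * k * h * pp a h d s * (l * s) +
        k * (d * pp a h d s + (k - 1) * (a * d - h ^ 2)) * (l * s) ^ 2) / TT k a h d s ^ 2 := by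
  rw [TT, aa, hh, dd]
  field_simp

/-- The rank two relation for the abstract dynamics. -/
theorem serre_alg {a h d s c1 c2 : ℝ} (ha : 0 < a) (hhp : 0 < h) (hd : 0 < d) (hs : 0 < s)
    (h1 : 0 < c1) (h2 : 0 < c2) (hD : 0 < a * d - h ^ 2) {p T p1 T1 p2 T2 p3 T3 K : ℝ}
    (hK : K = c1 ^ 2 * c2)
    (hp : p = pp a h d s) (hT : T = TT c2 a h d s)
    (hp2 : p2 = pp (aa c2 a h d s) (hh c2 a h d s) (dd c2 a h d s) (c1 * s))
    (hT2 : T2 = TT K (aa c2 a h d s) (hh c2 a h d s) (dd c2 a h d s) (c1 * s))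
    (hp1 : p1 = pp a h d (c1 * s)) (hT1 : T1 = TT K a h d (c1 * s))
    (hp3 : p3 = pp (aa K a h d (c1 * s)) (hh K a h d (c1 * s)) (dd K a h d (c1 * s)) s)
    (hT3 : T3 = TT c2 (aa K a h d (c1 * s)) (hh K a h d (c1 * s)) (dd K a h d (c1 * s)) s) :
    (c2 - 1) / p + (K - 1) / p2 = (K - 1) / p1 + (c2 - 1) / p3 ∧
    (1 - 1 / c2) * s ^ 2 / p + (1 - 1 / K) * (c1 * s) ^ 2 / p2 =
      (1 - 1 / K) * (c1 * s) ^ 2 / p1 + (1 - 1 / c2) * s ^ 2 / p3 ∧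
    T / p * (T2 / p2) = T1 / p1 * (T3 / p3) := by
  have hM := M_pos ha hhp hd hs h1 h2 hD
  have hKp : 0 < K := by rw [hK]; positivity
  have hs1 : 0 < c1 * s := by positivity
  have hpp : 0 < p := hp ▸ pp_pos ha hhp hd hs
  have hTp : 0 < T := hT ▸ TT_pos h2 ha hhp hd hs
  have hp1p : 0 < p1 := hp1 ▸ pp_pos ha hhp hd hs1
  have hT1p : 0 < T1 := hT1 ▸ TT_pos hKp ha hhp hd hs1
  rw [pp_step _ _ _ _ _ _ (hT ▸ hTp.ne'), ← hp, ← hT, ← hp1] at hp2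
  rw [TT_step _ _ _ _ _ _ _ (hT ▸ hTp.ne'), ← hp, ← hT] at hT2
  have es : (1 / c1) * (c1 * s) = s := by field_simp
  have hp3' : p3 = p1 * (c1 ^ 2 * (c2 * p * p1 + (c2 - 1) * (c1 ^ 2 * c2 - 1) *
      (a * d - h ^ 2) * s ^ 2)) / T1 ^ 2 := by
    have key := pp_step a h d (c1 * s) K (1 / c1) (hT1 ▸ hT1p.ne')
    rw [es, ← hp, ← hT1, ← hp1] at key
    rw [hp3, key, hK]
    field_simp
  have hT3' : T3 = p1 * (c2 * (K * a * p1 - (K - 1) * (a * d - h ^ 2) * (c1 * s) ^ 2) +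
        (c2 + 1) * K * h * p1 * s +
        K * (d * p1 + (K - 1) * (a * d - h ^ 2)) * s ^ 2) / T1 ^ 2 := by
    have key := TT_step a h d (c1 * s) K (1 / c1) c2 (hT1 ▸ hT1p.ne')
    rw [es, ← hT1, ← hp1] at key
    rw [hT3, key]
  rw [← hp, ← hp1] at hM
  clear hp3 hT3
  obtain ⟨M, hMd⟩ : ∃ M, M = c2 * p * p1 + (c2 - 1) * (c1 ^ 2 * c2 - 1) *
      (a * d - h ^ 2) * s ^ 2 := ⟨_, rfl⟩
  rw [← hMd] at hM hp3'
  have hp2' : p2 = p * M / T ^ 2 := by rw [hp2, hMd]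
  subst hp2' hT2 hT3' hp3'
  refine ⟨?_, ?_, ?_⟩
  · field_simp
    rw [hMd, hp, hp1, hT, hT1, hK]; unfold pp TT; ring
  · field_simp
    rw [hMd, hp, hp1, hT, hT1, hK]; unfold pp TT; ring
  · field_simp
    rw [hp, hp1, hT, hT1, hK]; unfold pp TT; ring

/-! ### Normal form of `e0` -/
def al0 (x : Fin 6 → ℝ) : ℝ := x 5 + x 4 ^ 2 / x 2
def h0 (x : Fin 6 → ℝ) : ℝ := x 4 / x 1
def de0 (x : Fin 6 → ℝ) : ℝ := x 2 / x 1 ^ 2 + 1 / x 0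
def p0 (x : Fin 6 → ℝ) : ℝ := pp (al0 x) (h0 x) (de0 x) (x 3)
def T0 (k : ℝ) (x : Fin 6 → ℝ) : ℝ := TT k (al0 x) (h0 x) (de0 x) (x 3)

def Pos (x : Fin 6 → ℝ) : Prop := ∀ i, 0 < x i

theorem pos_of {x : Fin 6 → ℝ} (h0 : 0 < x 0) (h1 : 0 < x 1) (h2 : 0 < x 2)
    (h3 : 0 < x 3) (h4 : 0 < x 4) (h5 : 0 < x 5) : Pos x := by
  intro i; fin_cases i <;> assumption

theorem e0_pos {x : Fin 6 → ℝ} (hx : Pos x) {c : ℝ} (hc : 0 < c) : Pos (e0 c x) := by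
  have h0 := hx 0; have h1 := hx 1; have h2 := hx 2
  have h3 := hx 3; have h4 := hx 4; have h5 := hx 5
  apply pos_of <;> simp [e0, c2p, c21p, c24p] <;> positivity
theorem e1_pos {x : Fin 6 → ℝ} (hx : Pos x) {c : ℝ} (hc : 0 < c) : Pos (e1 c x) := by
  have h0 := hx 0; have h1 := hx 1; have h2 := hx 2
  have h3 := hx 3; have h4 := hx 4; have h5 := hx 5
  apply pos_of <;> simp [e1] <;> positivity
theorem e2_pos {x : Fin 6 → ℝ} (hx : Pos x) {c : ℝ} (hc : 0 < c) : Pos (e2 c x) := by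
  have h0 := hx 0; have h1 := hx 1; have h2 := hx 2
  have h3 := hx 3; have h4 := hx 4; have h5 := hx 5
  apply pos_of <;> simp [e2, cc2] <;> positivity
theorem e3_pos {x : Fin 6 → ℝ} (hx : Pos x) {c : ℝ} (hc : 0 < c) : Pos (e3 c x) := by
  have h0 := hx 0; have h1 := hx 1; have h2 := hx 2
  have h3 := hx 3; have h4 := hx 4; have h5 := hx 5
  apply pos_of <;> simp [e3, c3, c31, c32] <;> positivity

theorem al0_pos {x : Fin 6 → ℝ} (hx : Pos x) : 0 < al0 x := by
  have h2 := hx 2; have h4 := hx 4; have h5 := hx 5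
  unfold al0; positivity
theorem h0_pos {x : Fin 6 → ℝ} (hx : Pos x) : 0 < h0 x := by
  have h1 := hx 1; have h4 := hx 4
  unfold h0; positivity
theorem de0_pos {x : Fin 6 → ℝ} (hx : Pos x) : 0 < de0 x := by
  have h1 := hx 1; have h2 := hx 2; have h0 := hx 0
  unfold de0; positivity
theorem D0_pos {x : Fin 6 → ℝ} (hx : Pos x) : 0 < al0 x * de0 x - h0 x ^ 2 := by
  have h0 := hx 0; have h1 := hx 1; have h2 := hx 2; have h4 := hx 4; have h5 := hx 5
  have : al0 x * de0 x - Stmt8.h0 x ^ 2 =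
      x 5 * (x 2 / x 1 ^ 2) + x 5 / x 0 + x 4 ^ 2 / (x 2 * x 0) := by
    unfold al0 de0 Stmt8.h0; field_simp; ring
  rw [this]; positivity
theorem p0_pos {x : Fin 6 → ℝ} (hx : Pos x) : 0 < p0 x :=
  pp_pos (al0_pos hx) (h0_pos hx) (de0_pos hx) (hx 3)
theorem T0_pos {x : Fin 6 → ℝ} (hx : Pos x) {k : ℝ} (hk : 0 < k) : 0 < T0 k x :=
  TT_pos hk (al0_pos hx) (h0_pos hx) (de0_pos hx) (hx 3)

theorem c2p_eq {x : Fin 6 → ℝ} (hx : Pos x) : c2p x = p0 x := by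
  have h0 := hx 0; have h1 := hx 1; have h2 := hx 2
  unfold c2p p0 pp al0 Stmt8.h0 de0; field_simp; ring
theorem c21p_eq {x : Fin 6 → ℝ} (hx : Pos x) (c : ℝ) :
    c21p c x = p0 x + (c - 1) * x 5 := by
  rw [← c2p_eq hx]; unfold c21p c2p; ring
theorem c24p_eq {x : Fin 6 → ℝ} (hx : Pos x) (c : ℝ) :
    c24p c x = c * p0 x - (c - 1) * x 3 ^ 2 / x 0 := by
  rw [← c2p_eq hx]; unfold c24p c2p; ring

theorem mix_eq {x : Fin 6 → ℝ} (hx : Pos x) (c : ℝ) :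
    x 4 * x 1 * c24p c x + x 3 * x 2 * c21p c x = (x 4 * x 1 + x 3 * x 2) * T0 c x := by
  have h0 := hx 0; have h1 := hx 1; have h2 := hx 2
  rw [c24p_eq hx, c21p_eq hx]
  unfold p0 T0 TT pp al0 Stmt8.h0 de0; field_simp; ring

section
variable {x : Fin 6 → ℝ} (hx : Pos x) {c : ℝ} (hc : 0 < c)

theorem e0_0 (hx : Pos x) (hc : 0 < c) :
    e0 c x 0 = x 0 - (1 - 1 / c) * x 3 ^ 2 / p0 x := by
  have := p0_pos hx; have h0 := hx 0
  simp [e0, c24p_eq hx, c2p_eq hx]; field_simp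
theorem e0_1 (hx : Pos x) (hc : 0 < c) : e0 c x 1 = x 1 / c * (T0 c x / p0 x) := by
  have := p0_pos hx; have h0 := hx 0; have h1 := hx 1; have h2 := hx 2
  have h3 := hx 3; have h4 := hx 4
  have := T0_pos hx hc
  simp [e0, mix_eq hx, c2p_eq hx]; field_simp
theorem e0_3 : e0 c x 3 = x 3 / c := by simp [e0]
theorem e0_4 (hx : Pos x) (hc : 0 < c) : e0 c x 4 = x 4 * p0 x / T0 c x := by
  have := p0_pos hx; have h0 := hx 0; have h1 := hx 1; have h2 := hx 2
  have h3 := hx 3; have h4 := hx 4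
  have := T0_pos hx hc
  simp [e0, mix_eq hx, c2p_eq hx]; field_simp
theorem e0_U (hx : Pos x) (hc : 0 < c) : e0 c x 4 * e0 c x 1 = x 4 * x 1 / c := by
  have := p0_pos hx
  have := T0_pos hx hc
  rw [e0_4 hx hc, e0_1 hx hc]; field_simp
theorem e0_5 (hx : Pos x) (hc : 0 < c) :
    1 / e0 c x 5 = 1 / x 5 + (c - 1) / p0 x := by
  have := p0_pos hx; have h5 := hx 5
  have h := e0_pos hx hc 5
  have e : e0 c x 5 = p0 x / (p0 x + (c - 1) * x 5) * x 5 := by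
    simp [e0, c21p_eq hx, c2p_eq hx]
  have : p0 x + (c - 1) * x 5 ≠ 0 := by
    intro h'; rw [e, h'] at h; simp at h
  rw [e]; field_simp
theorem e0_n (hx : Pos x) (hc : 0 < c) :
    e0 c x 0 * e0 c x 2 * e0 c x 5 = x 0 * x 2 * x 5 / c := by
  have h0 := hx 0; have h1 := hx 1; have h2 := hx 2
  have h3 := hx 3; have h4 := hx 4; have h5 := hx 5
  have k1 : 0 < c2p x := by unfold c2p; positivity
  have k2 : 0 < c21p c x := by unfold c21p; positivity
  have k3 : 0 < c24p c x := by unfold c24p; positivity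
  simp [e0]; field_simp
theorem e0_h (hx : Pos x) (hc : 0 < c) :
    h0 (e0 c x) = hh c (al0 x) (h0 x) (de0 x) (x 3) := by
  have h1 := hx 1
  have h2 := p0_pos hx
  have h3 := T0_pos hx hc
  rw [h0, e0_4 hx hc, e0_1 hx hc, hh, ← p0, ← T0, h0]; field_simp
theorem e0_al (hx : Pos x) (hc : 0 < c) :
    al0 (e0 c x) = aa c (al0 x) (h0 x) (de0 x) (x 3) := by
  have h0 := hx 0; have h1 := hx 1; have h2 := hx 2
  have h3 := hx 3; have h4 := hx 4; have h5 := hx 5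
  have k1 := p0_pos hx
  have k3 := T0_pos hx hc
  have k2 : 0 < c21p c x := by unfold c21p; positivity
  have k4 : 0 < c24p c x := by unfold c24p; positivity
  rw [aa, ← p0, ← T0, al0, e0_4 hx hc]
  simp [e0, c2p_eq hx]
  field_simp
  rw [c21p_eq hx, c24p_eq hx]
  unfold p0 T0 TT pp al0 Stmt8.h0 de0; field_simp; ring
theorem e0_de (hx : Pos x) (hc : 0 < c) :
    de0 (e0 c x) = dd c (al0 x) (h0 x) (de0 x) (x 3) := by
  have h0 := hx 0; have h1 := hx 1; have h2 := hx 2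
  have h3 := hx 3; have h4 := hx 4; have h5 := hx 5
  have k1 := p0_pos hx
  have k3 := T0_pos hx hc
  have k2 : 0 < c21p c x := by unfold c21p; positivity
  have k4 : 0 < c24p c x := by unfold c24p; positivity
  rw [dd, ← p0, ← T0, de0, e0_1 hx hc]
  simp [e0, c2p_eq hx]
  field_simp
  rw [c21p_eq hx, c24p_eq hx]
  unfold p0 T0 TT pp al0 Stmt8.h0 de0; field_simp; ring
end

/-- Two positive points agree as soon as these six functions agree. -/
theorem ext0 {x y : Fin 6 → ℝ} (hx : Pos x) (hy : Pos y) (e0 : x 0 = y 0) (e1 : x 1 = y 1)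
    (e3 : x 3 = y 3) (e5 : 1 / x 5 = 1 / y 5) (eU : x 4 * x 1 = y 4 * y 1)
    (en : x 0 * x 2 * x 5 = y 0 * y 2 * y 5) : x = y := by
  have e5' : x 5 = y 5 := by simpa using e5
  rw [e1] at eU
  rw [e0, e5'] at en
  exact vec6_ext e0 e1 (mul_left_cancel₀ (hy 0).ne' (mul_right_cancel₀ (hy 5).ne' en)) e3
    (mul_right_cancel₀ (hy 1).ne' eU) e5'

theorem serre10 {x : Fin 6 → ℝ} (hx : Pos x) {c1 c2 : ℝ} (h1 : 0 < c1) (h2 : 0 < c2) :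
    e1 c1 (e0 (c1 ^ 2 * c2) (e1 (c1 * c2) (e0 c2 x))) =
      e0 c2 (e1 (c1 * c2) (e0 (c1 ^ 2 * c2) (e1 c1 x))) := by
  have hKp : 0 < c1 ^ 2 * c2 := by positivity
  have h12 : 0 < c1 * c2 := by positivity
  have f0 : ∀ (k : ℝ) y, e1 k y 0 = y 0 := fun _ _ => rfl
  have f1 : ∀ (k : ℝ) y, e1 k y 1 = y 1 := fun _ _ => rfl
  have f2 : ∀ (k : ℝ) y, e1 k y 2 = y 2 := fun _ _ => rfl
  have f3 : ∀ (k : ℝ) y, e1 k y 3 = k * y 3 := fun _ _ => rfl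
  have f4 : ∀ (k : ℝ) y, e1 k y 4 = y 4 := fun _ _ => rfl
  have f5 : ∀ (k : ℝ) y, e1 k y 5 = y 5 := fun _ _ => rfl
  have fa : ∀ (k : ℝ) y, al0 (e1 k y) = al0 y := fun _ _ => rfl
  have fh : ∀ (k : ℝ) y, h0 (e1 k y) = h0 y := fun _ _ => rfl
  have fd : ∀ (k : ℝ) y, de0 (e1 k y) = de0 y := fun _ _ => rfl
  have y1 := e0_pos hx h2
  have y2 := e1_pos y1 h12
  have y3 := e0_pos y2 hKp
  have y4 := e1_pos y3 h1
  have z1 := e1_pos hx h1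
  have z2 := e0_pos z1 hKp
  have z3 := e1_pos z2 h12
  have z4 := e0_pos z3 h2
  have s2 : e1 (c1 * c2) (e0 c2 x) 3 = c1 * x 3 := by rw [f3, e0_3]; field_simp
  have s3 : e1 (c1 * c2) (e0 (c1 ^ 2 * c2) (e1 c1 x)) 3 = x 3 := by
    rw [f3, e0_3, f3]; field_simp
  obtain ⟨hA, hB, hC⟩ := serre_alg (al0_pos hx) (h0_pos hx) (de0_pos hx) (hx 3) h1 h2 (D0_pos hx)
    (p := p0 x) (T := T0 c2 x)
    (p2 := p0 (e1 (c1 * c2) (e0 c2 x)))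
    (T2 := T0 (c1 ^ 2 * c2) (e1 (c1 * c2) (e0 c2 x)))
    (p1 := p0 (e1 c1 x)) (T1 := T0 (c1 ^ 2 * c2) (e1 c1 x))
    (p3 := p0 (e1 (c1 * c2) (e0 (c1 ^ 2 * c2) (e1 c1 x))))
    (T3 := T0 c2 (e1 (c1 * c2) (e0 (c1 ^ 2 * c2) (e1 c1 x))))
    rfl rfl rfl
    (by rw [p0, s2, fa, fh, fd, e0_al hx h2, e0_h hx h2, e0_de hx h2])
    (by rw [T0, s2, fa, fh, fd, e0_al hx h2, e0_h hx h2, e0_de hx h2])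
    rfl rfl
    (by rw [p0, s3, fa, fh, fd, e0_al z1 hKp, e0_h z1 hKp, e0_de z1 hKp, fa, fh, fd, f3])
    (by rw [T0, s3, fa, fh, fd, e0_al z1 hKp, e0_h z1 hKp, e0_de z1 hKp, fa, fh, fd, f3])
  apply ext0 y4 z4
  · rw [f0, e0_0 y2 hKp, f0, e0_0 hx h2, e0_0 z3 h2, f0, e0_0 z1 hKp, f0, s2, s3, f3]
    linarith
  · rw [f1, e0_1 y2 hKp, f1, e0_1 hx h2, e0_1 z3 h2, f1, e0_1 z1 hKp, f1]
    linear_combination (x 1 / (c1 ^ 2 * c2 * c2)) * hC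
  · rw [f3, e0_3, s2, e0_3, s3]; field_simp
  · rw [f5, e0_5 y2 hKp, f5, e0_5 hx h2, e0_5 z3 h2, f5, e0_5 z1 hKp, f5]
    linarith
  · rw [f1, f4, e0_U y2 hKp, f1, f4, e0_U hx h2, e0_U z3 h2, f1, f4, e0_U z1 hKp, f1, f4]
    field_simp
  · rw [f0, f2, f5, e0_n y2 hKp, f0, f2, f5, e0_n hx h2, e0_n z3 h2, f0, f2, f5, e0_n z1 hKp,
      f0, f2, f5]
    field_simp

theorem hom0 {x : Fin 6 → ℝ} (hx : Pos x) {c1 c2 : ℝ} (h1 : 0 < c1) (h2 : 0 < c2) :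
    e0 (c1 * c2) x = e0 c1 (e0 c2 x) := by
  have h12 : 0 < c1 * c2 := by positivity
  have y1 := e0_pos hx h2
  have k1 := p0_pos hx
  have k2 := T0_pos hx h2
  have hp : p0 (e0 c2 x) = p0 x / c2 := by
    have key := pp_step (al0 x) (h0 x) (de0 x) (x 3) c2 (1 / c2) k2.ne'
    rw [p0, e0_al hx h2, e0_h hx h2, e0_de hx h2, e0_3, show x 3 / c2 = 1 / c2 * x 3 by ring, key,
      ← T0, ← p0, div_eq_div_iff (by positivity) (by positivity)]
    unfold p0 T0 TT pp; field_simp; ring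
  have hT : T0 c1 (e0 c2 x) = p0 x * T0 (c1 * c2) x / (c2 * T0 c2 x) := by
    have key := TT_step (al0 x) (h0 x) (de0 x) (x 3) c2 (1 / c2) c1 k2.ne'
    rw [T0, e0_al hx h2, e0_h hx h2, e0_de hx h2, e0_3, show x 3 / c2 = 1 / c2 * x 3 by ring, key,
      ← T0, ← p0, div_eq_div_iff (by positivity) (by positivity)]
    unfold p0 T0 TT pp; field_simp; ring
  apply ext0 (e0_pos hx h12) (e0_pos y1 h1)
  · rw [e0_0 y1 h1, e0_0 hx h2, e0_0 hx h12, e0_3, hp]; field_simp; ring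
  · rw [e0_1 y1 h1, e0_1 hx h2, e0_1 hx h12, hp, hT]; field_simp
  · rw [e0_3, e0_3, e0_3]; field_simp
  · rw [e0_5 y1 h1, e0_5 hx h2, e0_5 hx h12, hp]; field_simp; ring
  · rw [e0_U y1 h1, e0_U hx h2, e0_U hx h12]; field_simp
  · rw [e0_n y1 h1, e0_n hx h2, e0_n hx h12]; field_simp

/-! ### Normal form of `e3` -/
/-- Invariant of `e2`. -/
def om (x : Fin 6 → ℝ) : ℝ := (x 4 * x 1 + x 2 * x 3) / x 1 * x 0
def al3 (x : Fin 6 → ℝ) : ℝ := 1 / x 0 + x 3 ^ 2 * x 2 / om x ^ 2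
def h3 (x : Fin 6 → ℝ) : ℝ := x 3 * x 2 * x 5 * x 0 / om x ^ 2
def de3 (x : Fin 6 → ℝ) : ℝ := x 5 + x 0 ^ 2 * x 2 * x 5 ^ 2 / om x ^ 2
def s3 (x : Fin 6 → ℝ) : ℝ := x 4 * x 1 / (x 0 * x 2 * x 5)
def p3 (x : Fin 6 → ℝ) : ℝ := pp (al3 x) (h3 x) (de3 x) (s3 x)
def T3 (k : ℝ) (x : Fin 6 → ℝ) : ℝ := TT k (al3 x) (h3 x) (de3 x) (s3 x)

section
variable {x : Fin 6 → ℝ} {c : ℝ}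

theorem om_pos (hx : Pos x) : 0 < om x := by
  have h0 := hx 0; have h1 := hx 1; have h2 := hx 2
  have h3 := hx 3; have h4 := hx 4
  unfold om; positivity
theorem al3_pos (hx : Pos x) : 0 < al3 x := by
  have h0 := hx 0; have h2 := hx 2; have h3 := hx 3; have := om_pos hx
  unfold al3; positivity
theorem h3_pos (hx : Pos x) : 0 < h3 x := by
  have h0 := hx 0; have h2 := hx 2; have h3 := hx 3; have h5 := hx 5; have := om_pos hx
  unfold Stmt8.h3; positivity
theorem de3_pos (hx : Pos x) : 0 < de3 x := by
  have h0 := hx 0; have h2 := hx 2; have h3 := hx 3; have h5 := hx 5; have := om_pos hx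
  unfold de3; positivity
theorem s3_pos (hx : Pos x) : 0 < s3 x := by
  have h0 := hx 0; have h1 := hx 1; have h2 := hx 2; have h4 := hx 4; have h5 := hx 5
  unfold s3; positivity
theorem D3_pos (hx : Pos x) : 0 < al3 x * de3 x - h3 x ^ 2 := by
  have h0 := hx 0; have h2 := hx 2; have h3 := hx 3; have h5 := hx 5; have := om_pos hx
  have : al3 x * de3 x - Stmt8.h3 x ^ 2 = x 5 / x 0 + x 0 * x 2 * x 5 ^ 2 / om x ^ 2 +
      x 3 ^ 2 * x 2 * x 5 / om x ^ 2 := by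
    unfold al3 de3 Stmt8.h3; field_simp; ring
  rw [this]; positivity
theorem p3_pos (hx : Pos x) : 0 < p3 x :=
  pp_pos (al3_pos hx) (h3_pos hx) (de3_pos hx) (s3_pos hx)
theorem T3_pos (hx : Pos x) {k : ℝ} (hk : 0 < k) : 0 < T3 k x :=
  TT_pos hk (al3_pos hx) (h3_pos hx) (de3_pos hx) (s3_pos hx)

theorem c3_eq (hx : Pos x) : c3 x = p3 x * (x 0 ^ 2 * x 2 ^ 2 * x 5) := by
  have h0 := hx 0; have h1 := hx 1; have h2 := hx 2
  have h3 := hx 3; have h4 := hx 4; have h5 := hx 5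
  unfold c3 p3 pp al3 Stmt8.h3 de3 s3 om; field_simp; ring
theorem c31_eq (hx : Pos x) (c : ℝ) :
    c31 c x = (p3 x * x 0 + (c - 1)) * (x 0 * x 2 ^ 2 * x 5) := by
  have h := c3_eq hx
  unfold c3 at h; unfold c31
  linear_combination h
theorem c32_eq (hx : Pos x) (c : ℝ) :
    c32 c x = (c * p3 x - (c - 1) * s3 x ^ 2 * x 5) * (x 0 ^ 2 * x 2 ^ 2 * x 5) := by
  have h0 := hx 0; have h2 := hx 2; have h5 := hx 5
  have h := c3_eq hx
  have h' : x 1 ^ 2 * x 4 ^ 2 = s3 x ^ 2 * x 5 * (x 0 ^ 2 * x 2 ^ 2 * x 5) := by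
    unfold s3; field_simp
  unfold c3 at h; unfold c32
  linear_combination c * h - (c - 1) * h'

theorem e3_0 (hx : Pos x) (hc : 0 < c) : e3 c x 0 = x 0 + (c - 1) / p3 x := by
  have := p3_pos hx; have h0 := hx 0; have h2 := hx 2; have h5 := hx 5
  simp [e3, c31_eq hx, c3_eq hx]; field_simp
theorem e3_1 : e3 c x 1 = x 1 := rfl
theorem e3_2 (hx : Pos x) (hc : 0 < c) : e3 c x 2 =
    x 2 * x 0 * (c * p3 x - (c - 1) * s3 x ^ 2 * x 5) / (p3 x * x 0 + (c - 1)) := by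
  have h0 := hx 0; have h1 := hx 1; have h2 := hx 2; have h4 := hx 4; have h5 := hx 5
  have k2 : 0 < c31 c x := by unfold c31; positivity
  rw [c31_eq hx] at k2
  have k5 : 0 < p3 x * x 0 + (c - 1) := pos_of_mul_pos_left k2 (by positivity)
  simp [e3, c31_eq hx, c32_eq hx]; field_simp
theorem e3_3 : e3 c x 3 = x 3 := rfl
theorem e3_4 : e3 c x 4 = x 4 := rfl
theorem e3_5 (hx : Pos x) (hc : 0 < c) :
    1 / e3 c x 5 = 1 / x 5 - (1 - 1 / c) * s3 x ^ 2 / p3 x := by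
  have := p3_pos hx; have h0 := hx 0; have h2 := hx 2; have h5 := hx 5
  have h := e3_pos hx hc 5
  have e : e3 c x 5 = c * p3 x / (c * p3 x - (c - 1) * s3 x ^ 2 * x 5) * x 5 := by
    simp [e3, c32_eq hx, c3_eq hx]; left; field_simp
  have : c * p3 x - (c - 1) * s3 x ^ 2 * x 5 ≠ 0 := by
    intro h'; rw [e, h'] at h; simp at h
  rw [e]; field_simp
theorem e3_n (hx : Pos x) (hc : 0 < c) :
    e3 c x 0 * e3 c x 2 * e3 c x 5 = c * (x 0 * x 2 * x 5) := by
  have h0 := hx 0; have h1 := hx 1; have h2 := hx 2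
  have h3 := hx 3; have h4 := hx 4; have h5 := hx 5
  have k1 : 0 < c3 x := by unfold c3; positivity
  have k2 : 0 < c31 c x := by unfold c31; positivity
  have k3 : 0 < c32 c x := by unfold c32; positivity
  simp [e3]; field_simp
theorem e3_om (hx : Pos x) (hc : 0 < c) : om (e3 c x) = om x * (T3 c x / p3 x) := by
  have h0 := hx 0; have h1 := hx 1; have h2 := hx 2
  have h3 := hx 3; have h4 := hx 4; have h5 := hx 5
  have k0 := p3_pos hx
  have k1 : 0 < c3 x := by unfold c3; positivity
  have k2 : 0 < c31 c x := by unfold c31; positivity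
  have k3 : p3 x = c3 x / (x 0 ^ 2 * x 2 ^ 2 * x 5) := by rw [c3_eq hx]; field_simp
  rw [k3]
  unfold om
  simp [e3]
  field_simp
  unfold T3 TT c31 c32 al3 de3 Stmt8.h3 s3 om
  field_simp
  ring
theorem e3_s (hx : Pos x) (hc : 0 < c) : s3 (e3 c x) = s3 x / c := by
  have h0 := hx 0; have h2 := hx 2; have h5 := hx 5
  rw [s3, e3_n hx hc, e3_1, e3_4, s3]; field_simp
theorem e3_h (hx : Pos x) (hc : 0 < c) :
    h3 (e3 c x) = hh c (al3 x) (h3 x) (de3 x) (s3 x) := by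
  have h2 := p3_pos hx
  have h3 := T3_pos hx hc
  have h4 := om_pos hx
  have hn := e3_n hx hc
  rw [hh, ← p3, ← T3, Stmt8.h3, e3_om hx hc, e3_3, Stmt8.h3]
  field_simp
  linear_combination x 3 * hn
theorem e3_al (hx : Pos x) (hc : 0 < c) :
    al3 (e3 c x) = aa c (al3 x) (h3 x) (de3 x) (s3 x) := by
  have h0 := hx 0; have h1 := hx 1; have h2 := hx 2
  have h3 := hx 3; have h4 := hx 4; have h5 := hx 5
  have k0 := om_pos hx
  have k1 := p3_pos hx
  have k3 := T3_pos hx hc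
  have k2 : 0 < c31 c x := by unfold c31; positivity
  rw [c31_eq hx] at k2
  have k5 : 0 < p3 x * x 0 + (c - 1) := pos_of_mul_pos_left k2 (by positivity)
  have e00 : e3 c x 0 = (p3 x * x 0 + (c - 1)) / p3 x := by rw [e3_0 hx hc]; field_simp
  rw [aa, ← p3, ← T3, al3, e3_om hx hc]
  simp only [e00, e3_2 hx hc, e3_3]
  field_simp
  unfold p3 T3 TT pp al3 Stmt8.h3 de3
  generalize s3 x = s
  field_simp
  ring
theorem e3_de (hx : Pos x) (hc : 0 < c) :
    de3 (e3 c x) = dd c (al3 x) (h3 x) (de3 x) (s3 x) := by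
  have h0 := hx 0; have h1 := hx 1; have h2 := hx 2
  have h3 := hx 3; have h4 := hx 4; have h5 := hx 5
  have k0 := om_pos hx
  have k1 := p3_pos hx
  have k3 := T3_pos hx hc
  have k2 : 0 < c32 c x := by unfold c32; positivity
  rw [c32_eq hx] at k2
  have k5 : 0 < c * p3 x - (c - 1) * s3 x ^ 2 * x 5 := pos_of_mul_pos_left k2 (by positivity)
  have e : e3 c x 5 = c * p3 x / (c * p3 x - (c - 1) * s3 x ^ 2 * x 5) * x 5 := by
    simp [e3, c32_eq hx, c3_eq hx]; left; field_simp
  have en : e3 c x 0 ^ 2 * e3 c x 2 * e3 c x 5 ^ 2 =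
      c * (x 0 * x 2 * x 5) * (e3 c x 0 * e3 c x 5) := by rw [← e3_n hx hc]; ring
  rw [dd, ← p3, ← T3, de3, e3_om hx hc, en, e, e3_0 hx hc]
  field_simp
  unfold p3 T3 TT pp al3 Stmt8.h3 de3
  generalize s3 x = s
  field_simp
  ring
end

/-- Two positive points agree as soon as these six functions agree. -/
theorem ext3 {x y : Fin 6 → ℝ} (hx : Pos x) (hy : Pos y) (e0 : x 0 = y 0) (eo : om x = om y)
    (e3 : x 3 = y 3) (e5 : 1 / x 5 = 1 / y 5) (eU : x 4 * x 1 = y 4 * y 1)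
    (en : x 0 * x 2 * x 5 = y 0 * y 2 * y 5) : x = y := by
  have e5' : x 5 = y 5 := by simpa using e5
  have en' := en
  rw [e0, e5'] at en'
  have e2 : x 2 = y 2 := mul_left_cancel₀ (hy 0).ne' (mul_right_cancel₀ (hy 5).ne' en')
  refine ext0 hx hy e0 ?_ e3 e5 eU en
  have k0 := hy 0; have k1 := hy 1; have k2 := hy 2; have k3 := hy 3; have k4 := hy 4
  have k5 := hx 1
  unfold om at eo
  rw [e0, eU, e2, e3] at eo
  have hw : 0 < y 4 * y 1 + y 2 * y 3 := by positivity
  field_simp at eo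
  exact eo.symm

theorem e2_om {x : Fin 6 → ℝ} (hx : Pos x) {c : ℝ} (hc : 0 < c) : om (e2 c x) = om x := by
  have h0 := hx 0; have h1 := hx 1; have h2 := hx 2
  have h3 := hx 3; have h4 := hx 4
  simp [om, e2, cc2]; left; field_simp
theorem e2_U {x : Fin 6 → ℝ} (hx : Pos x) {c : ℝ} (hc : 0 < c) :
    e2 c x 4 * e2 c x 1 = c * (x 4 * x 1) := by
  have h0 := hx 0; have h1 := hx 1; have h2 := hx 2
  have h3 := hx 3; have h4 := hx 4
  simp [e2, cc2]; field_simp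

theorem serre23 {x : Fin 6 → ℝ} (hx : Pos x) {c1 c2 : ℝ} (h1 : 0 < c1) (h2 : 0 < c2) :
    e2 c1 (e3 (c1 ^ 2 * c2) (e2 (c1 * c2) (e3 c2 x))) =
      e3 c2 (e2 (c1 * c2) (e3 (c1 ^ 2 * c2) (e2 c1 x))) := by
  have hKp : 0 < c1 ^ 2 * c2 := by positivity
  have h12 : 0 < c1 * c2 := by positivity
  have f0 : ∀ (k : ℝ) y, e2 k y 0 = y 0 := fun _ _ => rfl
  have f2 : ∀ (k : ℝ) y, e2 k y 2 = y 2 := fun _ _ => rfl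
  have f3 : ∀ (k : ℝ) y, e2 k y 3 = y 3 := fun _ _ => rfl
  have f5 : ∀ (k : ℝ) y, e2 k y 5 = y 5 := fun _ _ => rfl
  have fs : ∀ {k : ℝ} {y}, Pos y → 0 < k → s3 (e2 k y) = k * s3 y := by
    intro k y hy hk
    rw [s3, e2_U hy hk, f0, f2, f5, s3]; ring
  have fa : ∀ {k : ℝ} {y}, Pos y → 0 < k → al3 (e2 k y) = al3 y := by
    intro k y hy hk
    rw [al3, e2_om hy hk, f0, f2, f3, al3]
  have fh : ∀ {k : ℝ} {y}, Pos y → 0 < k → h3 (e2 k y) = h3 y := by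
    intro k y hy hk
    rw [h3, e2_om hy hk, f0, f2, f3, f5, h3]
  have fd : ∀ {k : ℝ} {y}, Pos y → 0 < k → de3 (e2 k y) = de3 y := by
    intro k y hy hk
    rw [de3, e2_om hy hk, f0, f2, f5, de3]
  have y1 := e3_pos hx h2
  have y2 := e2_pos y1 h12
  have y3 := e3_pos y2 hKp
  have y4 := e2_pos y3 h1
  have z1 := e2_pos hx h1
  have z2 := e3_pos z1 hKp
  have z3 := e2_pos z2 h12
  have z4 := e3_pos z3 h2
  have s2' : s3 (e2 (c1 * c2) (e3 c2 x)) = c1 * s3 x := by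
    rw [fs y1 h12, e3_s hx h2]; field_simp
  have s3' : s3 (e2 (c1 * c2) (e3 (c1 ^ 2 * c2) (e2 c1 x))) = s3 x := by
    rw [fs z2 h12, e3_s z1 hKp, fs hx h1]; field_simp
  have s1' := fs hx h1
  obtain ⟨hA, hB, hC⟩ := serre_alg (al3_pos hx) (h3_pos hx) (de3_pos hx) (s3_pos hx) h1 h2
    (D3_pos hx)
    (p := p3 x) (T := T3 c2 x)
    (p2 := p3 (e2 (c1 * c2) (e3 c2 x)))
    (T2 := T3 (c1 ^ 2 * c2) (e2 (c1 * c2) (e3 c2 x)))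
    (p1 := p3 (e2 c1 x)) (T1 := T3 (c1 ^ 2 * c2) (e2 c1 x))
    (p3 := p3 (e2 (c1 * c2) (e3 (c1 ^ 2 * c2) (e2 c1 x))))
    (T3 := T3 c2 (e2 (c1 * c2) (e3 (c1 ^ 2 * c2) (e2 c1 x))))
    rfl rfl rfl
    (by rw [p3, s2', fa y1 h12, fh y1 h12, fd y1 h12, e3_al hx h2, e3_h hx h2, e3_de hx h2])
    (by rw [T3, s2', fa y1 h12, fh y1 h12, fd y1 h12, e3_al hx h2, e3_h hx h2, e3_de hx h2])
    (by rw [p3, s1', fa hx h1, fh hx h1, fd hx h1])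
    (by rw [T3, s1', fa hx h1, fh hx h1, fd hx h1])
    (by rw [p3, s3', fa z2 h12, fh z2 h12, fd z2 h12, e3_al z1 hKp, e3_h z1 hKp, e3_de z1 hKp,
          fa hx h1, fh hx h1, fd hx h1, s1'])
    (by rw [T3, s3', fa z2 h12, fh z2 h12, fd z2 h12, e3_al z1 hKp, e3_h z1 hKp, e3_de z1 hKp,
          fa hx h1, fh hx h1, fd hx h1, s1'])
  apply ext3 y4 z4
  · rw [f0, e3_0 y2 hKp, f0, e3_0 hx h2, e3_0 z3 h2, f0, e3_0 z1 hKp, f0]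
    linarith
  · rw [e2_om y3 h1, e3_om y2 hKp, e2_om y1 h12, e3_om hx h2, e3_om z3 h2, e2_om z2 h12,
      e3_om z1 hKp, e2_om hx h1]
    linear_combination om x * hC
  · rw [f3, e3_3, f3, e3_3, e3_3, f3, e3_3, f3]
  · rw [f5, e3_5 y2 hKp, f5, e3_5 hx h2, e3_5 z3 h2, f5, e3_5 z1 hKp, f5, s2', s3', s1']
    linarith
  · rw [e2_U y3 h1, e3_1, e3_4, e2_U y1 h12, e3_1, e3_4, e3_1, e3_4, e2_U z2 h12, e3_1, e3_4,
      e2_U hx h1]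
    ring
  · rw [f0, f2, f5, e3_n y2 hKp, f0, f2, f5, e3_n hx h2, e3_n z3 h2, f0, f2, f5, e3_n z1 hKp,
      f0, f2, f5]
    ring

/-! ### Commutation of `e0` with `e2` and `e3` -/
theorem p0_e3 {x : Fin 6 → ℝ} (hx : Pos x) {c : ℝ} (hc : 0 < c) : p0 (e3 c x) = p0 x := by
  have h0 := hx 0; have h1 := hx 1; have h2 := hx 2
  have h3 := hx 3; have h4 := hx 4; have h5 := hx 5
  rw [← c2p_eq hx, ← c2p_eq (e3_pos hx hc)]
  simp [e3, c2p, c3, c31, c32]; field_simp; ring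
theorem T0_e3 {x : Fin 6 → ℝ} (hx : Pos x) {c k : ℝ} (hc : 0 < c) : T0 k (e3 c x) = T0 k x := by
  have h0 := hx 0; have h1 := hx 1; have h2 := hx 2
  have h3 := hx 3; have h4 := hx 4; have h5 := hx 5
  have e : ∀ y, T0 k y = p0 y + (k - 1) * (al0 y + Stmt8.h0 y * y 3) := by
    intro y; unfold T0 TT p0 pp; ring
  have e' : al0 (e3 c x) + Stmt8.h0 (e3 c x) * e3 c x 3 = al0 x + Stmt8.h0 x * x 3 := by
    simp [al0, Stmt8.h0, e3, c3, c31, c32]; field_simp; ring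
  rw [e, e', p0_e3 hx hc, ← e]
theorem p3_eq {x : Fin 6 → ℝ} (hx : Pos x) : p3 x = ε 3 x := by
  have h0 := hx 0; have h2 := hx 2; have h5 := hx 5
  have h := c3_eq hx
  unfold c3 at h
  simp [ε]
  field_simp
  linear_combination - h

theorem comm03 {x : Fin 6 → ℝ} (hx : Pos x) {k c : ℝ} (hk : 0 < k) (hc : 0 < c)
    (hε : ε 3 (e0 k x) = ε 3 x) : e0 k (e3 c x) = e3 c (e0 k x) := by
  have y1 := e0_pos hx hk
  have z1 := e3_pos hx hc
  rw [← p3_eq hx, ← p3_eq y1] at hε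
  have hs : s3 (e0 k x) = s3 x := by
    have h0 := hx 0; have h2 := hx 2; have h5 := hx 5
    rw [s3, e0_U hx hk, e0_n hx hk, s3]; field_simp
  apply ext0 (e0_pos z1 hk) (e3_pos y1 hc)
  · rw [e0_0 z1 hk, e3_0 hx hc, e3_0 y1 hc, e0_0 hx hk, p0_e3 hx hc, hε, e3_3]; ring
  · rw [e0_1 z1 hk, e3_1, e3_1, e0_1 hx hk, p0_e3 hx hc, T0_e3 hx hc]
  · rw [e0_3, e3_3, e3_3, e0_3]
  · rw [e0_5 z1 hk, e3_5 hx hc, e3_5 y1 hc, e0_5 hx hk, p0_e3 hx hc, hε, hs]; ring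
  · rw [e0_U z1 hk, e3_1, e3_4, e3_1, e3_4, e0_U hx hk]
  · rw [e0_n z1 hk, e3_n hx hc, e3_n y1 hc, e0_n hx hk]; ring

theorem comm02 {x : Fin 6 → ℝ} (hx : Pos x) {k c : ℝ} (hk : 0 < k) (hc : 0 < c) :
    e0 k (e2 c x) = e2 c (e0 k x) := by
  have h0 := hx 0; have h1 := hx 1; have h2 := hx 2
  have h3 := hx 3; have h4 := hx 4; have h5 := hx 5
  have y1 := e0_pos hx hk
  have z1 := e2_pos hx hc
  have f0 : ∀ (k : ℝ) y, e2 k y 0 = y 0 := fun _ _ => rfl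
  have f2 : ∀ (k : ℝ) y, e2 k y 2 = y 2 := fun _ _ => rfl
  have f3 : ∀ (k : ℝ) y, e2 k y 3 = y 3 := fun _ _ => rfl
  have f5 : ∀ (k : ℝ) y, e2 k y 5 = y 5 := fun _ _ => rfl
  have ep : p0 (e2 c x) = p0 x := by
    rw [← c2p_eq hx, ← c2p_eq z1]
    simp [e2, c2p, cc2]; field_simp; ring
  have eo : ∀ {y}, Pos y → om (e0 k y) = om y / k := by
    intro y hy
    have h0 := hy 0; have h1 := hy 1; have h2 := hy 2
    have h3 := hy 3; have h4 := hy 4; have h5 := hy 5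
    have k1 := p0_pos hy
    have k2 := T0_pos hy hk
    have k3 : 0 < c24p k y := by unfold c24p; positivity
    have e := mix_eq hy k
    have e2 : e0 k y 2 = c21p k y / c24p k y * y 2 := rfl
    have e00 : e0 k y 0 = c24p k y / (k * p0 y) * y 0 := by rw [← c2p_eq hy]; rfl
    rw [om, e0_U hy hk, e0_1 hy hk, e0_3, e2, e00, om]
    field_simp
    linear_combination e
  apply ext3 (e0_pos z1 hk) (e2_pos y1 hc)
  · rw [e0_0 z1 hk, f0, f0, e0_0 hx hk, ep, f3]
  · rw [eo z1, e2_om hx hc, e2_om y1 hc, eo hx]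
  · rw [e0_3, f3, f3, e0_3]
  · rw [e0_5 z1 hk, f5, f5, e0_5 hx hk, ep]
  · rw [e0_U z1 hk, e2_U hx hc, e2_U y1 hc, e0_U hx hk]; ring
  · rw [e0_n z1 hk, f0, f2, f5, f0, f2, f5, e0_n hx hk]

set_option maxHeartbeats 1000000

theorem gam (x : Fin 6 → ℝ) (hx : ∀ i, 0 < x i) (c : ℝ) (hc : 0 < c) (i j : Fin 4) :
    γ j (e i c x) = c ^ (A i j) * γ j x := by
  have h0 := hx 0; have h1 := hx 1; have h2 := hx 2
  have h3 := hx 3; have h4 := hx 4; have h5 := hx 5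
  have k1 : 0 < c2p x := by unfold c2p; positivity
  have k2 : 0 < c21p c x := by unfold c21p; positivity
  have k3 : 0 < c24p c x := by unfold c24p; positivity
  have k4 : 0 < cc2 c x := by unfold cc2; positivity
  have k5 : 0 < c3 x := by unfold c3; positivity
  have k6 : 0 < c31 c x := by unfold c31; positivity
  have k7 : 0 < c32 c x := by unfold c32; positivity
  have k8 : 0 < x 4 * x 1 + x 3 * x 2 := by positivity
  have k9 : 0 < x 4 * x 1 * c24p c x + x 3 * x 2 * c21p c x := by positivity
  fin_cases i <;> fin_cases j <;> simp [γ, e, A, e0, e1, e2, e3] <;> field_simp 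

theorem hom123 (x : Fin 6 → ℝ) (hx : ∀ i, 0 < x i) (c1 c2 : ℝ) (hc1 : 0 < c1) (hc2 : 0 < c2) (i : Fin 4) (hi : i ≠ 0) :
   e i (c1 * c2) x = e i c1 (e i c2 x) := by
  have h0 := hx 0; have h1 := hx 1; have h2 := hx 2
  have h3 := hx 3; have h4 := hx 4; have h5 := hx 5
  fin_cases i 
  · simp at hi
  all_goals apply vec6_ext <;> simp [ e, e0, e1, e2, e3,c2p,c21p,c24p,cc2,c3,c31,c32] <;> field_simp <;> ring

theorem eps02 (x : Fin 6 → ℝ) (hx : ∀ i, 0 < x i) (c : ℝ) (hc : 0 < c)  :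
    ε 0 (e2 c x) = ε 0 x := by
  have h0 := hx 0; have h1 := hx 1; have h2 := hx 2
  have h3 := hx 3; have h4 := hx 4; have h5 := hx 5
  simp [ε, e, A, e0, e1, e2, e3,c2p,c21p,c24p,cc2,c3,c31,c32]; field_simp 
  all_goals ring
theorem eps03 (x : Fin 6 → ℝ) (hx : ∀ i, 0 < x i) (c : ℝ) (hc : 0 < c)  :
    ε 0 (e3 c x) = ε 0 x := by
  have h0 := hx 0; have h1 := hx 1; have h2 := hx 2
  have h3 := hx 3; have h4 := hx 4; have h5 := hx 5
  simp [ε, e, A, e0, e1, e2, e3,c2p,c21p,c24p,cc2,c3,c31,c32]; field_simp 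
  all_goals ring
theorem eps13 (x : Fin 6 → ℝ) (hx : ∀ i, 0 < x i) (c : ℝ) (hc : 0 < c)  :
    ε 1 (e3 c x) = ε 1 x := by
  simp [ε, e, A, e0, e1, e2, e3,c2p,c21p,c24p,cc2,c3,c31,c32]
theorem eps31 (x : Fin 6 → ℝ) (hx : ∀ i, 0 < x i) (c : ℝ) (hc : 0 < c)  :
    ε 3 (e1 c x) = ε 3 x := by
  simp [ε, e, A, e0, e1, e2, e3,c2p,c21p,c24p,cc2,c3,c31,c32]
theorem eps20 (x : Fin 6 → ℝ) (hx : ∀ i, 0 < x i) (c : ℝ) (hc : 0 < c)  :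
    ε 2 (e0 c x) = ε 2 x := by
  have h0 := hx 0; have h1 := hx 1; have h2 := hx 2
  have h3 := hx 3; have h4 := hx 4; have h5 := hx 5
  simp [ε, e, A, e0, e1, e2, e3,c2p,c21p,c24p,cc2,c3,c31,c32]; field_simp 
  all_goals ring
theorem eps30 (x : Fin 6 → ℝ) (hx : ∀ i, 0 < x i) (c : ℝ) (hc : 0 < c)  :
    ε 3 (e0 c x) = ε 3 x := by
  have h0 := hx 0; have h1 := hx 1; have h2 := hx 2
  have h3 := hx 3; have h4 := hx 4; have h5 := hx 5
  simp [ε, e, A, e0, e1, e2, e3,c2p,c21p,c24p,cc2,c3,c31,c32]; field_simp 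
  all_goals ring

theorem epsi (x : Fin 6 → ℝ) (hx : ∀ i, 0 < x i) (c : ℝ) (hc : 0 < c) (i : Fin 4) :
    ε i (e i c x) = c⁻¹ * ε i x := by
  have h0 := hx 0; have h1 := hx 1; have h2 := hx 2
  have h3 := hx 3; have h4 := hx 4; have h5 := hx 5
  fin_cases i <;> simp [ε, e, A, e0, e1, e2, e3,c2p,c21p,c24p,cc2,c3,c31,c32] <;> field_simp 
  all_goals ring

theorem eone (x : Fin 6 → ℝ) (hx : ∀ i, 0 < x i) (i : Fin 4) :
    e i 1 x = x := by
  have h0 := hx 0; have h1 := hx 1; have h2 := hx 2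
  have h3 := hx 3; have h4 := hx 4; have h5 := hx 5
  fin_cases i <;> apply vec6_ext <;>
    simp [e, e0, e1, e2, e3, c2p, c21p, c24p, cc2, c3, c31, c32] <;> field_simp

theorem s12 (x : Fin 6 → ℝ) (hx : ∀ i, 0 < x i) (c1 c2 : ℝ) (hc1 : 0 < c1) (hc2 : 0 < c2) :
    e1 c1 (e2 (c1 * c2) (e1 c2 x)) = e2 c2 (e1 (c1 * c2) (e2 c1 x)) := by
  have h0 := hx 0; have h1 := hx 1; have h2 := hx 2
  have h3 := hx 3; have h4 := hx 4; have h5 := hx 5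
  apply vec6_ext <;> simp [e1, e2, cc2] <;> field_simp

theorem comm13 (x : Fin 6 → ℝ) (c1 c2 : ℝ) : e1 c1 (e3 c2 x) = e3 c2 (e1 c1 x) := by
  apply vec6_ext <;> simp [e1, e3, c3, c31, c32]

/-- `(e_0, …, e_3, γ_0, …, γ_3, ε_0, …, ε_3)` is a positive geometric crystal
for `C_3^{(1)}`. -/
theorem geometric_crystal_C3 :
    ∀ x : Fin 6 → ℝ, (∀ i, 0 < x i) → ∀ c c1 c2 : ℝ, 0 < c → 0 < c1 → 0 < c2 →
      ((∀ i : Fin 4, e i 1 x = x ∧ e i (c1 * c2) x = e i c1 (e i c2 x)) ∧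
       (∀ i j : Fin 4, γ j (e i c x) = c ^ (A i j) * γ j x) ∧
       ((∀ i : Fin 4, ε i (e i c x) = c⁻¹ * ε i x) ∧
        (∀ i j : Fin 4, A i j = 0 ∧ A j i = 0 → ε i (e j c x) = ε i x)) ∧
       ((∀ i j : Fin 4, A i j = 0 ∧ A j i = 0 →
          e i c1 (e j c2 x) = e j c2 (e i c1 x)) ∧
        e 1 c1 (e 2 (c1 * c2) (e 1 c2 x)) = e 2 c2 (e 1 (c1 * c2) (e 2 c1 x)) ∧
        (∀ p : Fin 4 × Fin 4, p = (1, 0) ∨ p = (2, 3) →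
          e p.1 c1 (e p.2 (c1 ^ 2 * c2) (e p.1 (c1 * c2) (e p.2 c2 x))) =
            e p.2 c2 (e p.1 (c1 * c2) (e p.2 (c1 ^ 2 * c2) (e p.1 c1 x)))))) := by
  intro x hx c c1 c2 hc h1 h2
  have hx' : Pos x := hx
  have cases_ij : ∀ i j : Fin 4, A i j = 0 ∧ A j i = 0 →
      (i = 0 ∧ j = 2) ∨ (i = 2 ∧ j = 0) ∨ (i = 0 ∧ j = 3) ∨ (i = 3 ∧ j = 0) ∨
      (i = 1 ∧ j = 3) ∨ (i = 3 ∧ j = 1) := by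
    intro i j hij
    fin_cases i <;> fin_cases j <;> simp [A] at hij ⊢
  have E0 : e 0 = e0 := rfl
  have E1 : e 1 = e1 := rfl
  have E2 : e 2 = e2 := rfl
  have E3 : e 3 = e3 := rfl
  refine ⟨fun i => ⟨eone x hx i, ?_⟩, gam x hx c hc, ⟨epsi x hx c hc, ?_⟩, ?_, ?_, ?_⟩
  · by_cases hi : i = 0
    · subst hi; rw [E0]; exact hom0 hx' h1 h2
    · exact hom123 x hx c1 c2 h1 h2 i hi
  · intro i j hij
    rcases cases_ij i j hij with ⟨rfl, rfl⟩ | ⟨rfl, rfl⟩ | ⟨rfl, rfl⟩ | ⟨rfl, rfl⟩ |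
      ⟨rfl, rfl⟩ | ⟨rfl, rfl⟩
    · rw [E2]; exact eps02 x hx c hc
    · rw [E0]; exact eps20 x hx c hc
    · rw [E3]; exact eps03 x hx c hc
    · rw [E0]; exact eps30 x hx c hc
    · rw [E3]; exact eps13 x hx c hc
    · rw [E1]; exact eps31 x hx c hc
  · intro i j hij
    rcases cases_ij i j hij with ⟨rfl, rfl⟩ | ⟨rfl, rfl⟩ | ⟨rfl, rfl⟩ | ⟨rfl, rfl⟩ |
      ⟨rfl, rfl⟩ | ⟨rfl, rfl⟩
    · rw [E0, E2]; exact comm02 hx' h1 h2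
    · rw [E0, E2]; exact (comm02 hx' h2 h1).symm
    · rw [E0, E3]; exact comm03 hx' h1 h2 (eps30 x hx c1 h1)
    · rw [E0, E3]; exact (comm03 hx' h2 h1 (eps30 x hx c2 h2)).symm
    · rw [E1, E3]; exact comm13 x c1 c2
    · rw [E1, E3]; exact (comm13 x c2 c1).symm
  · rw [E1, E2]; exact s12 x hx c1 c2 h1 h2
  · rintro p (rfl | rfl)
    · simp only [E0, E1]; exact serre10 hx' h1 h2
    · simp only [E2, E3]; exact serre23 hx' h1 h2

end

end Stmt8
end

section
/- For all x ∈ ℝ_{>0}^6 and all c, d ∈ ℝ_{>0}: e_0^c(e_3^d(x)) = e_3^d(e_0^c(x)); i.e., the 0-action and the 3-action of the C_3^{(1)}-geometric crystal commute. -/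
namespace Stmt10

noncomputable section

/-! Coordinates: `x = (x33, x22, x32, x11, x21, x31)` at indices `0, …, 5`. -/

def c3 (x : Fin 6 → ℝ) : ℝ :=
  x 2 ^ 2 * x 5 * x 0 + x 1 ^ 2 * x 5 * x 2 + x 1 ^ 2 * x 4 ^ 2
def c31 (c : ℝ) (x : Fin 6 → ℝ) : ℝ :=
  c * (x 2 ^ 2 * x 5 * x 0) + x 1 ^ 2 * x 5 * x 2 + x 1 ^ 2 * x 4 ^ 2
def c32 (c : ℝ) (x : Fin 6 → ℝ) : ℝ :=
  c * (x 2 ^ 2 * x 5 * x 0) + c * (x 1 ^ 2 * x 5 * x 2) + x 1 ^ 2 * x 4 ^ 2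

def e3 (c : ℝ) (x : Fin 6 → ℝ) : Fin 6 → ℝ :=
  ![(c31 c x / c3 x) * x 0, x 1, (c32 c x / c31 c x) * x 2, x 3, x 4,
    (c * c3 x / c32 c x) * x 5]

def c2p (x : Fin 6 → ℝ) : ℝ :=
  x 5 + x 4 ^ 2 / x 2 + 2 * x 4 * x 3 / x 1 + x 3 ^ 2 * x 2 / x 1 ^ 2 + x 3 ^ 2 / x 0
def c21p (c : ℝ) (x : Fin 6 → ℝ) : ℝ :=
  c * x 5 + x 4 ^ 2 / x 2 + 2 * x 4 * x 3 / x 1 + x 3 ^ 2 * x 2 / x 1 ^ 2 + x 3 ^ 2 / x 0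
def c24p (c : ℝ) (x : Fin 6 → ℝ) : ℝ :=
  c * x 5 + c * (x 4 ^ 2 / x 2) + c * (2 * x 4 * x 3 / x 1) +
    c * (x 3 ^ 2 * x 2 / x 1 ^ 2) + x 3 ^ 2 / x 0

def e0 (c : ℝ) (x : Fin 6 → ℝ) : Fin 6 → ℝ :=
  ![(c24p c x / (c * c2p x)) * x 0,
    x 1 * (x 4 * x 1 * c24p c x + x 3 * x 2 * c21p c x) /
      ((x 4 * x 1 + x 3 * x 2) * c * c2p x),
    (c21p c x / c24p c x) * x 2,
    x 3 / c,
    x 4 * (x 4 * x 1 + x 3 * x 2) * c2p x /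
      (x 4 * x 1 * c24p c x + x 3 * x 2 * c21p c x),
    (c2p x / c21p c x) * x 5]

/-- `c2p` with the middle three terms written as one square. -/
lemma c2p_eq (x : Fin 6 → ℝ) (hx : ∀ i, 0 < x i) :
    c2p x = x 5 + (x 4 * x 1 + x 3 * x 2) ^ 2 / (x 2 * x 1 ^ 2) + x 3 ^ 2 / x 0 := by
  have h0 := (hx 0).ne'
  have h1 := (hx 1).ne'
  have h2 := (hx 2).ne'
  unfold c2p
  field_simp
  ring

lemma c21p_eq (c : ℝ) (x : Fin 6 → ℝ) : c21p c x = c2p x + (c - 1) * x 5 := by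
  unfold c21p c2p
  ring

lemma c24p_eq (c : ℝ) (x : Fin 6 → ℝ) :
    c24p c x = c * c2p x - (c - 1) * (x 3 ^ 2 / x 0) := by
  unfold c24p c2p
  ring

lemma c31_eq (d : ℝ) (x : Fin 6 → ℝ) :
    c31 d x = c3 x + (d - 1) * (x 2 ^ 2 * x 5 * x 0) := by
  unfold c31 c3
  ring

lemma c32_eq (d : ℝ) (x : Fin 6 → ℝ) :
    c32 d x = d * c3 x - (d - 1) * (x 1 * x 4) ^ 2 := by
  unfold c32 c3
  ring

lemma pos_all (x : Fin 6 → ℝ) (hx : ∀ i, 0 < x i) (c : ℝ) (hc : 0 < c) :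
    0 < c3 x ∧ 0 < c31 c x ∧ 0 < c32 c x ∧ 0 < c2p x ∧ 0 < c21p c x ∧ 0 < c24p c x := by
  have h0 := hx 0
  have h1 := hx 1
  have h2 := hx 2
  have h3 := hx 3
  have h4 := hx 4
  have h5 := hx 5
  unfold c3 c31 c32 c2p c21p c24p
  refine ⟨?_, ?_, ?_, ?_, ?_, ?_⟩ <;> positivity

lemma e3_pos (x : Fin 6 → ℝ) (hx : ∀ i, 0 < x i) (d : ℝ) (hd : 0 < d) :
    ∀ i, 0 < e3 d x i := by
  obtain ⟨ha, hb, hg, -, -, -⟩ := pos_all x hx d hd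
  have h0 := hx 0
  have h1 := hx 1
  have h2 := hx 2
  have h3 := hx 3
  have h4 := hx 4
  have h5 := hx 5
  intro i
  fin_cases i <;> simp [e3] <;> positivity

/-- `c2p` is invariant under the `3`-action. -/
lemma c2p_e3 (x : Fin 6 → ℝ) (hx : ∀ i, 0 < x i) (d : ℝ) (hd : 0 < d) :
    c2p (e3 d x) = c2p x := by
  rw [c2p_eq _ (e3_pos x hx d hd), c2p_eq x hx]
  obtain ⟨ha, hb, hg, -, -, -⟩ := pos_all x hx d hd
  have h0 := (hx 0).ne'
  have h1 := (hx 1).ne'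
  have h2 := (hx 2).ne'
  have ha' := ha.ne'
  have hb' := hb.ne'
  have hg' := hg.ne'
  have e0' : e3 d x 0 = (c31 d x / c3 x) * x 0 := rfl
  have e1' : e3 d x 1 = x 1 := rfl
  have e2' : e3 d x 2 = (c32 d x / c31 d x) * x 2 := rfl
  have e3' : e3 d x 3 = x 3 := rfl
  have e4' : e3 d x 4 = x 4 := rfl
  have e5' : e3 d x 5 = (d * c3 x / c32 d x) * x 5 := rfl
  rw [e0', e1', e2', e3', e4', e5']
  field_simp
  unfold c31 c32 c3
  ring

/-- Transformation of `c3` under the `0`-action. -/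
lemma c3_e0 (x : Fin 6 → ℝ) (hx : ∀ i, 0 < x i) (c : ℝ) (hc : 0 < c) :
    c3 (e0 c x) = c3 x * c21p c x / (c ^ 2 * c2p x) := by
  obtain ⟨-, -, -, hp, hq, hr⟩ := pos_all x hx c hc
  have h0 := hx 0
  have h1 := hx 1
  have h2 := hx 2
  have h3 := hx 3
  have h4 := hx 4
  have h5 := hx 5
  have hn : 0 < x 4 * x 1 * c24p c x + x 3 * x 2 * c21p c x := by positivity
  have huv : 0 < x 4 * x 1 + x 3 * x 2 := by positivity
  have key : (x 4 * x 1 + x 3 * x 2) ^ 2 *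
      (x 2 ^ 2 * x 5 * x 0 * c21p c x * c * c2p x + (x 1 * x 4) ^ 2 * c2p x * c24p c x)
      + (x 4 * x 1 * c24p c x + x 3 * x 2 * c21p c x) ^ 2 * (x 1 ^ 2 * x 5 * x 2)
      = c3 x * c21p c x * c24p c x * (x 4 * x 1 + x 3 * x 2) ^ 2 := by
    rw [c21p_eq, c24p_eq, c2p_eq x hx]
    unfold c3
    field_simp
    ring
  have hT : c3 (e0 c x) = x 2 ^ 2 * x 5 * x 0 * c21p c x / (c * c24p c x)
      + (x 4 * x 1 * c24p c x + x 3 * x 2 * c21p c x) ^ 2 * (x 1 ^ 2 * x 5 * x 2)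
        / ((x 4 * x 1 + x 3 * x 2) ^ 2 * c ^ 2 * c2p x * c24p c x)
      + (x 1 * x 4) ^ 2 / c ^ 2 := by
    unfold c3
    simp only [e0, Matrix.cons_val]
    generalize x 4 * x 1 * c24p c x + x 3 * x 2 * c21p c x = n at *
    generalize x 4 * x 1 + x 3 * x 2 = w at *
    field_simp
  rw [hT]
  generalize x 4 * x 1 * c24p c x + x 3 * x 2 * c21p c x = n at *
  generalize x 4 * x 1 + x 3 * x 2 = w at *
  field_simp
  linear_combination key

lemma e0_pos (x : Fin 6 → ℝ) (hx : ∀ i, 0 < x i) (c : ℝ) (hc : 0 < c) :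
    ∀ i, 0 < e0 c x i := by
  obtain ⟨-, -, -, hp, hq, hr⟩ := pos_all x hx c hc
  have h0 := hx 0
  have h1 := hx 1
  have h2 := hx 2
  have h3 := hx 3
  have h4 := hx 4
  have h5 := hx 5
  intro i
  fin_cases i <;> simp [e0] <;> positivity

set_option maxHeartbeats 1000000 in
/-- The `0`-action and the `3`-action of the `C_3^{(1)}`-geometric crystal
commute. -/
theorem e0_e3_commute (x : Fin 6 → ℝ) (hx : ∀ i, 0 < x i)
    (c d : ℝ) (hc : 0 < c) (hd : 0 < d) :
    e0 c (e3 d x) = e3 d (e0 c x) := by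
  obtain ⟨ha, hb, hg, -, -, -⟩ := pos_all x hx d hd
  obtain ⟨-, -, -, hp, hq, hr⟩ := pos_all x hx c hc
  have hy := e3_pos x hx d hd
  have hz := e0_pos x hx c hc
  obtain ⟨-, -, -, -, hq', hr'⟩ := pos_all _ hy c hc
  obtain ⟨ha', hb', hg', -, -, -⟩ := pos_all _ hz d hd
  have hP := c2p_e3 x hx d hd
  have hA := c3_e0 x hx c hc
  have h0 := hx 0
  have h1 := hx 1
  have h2 := hx 2
  have h3 := hx 3
  have h4 := hx 4
  have h5 := hx 5
  have y0 : e3 d x 0 = (c31 d x / c3 x) * x 0 := rfl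
  have y1 : e3 d x 1 = x 1 := rfl
  have y2 : e3 d x 2 = (c32 d x / c31 d x) * x 2 := rfl
  have y3 : e3 d x 3 = x 3 := rfl
  have y4 : e3 d x 4 = x 4 := rfl
  have y5 : e3 d x 5 = (d * c3 x / c32 d x) * x 5 := rfl
  have hn : 0 < x 4 * x 1 * c24p c x + x 3 * x 2 * c21p c x := by positivity
  have huv : 0 < x 4 * x 1 + x 3 * x 2 := by positivity
  -- the transformed quantities
  have hQ : c21p c (e3 d x) * c32 d x = c2p x * c32 d x + (c - 1) * d * c3 x * x 5 := by
    rw [c21p_eq, hP, y5]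
    field_simp
  have hR : c24p c (e3 d x) * c31 d x
      = c3 x * c24p c x + (d - 1) * c * (x 2 ^ 2 * x 5 * x 0) * c2p x := by
    rw [c24p_eq, c24p_eq, hP, y0, y3]
    field_simp
    rw [c31_eq]
    ring
  have hT1 : e0 c x 2 ^ 2 * e0 c x 5 * e0 c x 0
      = x 2 ^ 2 * x 5 * x 0 * c21p c x / (c * c24p c x) := by
    simp only [e0, Matrix.cons_val]
    field_simp
  have hT3 : e0 c x 1 * e0 c x 4 = x 1 * x 4 / c := by
    simp only [e0, Matrix.cons_val]
    generalize x 4 * x 1 * c24p c x + x 3 * x 2 * c21p c x = n at *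
    generalize x 4 * x 1 + x 3 * x 2 = w at *
    field_simp
  have hG : c21p c (e3 d x) * c32 d x = c ^ 2 * c2p x * c32 d (e0 c x) := by
    rw [hQ, c32_eq d (e0 c x), hA, hT3, c32_eq, c21p_eq]
    field_simp
    ring
  have hB : c24p c (e3 d x) * c31 d x * c21p c x
      = c ^ 2 * c2p x * c24p c x * c31 d (e0 c x) := by
    rw [hR, c31_eq d (e0 c x), hA, hT1]
    field_simp
  have hN : (x 4 * x 1 * c31 d x + x 3 * x 2 * c32 d x)
        * (x 4 * x 1 * c24p c x + x 3 * x 2 * c21p c x)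
      = (x 4 * x 1 + x 3 * x 2) * (x 4 * x 1 * (c24p c (e3 d x) * c31 d x)
        + x 3 * x 2 * (c21p c (e3 d x) * c32 d x)) := by
    rw [hQ, hR, c31_eq, c32_eq, c21p_eq, c24p_eq, c2p_eq x hx]
    unfold c3
    field_simp
    ring
  have hn' : 0 < x 4 * x 1 * (c24p c (e3 d x) * c31 d x)
        + x 3 * x 2 * (c21p c (e3 d x) * c32 d x) := by positivity
  have hw' : 0 < x 4 * x 1 * c31 d x + x 3 * x 2 * c32 d x := by positivity
  -- rewriting of the second and fifth coordinates
  have hW : e3 d x 4 * e3 d x 1 + e3 d x 3 * e3 d x 2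
      = (x 4 * x 1 * c31 d x + x 3 * x 2 * c32 d x) / c31 d x := by
    rw [y1, y2, y3, y4]
    field_simp
  have hM : e3 d x 4 * e3 d x 1 * c24p c (e3 d x) + e3 d x 3 * e3 d x 2 * c21p c (e3 d x)
      = (x 4 * x 1 * (c24p c (e3 d x) * c31 d x)
        + x 3 * x 2 * (c21p c (e3 d x) * c32 d x)) / c31 d x := by
    rw [y1, y2, y3, y4]
    field_simp
  have g0 : e0 c (e3 d x) 0 = e3 d (e0 c x) 0 := by
    change (c24p c (e3 d x) / (c * c2p (e3 d x))) * e3 d x 0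
      = (c31 d (e0 c x) / c3 (e0 c x)) * ((c24p c x / (c * c2p x)) * x 0)
    rw [hP, y0, hA]
    field_simp
    linear_combination hB
  have g1 : e0 c (e3 d x) 1 = e3 d (e0 c x) 1 := by
    change e3 d x 1 * (e3 d x 4 * e3 d x 1 * c24p c (e3 d x)
        + e3 d x 3 * e3 d x 2 * c21p c (e3 d x)) /
        ((e3 d x 4 * e3 d x 1 + e3 d x 3 * e3 d x 2) * c * c2p (e3 d x))
      = x 1 * (x 4 * x 1 * c24p c x + x 3 * x 2 * c21p c x) /
        ((x 4 * x 1 + x 3 * x 2) * c * c2p x)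
    rw [hM, hW, hP, y1]
    generalize x 4 * x 1 * (c24p c (e3 d x) * c31 d x)
        + x 3 * x 2 * (c21p c (e3 d x) * c32 d x) = n' at *
    generalize x 4 * x 1 * c31 d x + x 3 * x 2 * c32 d x = w' at *
    generalize x 4 * x 1 * c24p c x + x 3 * x 2 * c21p c x = n at *
    generalize x 4 * x 1 + x 3 * x 2 = w at *
    field_simp
    linear_combination -hN
  have g2 : e0 c (e3 d x) 2 = e3 d (e0 c x) 2 := by
    change (c21p c (e3 d x) / c24p c (e3 d x)) * e3 d x 2
      = (c32 d (e0 c x) / c31 d (e0 c x)) * ((c21p c x / c24p c x) * x 2)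
    rw [y2]
    have hcp : c ^ 2 * c2p x ≠ 0 := by positivity
    field_simp
    apply mul_left_cancel₀ hcp
    linear_combination c24p c x * c31 d (e0 c x) * c ^ 2 * c2p x * hG
      - c ^ 2 * c2p x * c32 d (e0 c x) * hB
  have g3 : e0 c (e3 d x) 3 = e3 d (e0 c x) 3 := rfl
  have g4 : e0 c (e3 d x) 4 = e3 d (e0 c x) 4 := by
    change e3 d x 4 * (e3 d x 4 * e3 d x 1 + e3 d x 3 * e3 d x 2) * c2p (e3 d x) /
        (e3 d x 4 * e3 d x 1 * c24p c (e3 d x) + e3 d x 3 * e3 d x 2 * c21p c (e3 d x))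
      = x 4 * (x 4 * x 1 + x 3 * x 2) * c2p x /
        (x 4 * x 1 * c24p c x + x 3 * x 2 * c21p c x)
    rw [hM, hW, hP, y4]
    generalize x 4 * x 1 * (c24p c (e3 d x) * c31 d x)
        + x 3 * x 2 * (c21p c (e3 d x) * c32 d x) = n' at *
    generalize x 4 * x 1 * c31 d x + x 3 * x 2 * c32 d x = w' at *
    generalize x 4 * x 1 * c24p c x + x 3 * x 2 * c21p c x = n at *
    generalize x 4 * x 1 + x 3 * x 2 = w at *
    field_simp
    linear_combination hN
  have g5 : e0 c (e3 d x) 5 = e3 d (e0 c x) 5 := by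
    change (c2p (e3 d x) / c21p c (e3 d x)) * e3 d x 5
      = (d * c3 (e0 c x) / c32 d (e0 c x)) * ((c2p x / c21p c x) * x 5)
    rw [hP, y5, hA]
    field_simp
    linear_combination -hG
  funext i
  fin_cases i
  exacts [g0, g1, g2, g3, g4, g5]

end

end Stmt10
end

section
/- The data (e_0, …, e_4, γ_0, …, γ_4, ε_0, …, ε_4) form a positive geometric crystal for C_4^{(1)}: for all x ∈ ℝ_{>0}^{10} and all c, c1, c2 ∈ ℝ_{>0}: (i) e_i^1(x) = x and e_i^{c1·c2}(x) = e_i^{c1}(e_i^{c2}(x)) for i = 0, …, 4; (ii) γ_j(e_i^c(x)) = c^{a_ij}·γ_j(x) for all i, j ∈ {0, …, 4}; (iii) ε_i(e_i^c(x)) = c^{−1}·ε_i(x) for all i, and ε_i(e_j^c(x)) = ε_i(x) for each pair with a_ij = a_ji = 0, namely (i,j) with |i−j| ≥ 2; (iv) e_i^{c1} and e_j^{c2} commute whenever a_ij = a_ji = 0; e_i^{c1}(e_j^{c1·c2}(e_i^{c2}(x))) = e_j^{c2}(e_i^{c1·c2}(e_j^{c1}(x))) for (i,j) ∈ {(1,2),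 (2,3)} (where a_ij = a_ji = −1); and for (i,j) ∈ {(1,0), (3,4)} (where a_ij = −2, a_ji = −1): e_i^{c1}(e_j^{c1²·c2}(e_i^{c1·c2}(e_j^{c2}(x)))) = e_j^{c2}(e_i^{c1·c2}(e_j^{c1²·c2}(e_i^{c1}(x)))). -/
namespace Stmt11

noncomputable section

/-! Coordinates: `x = (x44, x33, x43, x22, x32, x42, x11, x21, x31, x41)`
at indices `0, …, 9`. -/

def e1 (c : ℝ) (x : Fin 10 → ℝ) : Fin 10 → ℝ :=
  ![x 0, x 1, x 2, x 3, x 4, x 5, c * x 6, x 7, x 8, x 9]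

/-- `r2 = (c·x22·x21 + x32·x11)/(x22·x21 + x32·x11)`. -/
def r2 (c : ℝ) (x : Fin 10 → ℝ) : ℝ :=
  (c * x 3 * x 7 + x 4 * x 6) / (x 3 * x 7 + x 4 * x 6)

def e2 (c : ℝ) (x : Fin 10 → ℝ) : Fin 10 → ℝ :=
  ![x 0, x 1, x 2, r2 c x * x 3, x 4, x 5, x 6, (c / r2 c x) * x 7, x 8, x 9]

def c3 (x : Fin 10 → ℝ) : ℝ :=
  x 0 * x 1 * x 4 ^ 2 * x 8 + x 0 * x 2 * x 3 * x 4 * x 8 + x 0 * x 2 * x 5 * x 3 * x 7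
def c31 (c : ℝ) (x : Fin 10 → ℝ) : ℝ :=
  c * (x 0 * x 1 * x 4 ^ 2 * x 8) + x 0 * x 2 * x 3 * x 4 * x 8 + x 0 * x 2 * x 5 * x 3 * x 7
def c32 (c : ℝ) (x : Fin 10 → ℝ) : ℝ :=
  c * (x 0 * x 1 * x 4 ^ 2 * x 8) + c * (x 0 * x 2 * x 3 * x 4 * x 8) +
    x 0 * x 2 * x 5 * x 3 * x 7

def e3 (c : ℝ) (x : Fin 10 → ℝ) : Fin 10 → ℝ :=
  ![x 0, (c31 c x / c3 x) * x 1, x 2, x 3, (c32 c x / c31 c x) * x 4, x 5, x 6, x 7,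
    (c * c3 x / c32 c x) * x 8, x 9]

def c4 (x : Fin 10 → ℝ) : ℝ :=
  x 9 * x 5 ^ 2 * x 2 ^ 2 * x 0 + x 1 ^ 2 * x 2 * x 5 ^ 2 * x 9 +
    x 1 ^ 2 * x 4 ^ 2 * x 5 * x 9 + x 1 ^ 2 * x 4 ^ 2 * x 8 ^ 2
def c41 (c : ℝ) (x : Fin 10 → ℝ) : ℝ :=
  c * (x 9 * x 5 ^ 2 * x 2 ^ 2 * x 0) + x 1 ^ 2 * x 2 * x 5 ^ 2 * x 9 +
    x 1 ^ 2 * x 4 ^ 2 * x 5 * x 9 + x 1 ^ 2 * x 4 ^ 2 * x 8 ^ 2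
def c42 (c : ℝ) (x : Fin 10 → ℝ) : ℝ :=
  c * (x 9 * x 5 ^ 2 * x 2 ^ 2 * x 0) + c * (x 1 ^ 2 * x 2 * x 5 ^ 2 * x 9) +
    x 1 ^ 2 * x 4 ^ 2 * x 5 * x 9 + x 1 ^ 2 * x 4 ^ 2 * x 8 ^ 2
def c43 (c : ℝ) (x : Fin 10 → ℝ) : ℝ :=
  c * (x 9 * x 5 ^ 2 * x 2 ^ 2 * x 0) + c * (x 1 ^ 2 * x 2 * x 5 ^ 2 * x 9) +
    c * (x 1 ^ 2 * x 4 ^ 2 * x 5 * x 9) + x 1 ^ 2 * x 4 ^ 2 * x 8 ^ 2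

def e4 (c : ℝ) (x : Fin 10 → ℝ) : Fin 10 → ℝ :=
  ![(c41 c x / c4 x) * x 0, x 1, (c42 c x / c41 c x) * x 2, x 3, x 4,
    (c43 c x / c42 c x) * x 5, x 6, x 7, x 8, (c * c4 x / c43 c x) * x 9]

def c4p (x : Fin 10 → ℝ) : ℝ :=
  x 9 + (x 6 * x 5 / x 3 + x 7 * x 5 / x 4 + x 8) ^ 2 / x 5 +
    (x 7 + x 6 * x 2 / x 1 + x 6 * x 4 / x 3) ^ 2 / x 2 + x 6 ^ 2 / x 0
def c41p (c : ℝ) (x : Fin 10 → ℝ) : ℝ :=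
  c * x 9 + (x 6 * x 5 / x 3 + x 7 * x 5 / x 4 + x 8) ^ 2 / x 5 +
    (x 7 + x 6 * x 2 / x 1 + x 6 * x 4 / x 3) ^ 2 / x 2 + x 6 ^ 2 / x 0
def c42p (c : ℝ) (x : Fin 10 → ℝ) : ℝ :=
  c * x 9 + c * ((x 6 * x 5 / x 3 + x 7 * x 5 / x 4 + x 8) ^ 2 / x 5) +
    (x 7 + x 6 * x 2 / x 1 + x 6 * x 4 / x 3) ^ 2 / x 2 + x 6 ^ 2 / x 0
def c43p (c : ℝ) (x : Fin 10 → ℝ) : ℝ :=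
  c * x 9 + c * ((x 6 * x 5 / x 3 + x 7 * x 5 / x 4 + x 8) ^ 2 / x 5) +
    c * ((x 7 + x 6 * x 2 / x 1 + x 6 * x 4 / x 3) ^ 2 / x 2) + x 6 ^ 2 / x 0

def pA (c : ℝ) (x : Fin 10 → ℝ) : ℝ :=
  x 6 * x 3 * x 2 * c42p c x + c43p c x * (x 7 * x 3 * x 1) + c43p c x * (x 6 * x 4 * x 1)
def pB (x : Fin 10 → ℝ) : ℝ :=
  x 6 * x 3 * x 2 + x 7 * x 3 * x 1 + x 6 * x 4 * x 1
def pC (c : ℝ) (x : Fin 10 → ℝ) : ℝ :=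
  c41p c x * (x 6 * x 4 * x 5) + c41p c x * (x 7 * x 3 * x 5) + c42p c x * (x 3 * x 8 * x 4)
def pD (x : Fin 10 → ℝ) : ℝ :=
  x 6 * x 4 * x 5 + x 7 * x 3 * x 5 + x 3 * x 8 * x 4
def pG (c : ℝ) (x : Fin 10 → ℝ) : ℝ :=
  c41p c x * (x 6 ^ 2 * x 3 * x 4 * x 5 * x 2 + x 6 ^ 2 * x 4 ^ 2 * x 1 * x 5 +
      x 6 * x 7 * x 3 * x 4 * x 1 * x 5) +
    c42p c x * (x 6 * x 7 * x 3 ^ 2 * x 5 * x 2 + x 6 * x 3 ^ 2 * x 8 * x 4 * x 2 +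
      x 6 * x 3 * x 8 * x 4 ^ 2 * x 1) +
    c43p c x * (x 6 * x 7 * x 3 * x 4 * x 1 * x 5 + x 7 ^ 2 * x 3 ^ 2 * x 1 * x 5 +
      x 7 * x 3 ^ 2 * x 8 * x 4 * x 1)

def e0 (c : ℝ) (x : Fin 10 → ℝ) : Fin 10 → ℝ :=
  ![x 0 * c43p c x / (c * c4p x),
    x 1 * pA c x / (c * c4p x * pB x),
    x 2 * c42p c x / c43p c x,
    x 3 * pG c x / (pB x * pD x * c * c4p x),
    x 4 * pC c x * pB x / (pA c x * pD x),
    c41p c x * x 5 / c42p c x,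
    x 6 / c,
    x 7 * c4p x * pD x * pB x / pG c x,
    x 8 * c4p x * pD x / pC c x,
    x 9 * c4p x / c41p c x]

def e : Fin 5 → ℝ → (Fin 10 → ℝ) → Fin 10 → ℝ := ![e0, e1, e2, e3, e4]

def γ : Fin 5 → (Fin 10 → ℝ) → ℝ :=
  ![fun x => 1 / x 6 ^ 2,
    fun x => x 6 ^ 2 / (x 7 * x 3),
    fun x => x 7 ^ 2 * x 3 ^ 2 / (x 6 * x 8 * x 4 * x 1),
    fun x => x 8 ^ 2 * x 4 ^ 2 * x 1 ^ 2 / (x 7 * x 3 * x 9 * x 5 * x 2 * x 0),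
    fun x => x 9 ^ 2 * x 5 ^ 2 * x 2 ^ 2 * x 0 ^ 2 / (x 8 ^ 2 * x 4 ^ 2 * x 1 ^ 2)]

def ε : Fin 5 → (Fin 10 → ℝ) → ℝ :=
  ![fun x => x 9 + (x 6 * x 5 / x 3 + x 7 * x 5 / x 4 + x 8) ^ 2 / x 5 +
      (x 7 + x 6 * x 2 / x 1 + x 6 * x 4 / x 3) ^ 2 / x 2 + x 6 ^ 2 / x 0,
    fun x => x 3 / x 6,
    fun x => x 1 / x 3 + x 1 * x 4 * x 6 / (x 3 ^ 2 * x 7),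
    fun x => x 0 / x 1 + x 0 * x 2 * x 3 / (x 1 ^ 2 * x 4) +
      x 0 * x 2 * x 5 * x 3 * x 7 / (x 1 ^ 2 * x 4 ^ 2 * x 8),
    fun x => 1 / x 0 + x 1 ^ 2 / (x 2 * x 0 ^ 2) +
      x 1 ^ 2 * x 4 ^ 2 / (x 0 ^ 2 * x 2 ^ 2 * x 5) +
      x 1 ^ 2 * x 4 ^ 2 * x 8 ^ 2 / (x 0 ^ 2 * x 2 ^ 2 * x 5 ^ 2 * x 9)]

/-- The Cartan matrix of `C_4^{(1)}`. -/
def A : Fin 5 → Fin 5 → ℤ :=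
  ![![2, -1, 0, 0, 0], ![-2, 2, -1, 0, 0], ![0, -1, 2, -1, 0],
    ![0, 0, -1, 2, -2], ![0, 0, 0, -1, 2]]

set_option linter.unusedVariables false
set_option linter.unusedSimpArgs false
theorem all_pos (x : Fin 10 → ℝ) (hx : ∀ i, 0 < x i) : 0 < x 0 ∧ 0 < x 1 ∧ 0 < x 2 ∧ 0 < x 3 ∧
    0 < x 4 ∧ 0 < x 5 ∧ 0 < x 6 ∧ 0 < x 7 ∧ 0 < x 8 ∧ 0 < x 9 :=
  ⟨hx 0, hx 1, hx 2, hx 3, hx 4, hx 5, hx 6, hx 7, hx 8, hx 9⟩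
theorem pos_all {x : Fin 10 → ℝ} (h0 : 0 < x 0) (h1 : 0 < x 1) (h2 : 0 < x 2) (h3 : 0 < x 3)
    (h4 : 0 < x 4) (h5 : 0 < x 5) (h6 : 0 < x 6) (h7 : 0 < x 7) (h8 : 0 < x 8) (h9 : 0 < x 9) :
    ∀ i, 0 < x i := by
  intro i
  fin_cases i <;> assumption

/-! Entries of the symmetric matrix attached to a point. -/

def n3 (x : Fin 10 → ℝ) : ℝ := x 7 + x 6 * x 2 / x 1 + x 6 * x 4 / x 3
def n2 (x : Fin 10 → ℝ) : ℝ := x 6 * x 5 / x 3 + x 7 * x 5 / x 4 + x 8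
def kk (x : Fin 10 → ℝ) : ℝ := x 4 + x 3 * x 2 / x 1
def m44 (x : Fin 10 → ℝ) : ℝ := x 0
def m34 (x : Fin 10 → ℝ) : ℝ := x 1
def m24 (x : Fin 10 → ℝ) : ℝ := x 3
def m14 (x : Fin 10 → ℝ) : ℝ := x 6
def m33 (x : Fin 10 → ℝ) : ℝ := x 2 + x 1 ^ 2 / x 0
def m23 (x : Fin 10 → ℝ) : ℝ := kk x + x 1 * x 3 / x 0
def m13 (x : Fin 10 → ℝ) : ℝ := n3 x + x 1 * x 6 / x 0
def m22 (x : Fin 10 → ℝ) : ℝ := x 5 + kk x ^ 2 / x 2 + x 3 ^ 2 / x 0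
def m12 (x : Fin 10 → ℝ) : ℝ := n2 x + kk x * n3 x / x 2 + x 3 * x 6 / x 0
def m11 (x : Fin 10 → ℝ) : ℝ := c4p x

/-- The matrix determines the point. -/
theorem m_inj (x y : Fin 10 → ℝ) (hx : ∀ i, 0 < x i)
    (h44 : m44 x = m44 y) (h34 : m34 x = m34 y) (h24 : m24 x = m24 y) (h14 : m14 x = m14 y)
    (h33 : m33 x = m33 y) (h23 : m23 x = m23 y) (h13 : m13 x = m13 y)
    (h22 : m22 x = m22 y) (h12 : m12 x = m12 y) (h11 : m11 x = m11 y) : x = y := by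
  simp only [m44, m34, m24, m14] at h44 h34 h24 h14
  simp only [m33, ← h44, ← h34, ← h24, ← h14] at h33
  have h2 : x 2 = y 2 := by linarith
  simp only [m23, kk, ← h44, ← h34, ← h24, ← h14, ← h2] at h23
  have h4 : x 4 = y 4 := by linarith
  simp only [m13, n3, ← h44, ← h34, ← h24, ← h14, ← h2, ← h4] at h13
  have h7 : x 7 = y 7 := by linarith
  simp only [m22, kk, ← h44, ← h34, ← h24, ← h14, ← h2, ← h4, ← h7] at h22
  have h5 : x 5 = y 5 := by linarith
  simp only [m12, n2, n3, kk, ← h44, ← h34, ← h24, ← h14, ← h2, ← h4, ← h7, ← h5] at h12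
  have h8 : x 8 = y 8 := by linarith
  simp only [m11, c4p, ← h44, ← h34, ← h24, ← h14, ← h2, ← h4, ← h7, ← h5, ← h8] at h11
  have h9 : x 9 = y 9 := by linarith
  ext i
  fin_cases i <;> assumption

theorem n3_pos (x : Fin 10 → ℝ) (hx : ∀ i, 0 < x i) : 0 < n3 x := by
  have := hx 1; have := hx 2; have := hx 3; have := hx 4; have := hx 6; have := hx 7
  unfold n3; positivity
theorem n2_pos (x : Fin 10 → ℝ) (hx : ∀ i, 0 < x i) : 0 < n2 x := by
  have := hx 5; have := hx 8; have := hx 3; have := hx 4; have := hx 6; have := hx 7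
  unfold n2; positivity

/-! ### The operator `e0` -/

def qa (c : ℝ) (x : Fin 10 → ℝ) : ℝ := c43p c x - (c - 1) * n3 x * x 6 / x 1
def qc (c : ℝ) (x : Fin 10 → ℝ) : ℝ := c41p c x + (c - 1) * n2 x * x 8 / x 5
def qg (c : ℝ) (x : Fin 10 → ℝ) : ℝ := c * c4p x - (c - 1) * m12 x * x 6 / x 3

theorem c43p_eq (c : ℝ) (x : Fin 10 → ℝ) : c43p c x = c * c4p x - (c - 1) * (x 6 ^ 2 / x 0) := by
  unfold c43p c4p; ring
theorem c42p_eq (c : ℝ) (x : Fin 10 → ℝ) : c42p c x = c43p c x - (c - 1) * (n3 x ^ 2 / x 2) := by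
  unfold c42p c43p n3; ring
theorem c41p_eq (c : ℝ) (x : Fin 10 → ℝ) : c41p c x = c42p c x - (c - 1) * (n2 x ^ 2 / x 5) := by
  unfold c41p c42p n2; ring
theorem c4p_eq (x : Fin 10 → ℝ) :
    c4p x = x 9 + n2 x ^ 2 / x 5 + n3 x ^ 2 / x 2 + x 6 ^ 2 / x 0 := by
  unfold c4p n2 n3; ring

theorem pB_eq (x : Fin 10 → ℝ) (hx : ∀ i, 0 < x i) : pB x = n3 x * x 3 * x 1 := by
  have := hx 1; have := hx 3
  unfold pB n3; field_simp
  ring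
theorem pD_eq (x : Fin 10 → ℝ) (hx : ∀ i, 0 < x i) : pD x = n2 x * x 3 * x 4 := by
  have := hx 4; have := hx 3
  unfold pD n2; field_simp

theorem pA_eq (c : ℝ) (x : Fin 10 → ℝ) (hx : ∀ i, 0 < x i) : pA c x = pB x * qa c x := by
  have := hx 1; have := hx 3; have := hx 2
  have : pA c x = c43p c x * pB x - (c43p c x - c42p c x) * (x 6 * x 3 * x 2) := by
    unfold pA pB; ring
  rw [this, c42p_eq, pB_eq x hx, qa]; field_simp
  ring
theorem pC_eq (c : ℝ) (x : Fin 10 → ℝ) (hx : ∀ i, 0 < x i) : pC c x = pD x * qc c x := by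
  have := hx 5; have := hx 3; have := hx 4
  have : pC c x = c41p c x * pD x + (c42p c x - c41p c x) * (x 3 * x 8 * x 4) := by
    unfold pC pD; ring
  rw [this, c41p_eq, pD_eq x hx, qc, c41p_eq]; field_simp
  ring
theorem pG_eq (c : ℝ) (x : Fin 10 → ℝ) (hx : ∀ i, 0 < x i) : pG c x = pB x * pD x * qg c x := by
  have := hx 1; have := hx 3; have := hx 4; have := hx 2; have := hx 5; have := hx 0
  have h1 : pG c x = c43p c x * (pB x * pD x)
      - (c43p c x - c42p c x) * (x 6 * pD x * (x 3 * x 2 + x 4 * x 1))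
      - (c42p c x - c41p c x) * (x 6 * pB x * x 4 * x 5) := by
    unfold pG pB pD; ring
  have h2 : qg c x = c43p c x - (c - 1) * x 6 / x 3 * (n2 x + kk x * n3 x / x 2) := by
    rw [c43p_eq, qg, m12]; field_simp; ring
  rw [h1, h2, c41p_eq c x, c42p_eq c x, pB_eq x hx, pD_eq x hx, kk]; field_simp
  ring

section pos
variable (c : ℝ) (x : Fin 10 → ℝ) (hc : 0 < c) (hx : ∀ i, 0 < x i)

theorem pos4 (hx : ∀ i, 0 < x i) : 0 < c4p x := by
  have h := hx; simp only [Fin.forall_fin_succ, Fin.forall_fin_zero] at h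
  obtain ⟨_, _, _, _, _, _, _, _, _, _⟩ := all_pos x hx
  unfold c4p; positivity
theorem pos41 (hc : 0 < c) (hx : ∀ i, 0 < x i) : 0 < c41p c x := by
  obtain ⟨_, _, _, _, _, _, _, _, _, _⟩ := all_pos x hx
  unfold c41p; positivity
theorem pos42 (hc : 0 < c) (hx : ∀ i, 0 < x i) : 0 < c42p c x := by
  obtain ⟨_, _, _, _, _, _, _, _, _, _⟩ := all_pos x hx
  unfold c42p; positivity
theorem pos43 (hc : 0 < c) (hx : ∀ i, 0 < x i) : 0 < c43p c x := by
  obtain ⟨_, _, _, _, _, _, _, _, _, _⟩ := all_pos x hx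
  unfold c43p; positivity
theorem posB (hx : ∀ i, 0 < x i) : 0 < pB x := by
  have := hx 1; have := hx 2; have := hx 3; have := hx 4; have := hx 6; have := hx 7
  unfold pB; positivity
theorem posD (hx : ∀ i, 0 < x i) : 0 < pD x := by
  have := hx 5; have := hx 8; have := hx 3; have := hx 4; have := hx 6; have := hx 7
  unfold pD; positivity
theorem posqa (hc : 0 < c) (hx : ∀ i, 0 < x i) : 0 < qa c x := by
  have := hx 1; have := hx 2; have := hx 3; have := hx 4; have := hx 6; have := hx 7
  have := pos42 c x hc hx; have := pos43 c x hc hx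
  have h : 0 < pB x * qa c x := by rw [← pA_eq c x hx]; unfold pA; positivity
  exact (pos_iff_pos_of_mul_pos h).1 (posB x hx)
theorem posqc (hc : 0 < c) (hx : ∀ i, 0 < x i) : 0 < qc c x := by
  have := hx 5; have := hx 8; have := hx 3; have := hx 4; have := hx 6; have := hx 7
  have := pos42 c x hc hx; have := pos41 c x hc hx
  have h : 0 < pD x * qc c x := by rw [← pC_eq c x hx]; unfold pC; positivity
  exact (pos_iff_pos_of_mul_pos h).1 (posD x hx)
theorem posqg (hc : 0 < c) (hx : ∀ i, 0 < x i) : 0 < qg c x := by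
  obtain ⟨_, _, _, _, _, _, _, _, _, _⟩ := all_pos x hx
  have := pos42 c x hc hx; have := pos41 c x hc hx; have := pos43 c x hc hx
  have h : 0 < (pB x * pD x) * qg c x := by rw [← pG_eq c x hx]; unfold pG; positivity
  exact (pos_iff_pos_of_mul_pos h).1 (mul_pos (posB x hx) (posD x hx))

end pos

/-- Vectors with ten entries are equal when the entries are. -/
theorem vext {a0 a1 a2 a3 a4 a5 a6 a7 a8 a9 b0 b1 b2 b3 b4 b5 b6 b7 b8 b9 : ℝ}
    (h0 : a0 = b0) (h1 : a1 = b1) (h2 : a2 = b2) (h3 : a3 = b3) (h4 : a4 = b4) (h5 : a5 = b5)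
    (h6 : a6 = b6) (h7 : a7 = b7) (h8 : a8 = b8) (h9 : a9 = b9) :
    ![a0, a1, a2, a3, a4, a5, a6, a7, a8, a9] = ![b0, b1, b2, b3, b4, b5, b6, b7, b8, b9] := by
  subst_vars; rfl

/-- `e0` in simplified form. -/
theorem e0_eq (c : ℝ) (x : Fin 10 → ℝ) (hc : 0 < c) (hx : ∀ i, 0 < x i) : e0 c x =
  ![x 0 * c43p c x / (c * c4p x), x 1 * qa c x / (c * c4p x), x 2 * c42p c x / c43p c x,
    x 3 * qg c x / (c * c4p x), x 4 * qc c x / qa c x, x 5 * c41p c x / c42p c x, x 6 / c,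
    x 7 * c4p x / qg c x, x 8 * c4p x / qc c x, x 9 * c4p x / c41p c x] := by
  have := pos42 c x hc hx; have := pos41 c x hc hx; have := pos43 c x hc hx
  have := pos4 x hx; have := posB x hx; have := posD x hx
  have := posqa c x hc hx; have := posqc c x hc hx; have := posqg c x hc hx
  unfold e0
  rw [pA_eq c x hx, pC_eq c x hx, pG_eq c x hx]
  apply vext <;> field_simp
section
variable (c : ℝ) (x : Fin 10 → ℝ) 
theorem e0_0 (hc : 0 < c) (hx : ∀ i, 0 < x i) : e0 c x 0 = x 0 * c43p c x / (c * c4p x) := by rw [e0_eq c x hc hx]; rfl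
theorem e0_1 (hc : 0 < c) (hx : ∀ i, 0 < x i) : e0 c x 1 = x 1 * qa c x / (c * c4p x) := by rw [e0_eq c x hc hx]; rfl
theorem e0_2 (hc : 0 < c) (hx : ∀ i, 0 < x i) : e0 c x 2 = x 2 * c42p c x / c43p c x := by rw [e0_eq c x hc hx]; rfl
theorem e0_3 (hc : 0 < c) (hx : ∀ i, 0 < x i) : e0 c x 3 = x 3 * qg c x / (c * c4p x) := by rw [e0_eq c x hc hx]; rfl
theorem e0_4 (hc : 0 < c) (hx : ∀ i, 0 < x i) : e0 c x 4 = x 4 * qc c x / qa c x := by rw [e0_eq c x hc hx]; rfl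
theorem e0_5 (hc : 0 < c) (hx : ∀ i, 0 < x i) : e0 c x 5 = x 5 * c41p c x / c42p c x := by rw [e0_eq c x hc hx]; rfl
theorem e0_6 (hc : 0 < c) (hx : ∀ i, 0 < x i) : e0 c x 6 = x 6 / c := by rw [e0_eq c x hc hx]; rfl
theorem e0_7 (hc : 0 < c) (hx : ∀ i, 0 < x i) : e0 c x 7 = x 7 * c4p x / qg c x := by rw [e0_eq c x hc hx]; rfl
theorem e0_8 (hc : 0 < c) (hx : ∀ i, 0 < x i) : e0 c x 8 = x 8 * c4p x / qc c x := by rw [e0_eq c x hc hx]; rfl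
theorem e0_9 (hc : 0 < c) (hx : ∀ i, 0 < x i) : e0 c x 9 = x 9 * c4p x / c41p c x := by rw [e0_eq c x hc hx]; rfl

theorem e0_aux (hc : 0 < c) (hx : ∀ i, 0 < x i) : 0 < c4p x ∧ 0 < c41p c x ∧ 0 < c42p c x ∧
    0 < c43p c x ∧ 0 < qa c x ∧ 0 < qc c x ∧ 0 < qg c x :=
  ⟨pos4 x hx, pos41 c x hc hx, pos42 c x hc hx, pos43 c x hc hx, posqa c x hc hx,
    posqc c x hc hx, posqg c x hc hx⟩
theorem e0_pos (hc : 0 < c) (hx : ∀ i, 0 < x i) : ∀ i, 0 < e0 c x i := by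
  obtain ⟨_, _, _, _, _, _, _, _, _, _⟩ := all_pos x hx
  obtain ⟨_, _, _, _, _, _, _⟩ := e0_aux c x hc hx
  apply pos_all <;> rw [e0_eq c x hc hx]
  · show 0 < x 0 * c43p c x / (c * c4p x); positivity
  · show 0 < x 1 * qa c x / (c * c4p x); positivity
  · show 0 < x 2 * c42p c x / c43p c x; positivity
  · show 0 < x 3 * qg c x / (c * c4p x); positivity
  · show 0 < x 4 * qc c x / qa c x; positivity
  · show 0 < x 5 * c41p c x / c42p c x; positivity
  · show 0 < x 6 / c; positivity
  · show 0 < x 7 * c4p x / qg c x; positivity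
  · show 0 < x 8 * c4p x / qc c x; positivity
  · show 0 < x 9 * c4p x / c41p c x; positivity

theorem e0_m14 (hc : 0 < c) (hx : ∀ i, 0 < x i) : m14 (e0 c x) = m14 x / c := by
  rw [m14, e0_6 c x hc hx, m14]
theorem e0_m44 (hc : 0 < c) (hx : ∀ i, 0 < x i) :
    m44 (e0 c x) = m44 x - (1 - 1 / c) * m14 x * m14 x / m11 x := by
  have := hx 0; have := pos4 x hx
  rw [m44, e0_0 c x hc hx, c43p_eq, m14, m44, m11]; field_simp
  try ring
theorem e0_m34 (hc : 0 < c) (hx : ∀ i, 0 < x i) :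
    m34 (e0 c x) = m34 x - (1 - 1 / c) * m13 x * m14 x / m11 x := by
  have := hx 0; have := hx 1; have := pos4 x hx
  rw [m34, e0_1 c x hc hx, m34, m14, m13, m11, qa, c43p_eq]; field_simp
  try ring
theorem e0_m24 (hc : 0 < c) (hx : ∀ i, 0 < x i) :
    m24 (e0 c x) = m24 x - (1 - 1 / c) * m12 x * m14 x / m11 x := by
  have := hx 3; have := pos4 x hx
  rw [m24, e0_3 c x hc hx, m24, m14, m11, qg]; field_simp
  try ring
theorem e0_m33 (hc : 0 < c) (hx : ∀ i, 0 < x i) :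
    m33 (e0 c x) = m33 x - (1 - 1 / c) * m13 x * m13 x / m11 x := by
  have := hx 0; have := hx 1; have := hx 2; have := pos4 x hx; have h3 := pos43 c x hc hx
  rw [m33, e0_1 c x hc hx, e0_0 c x hc hx, e0_2 c x hc hx, m33, m13, m11, qa, c42p_eq]
  field_simp
  simp only [c43p_eq]
  field_simp
  ring
theorem e0_n3 (hc : 0 < c) (hx : ∀ i, 0 < x i) : n3 (e0 c x) = n3 x * c4p x / c43p c x := by
  obtain ⟨_, _, _, _, _, _, _, _, _, _⟩ := all_pos x hx
  obtain ⟨_, _, _, _, _, _, _⟩ := e0_aux c x hc hx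
  have hx7 : x 7 = n3 x - x 6 * x 2 / x 1 - x 6 * x 4 / x 3 := by rw [n3]; ring
  have hx8 : x 8 = n2 x - x 6 * x 5 / x 3 - x 7 * x 5 / x 4 := by rw [n2]; ring
  rw [n3, e0_7 c x hc hx, e0_6 c x hc hx, e0_2 c x hc hx, e0_1 c x hc hx, e0_4 c x hc hx,
    e0_3 c x hc hx]
  field_simp
  simp only [qa, qc, qg, c41p_eq, c42p_eq, c43p_eq, m12, kk, hx8, hx7]
  field_simp
  ring
theorem e0_n2 (hc : 0 < c) (hx : ∀ i, 0 < x i) : n2 (e0 c x) = n2 x * c4p x / c42p c x := by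
  obtain ⟨_, _, _, _, _, _, _, _, _, _⟩ := all_pos x hx
  obtain ⟨_, _, _, _, _, _, _⟩ := e0_aux c x hc hx
  have hx7 : x 7 = n3 x - x 6 * x 2 / x 1 - x 6 * x 4 / x 3 := by rw [n3]; ring
  have hx8 : x 8 = n2 x - x 6 * x 5 / x 3 - x 7 * x 5 / x 4 := by rw [n2]; ring
  rw [n2, e0_7 c x hc hx, e0_6 c x hc hx, e0_5 c x hc hx, e0_8 c x hc hx, e0_4 c x hc hx,
    e0_3 c x hc hx]
  field_simp
  simp only [qa, qc, qg, c41p_eq, c42p_eq, c43p_eq, m12, kk, hx8, hx7]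
  field_simp
  ring
theorem e0_m11 (hc : 0 < c) (hx : ∀ i, 0 < x i) : m11 (e0 c x) = m11 x / c := by
  obtain ⟨_, _, _, _, _, _, _, _, _, _⟩ := all_pos x hx
  obtain ⟨_, _, _, _, _, _, _⟩ := e0_aux c x hc hx
  have hx7 : x 7 = n3 x - x 6 * x 2 / x 1 - x 6 * x 4 / x 3 := by rw [n3]; ring
  have hx8 : x 8 = n2 x - x 6 * x 5 / x 3 - x 7 * x 5 / x 4 := by rw [n2]; ring
  have hx9 : x 9 = c4p x - n2 x ^ 2 / x 5 - n3 x ^ 2 / x 2 - x 6 ^ 2 / x 0 := by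
    rw [c4p_eq]; ring
  rw [m11, c4p_eq, e0_n2 c x hc hx, e0_n3 c x hc hx, e0_9 c x hc hx, e0_5 c x hc hx,
    e0_2 c x hc hx, e0_6 c x hc hx, e0_0 c x hc hx, m11]
  field_simp
  simp only [c41p_eq, c42p_eq, c43p_eq, hx9]
  field_simp
  ring
theorem e0_m13 (hc : 0 < c) (hx : ∀ i, 0 < x i) : m13 (e0 c x) = m13 x / c := by
  obtain ⟨_, _, _, _, _, _, _, _, _, _⟩ := all_pos x hx
  obtain ⟨_, _, _, _, _, _, _⟩ := e0_aux c x hc hx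
  have hx7 : x 7 = n3 x - x 6 * x 2 / x 1 - x 6 * x 4 / x 3 := by rw [n3]; ring
  have hx8 : x 8 = n2 x - x 6 * x 5 / x 3 - x 7 * x 5 / x 4 := by rw [n2]; ring
  rw [m13, e0_n3 c x hc hx, e0_1 c x hc hx, e0_6 c x hc hx, e0_0 c x hc hx, m13]
  field_simp
  simp only [qa, c43p_eq]
  field_simp
  ring
theorem e0_m23 (hc : 0 < c) (hx : ∀ i, 0 < x i) :
    m23 (e0 c x) = m23 x - (1 - 1 / c) * m12 x * m13 x / m11 x := by
  obtain ⟨_, _, _, _, _, _, _, _, _, _⟩ := all_pos x hx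
  obtain ⟨_, _, _, _, _, _, _⟩ := e0_aux c x hc hx
  have hx7 : x 7 = n3 x - x 6 * x 2 / x 1 - x 6 * x 4 / x 3 := by rw [n3]; ring
  have hx8 : x 8 = n2 x - x 6 * x 5 / x 3 - x 7 * x 5 / x 4 := by rw [n2]; ring
  rw [m23, kk, e0_1 c x hc hx, e0_4 c x hc hx, e0_3 c x hc hx, e0_2 c x hc hx, e0_0 c x hc hx,
    m23, m13, m11]
  field_simp
  simp only [qa, qc, qg, c41p_eq, c42p_eq, c43p_eq, m12, kk, hx8, hx7]
  field_simp
  ring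
end
section
variable (c : ℝ) (x : Fin 10 → ℝ)
theorem e0_kk (hc : 0 < c) (hx : ∀ i, 0 < x i) :
    kk (e0 c x) = kk x - (c - 1) * n3 x * (n2 x + kk x * n3 x / x 2) / c43p c x := by
  obtain ⟨_, _, _, _, _, _, _, _, _, _⟩ := all_pos x hx
  obtain ⟨_, _, _, _, _, _, _⟩ := e0_aux c x hc hx
  have hx7 : x 7 = n3 x - x 6 * x 2 / x 1 - x 6 * x 4 / x 3 := by rw [n3]; ring
  have hx8 : x 8 = n2 x - x 6 * x 5 / x 3 - x 7 * x 5 / x 4 := by rw [n2]; ring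
  have h := e0_m23 c x hc hx
  rw [m23, e0_1 c x hc hx, e0_3 c x hc hx, e0_0 c x hc hx, m23, m13, m11] at h
  rw [eq_sub_of_add_eq h]
  field_simp
  simp only [qa, qg, c43p_eq, m12]
  field_simp
  ring
theorem e0_m12 (hc : 0 < c) (hx : ∀ i, 0 < x i) : m12 (e0 c x) = m12 x / c := by
  obtain ⟨_, _, _, _, _, _, _, _, _, _⟩ := all_pos x hx
  obtain ⟨_, _, _, _, _, _, _⟩ := e0_aux c x hc hx
  have hx7 : x 7 = n3 x - x 6 * x 2 / x 1 - x 6 * x 4 / x 3 := by rw [n3]; ring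
  have hx8 : x 8 = n2 x - x 6 * x 5 / x 3 - x 7 * x 5 / x 4 := by rw [n2]; ring
  rw [m12, e0_n2 c x hc hx, e0_n3 c x hc hx, e0_kk c x hc hx, e0_3 c x hc hx, e0_6 c x hc hx,
    e0_0 c x hc hx, e0_2 c x hc hx]
  field_simp
  simp only [qg, c42p_eq, c43p_eq, m12]
  field_simp
  ring
theorem e0_m22 (hc : 0 < c) (hx : ∀ i, 0 < x i) :
    m22 (e0 c x) = m22 x - (1 - 1 / c) * m12 x * m12 x / m11 x := by
  obtain ⟨_, _, _, _, _, _, _, _, _, _⟩ := all_pos x hx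
  obtain ⟨_, _, _, _, _, _, _⟩ := e0_aux c x hc hx
  have hx7 : x 7 = n3 x - x 6 * x 2 / x 1 - x 6 * x 4 / x 3 := by rw [n3]; ring
  have hx8 : x 8 = n2 x - x 6 * x 5 / x 3 - x 7 * x 5 / x 4 := by rw [n2]; ring
  rw [m22, e0_kk c x hc hx, e0_3 c x hc hx, e0_5 c x hc hx,
    e0_0 c x hc hx, e0_2 c x hc hx, m22, m11]
  field_simp
  simp only [qg, c41p_eq, c42p_eq, c43p_eq, m12]
  field_simp
  ring
/-! `ε₂, ε₃, ε₄` under `e0` -/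
theorem e0_ε2 (hc : 0 < c) (hx : ∀ i, 0 < x i) : ε 2 (e0 c x) = ε 2 x := by
  obtain ⟨_, _, _, _, _, _, _, _, _, _⟩ := all_pos x hx
  obtain ⟨_, _, _, _, _, _, _⟩ := e0_aux c x hc hx
  have hx7 : x 7 = n3 x - x 6 * x 2 / x 1 - x 6 * x 4 / x 3 := by rw [n3]; ring
  have hx8 : x 8 = n2 x - x 6 * x 5 / x 3 - x 7 * x 5 / x 4 := by rw [n2]; ring
  show e0 c x 1 / e0 c x 3 + e0 c x 1 * e0 c x 4 * e0 c x 6 / (e0 c x 3 ^ 2 * e0 c x 7)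
    = x 1 / x 3 + x 1 * x 4 * x 6 / (x 3 ^ 2 * x 7)
  rw [e0_1 c x hc hx, e0_3 c x hc hx, e0_4 c x hc hx, e0_6 c x hc hx, e0_7 c x hc hx]
  have h7 : n3 x - x 6 * x 2 / x 1 - x 6 * x 4 / x 3 ≠ 0 := by rw [← hx7]; positivity
  field_simp
  simp only [qa, qc, qg, c41p_eq, c42p_eq, c43p_eq, m12, kk, hx8]
  field_simp
  simp only [hx7]
  field_simp
  ring
theorem e0_ε3 (hc : 0 < c) (hx : ∀ i, 0 < x i) : ε 3 (e0 c x) = ε 3 x := by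
  obtain ⟨_, _, _, _, _, _, _, _, _, _⟩ := all_pos x hx
  obtain ⟨_, _, _, _, _, _, _⟩ := e0_aux c x hc hx
  have hx7 : x 7 = n3 x - x 6 * x 2 / x 1 - x 6 * x 4 / x 3 := by rw [n3]; ring
  have hx8 : x 8 = n2 x - x 6 * x 5 / x 3 - x 7 * x 5 / x 4 := by rw [n2]; ring
  show e0 c x 0 / e0 c x 1 + e0 c x 0 * e0 c x 2 * e0 c x 3 / (e0 c x 1 ^ 2 * e0 c x 4) +
      e0 c x 0 * e0 c x 2 * e0 c x 5 * e0 c x 3 * e0 c x 7 / (e0 c x 1 ^ 2 * e0 c x 4 ^ 2 * e0 c x 8)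
    = x 0 / x 1 + x 0 * x 2 * x 3 / (x 1 ^ 2 * x 4) +
      x 0 * x 2 * x 5 * x 3 * x 7 / (x 1 ^ 2 * x 4 ^ 2 * x 8)
  rw [e0_1 c x hc hx, e0_3 c x hc hx, e0_4 c x hc hx, e0_0 c x hc hx, e0_7 c x hc hx,
    e0_2 c x hc hx, e0_5 c x hc hx, e0_8 c x hc hx]
  field_simp
  simp only [qa, qc, qg, c41p_eq, c42p_eq, c43p_eq, m12, kk, n2]
  field_simp
  simp only [n3]
  field_simp
  ring
theorem e0_ε4 (hc : 0 < c) (hx : ∀ i, 0 < x i) : ε 4 (e0 c x) = ε 4 x := by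
  obtain ⟨_, _, _, _, _, _, _, _, _, _⟩ := all_pos x hx
  obtain ⟨_, _, _, _, _, _, _⟩ := e0_aux c x hc hx
  have hx7 : x 7 = n3 x - x 6 * x 2 / x 1 - x 6 * x 4 / x 3 := by rw [n3]; ring
  have hx8 : x 8 = n2 x - x 6 * x 5 / x 3 - x 7 * x 5 / x 4 := by rw [n2]; ring
  show 1 / e0 c x 0 + e0 c x 1 ^ 2 / (e0 c x 2 * e0 c x 0 ^ 2) +
      e0 c x 1 ^ 2 * e0 c x 4 ^ 2 / (e0 c x 0 ^ 2 * e0 c x 2 ^ 2 * e0 c x 5) +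
      e0 c x 1 ^ 2 * e0 c x 4 ^ 2 * e0 c x 8 ^ 2 / (e0 c x 0 ^ 2 * e0 c x 2 ^ 2 * e0 c x 5 ^ 2 * e0 c x 9)
    = 1 / x 0 + x 1 ^ 2 / (x 2 * x 0 ^ 2) + x 1 ^ 2 * x 4 ^ 2 / (x 0 ^ 2 * x 2 ^ 2 * x 5) +
      x 1 ^ 2 * x 4 ^ 2 * x 8 ^ 2 / (x 0 ^ 2 * x 2 ^ 2 * x 5 ^ 2 * x 9)
  rw [e0_1 c x hc hx, e0_4 c x hc hx, e0_0 c x hc hx, e0_9 c x hc hx,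
    e0_2 c x hc hx, e0_5 c x hc hx, e0_8 c x hc hx]
  have hx8' : x 8 = n2 x - x 5 / x 4 * (n3 x - x 6 * x 2 / x 1) := by
    rw [n2, n3]; field_simp; ring
  field_simp
  simp only [qa, qc, c41p_eq, c42p_eq, c43p_eq, hx8', c4p_eq]
  field_simp
  ring
end
section
variable (c : ℝ) (x : Fin 10 → ℝ)
theorem r2_pos (hc : 0 < c) (hx : ∀ i, 0 < x i) : 0 < r2 c x := by
  obtain ⟨_, _, _, _, _, _, _, _, _, _⟩ := all_pos x hx
  unfold r2
  positivity
theorem e3_aux (hc : 0 < c) (hx : ∀ i, 0 < x i) : 0 < c3 x ∧ 0 < c31 c x ∧ 0 < c32 c x := by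
  obtain ⟨_, _, _, _, _, _, _, _, _, _⟩ := all_pos x hx
  unfold c3 c31 c32
  refine ⟨?_, ?_, ?_⟩ <;> positivity
theorem e4_aux (hc : 0 < c) (hx : ∀ i, 0 < x i) : 0 < c4 x ∧ 0 < c41 c x ∧ 0 < c42 c x ∧ 0 < c43 c x := by
  obtain ⟨_, _, _, _, _, _, _, _, _, _⟩ := all_pos x hx
  unfold c4 c41 c42 c43
  refine ⟨?_, ?_, ?_, ?_⟩ <;> positivity
theorem e1_co : e1 c x 0 = x 0 ∧ e1 c x 1 = x 1 ∧ e1 c x 2 = x 2 ∧ e1 c x 3 = x 3 ∧ e1 c x 4 = x 4 ∧ e1 c x 5 = x 5 ∧ e1 c x 6 = c * x 6 ∧ e1 c x 7 = x 7 ∧ e1 c x 8 = x 8 ∧ e1 c x 9 = x 9 :=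
  ⟨rfl, rfl, rfl, rfl, rfl, rfl, rfl, rfl, rfl, rfl⟩
theorem e1_pos (hc : 0 < c) (hx : ∀ i, 0 < x i) : ∀ i, 0 < e1 c x i := by
  obtain ⟨_, _, _, _, _, _, _, _, _, _⟩ := all_pos x hx
  apply pos_all <;> simp only [e1_co] <;> positivity
theorem e2_co : e2 c x 0 = x 0 ∧ e2 c x 1 = x 1 ∧ e2 c x 2 = x 2 ∧ e2 c x 3 = r2 c x * x 3 ∧ e2 c x 4 = x 4 ∧ e2 c x 5 = x 5 ∧ e2 c x 6 = x 6 ∧ e2 c x 7 = (c / r2 c x) * x 7 ∧ e2 c x 8 = x 8 ∧ e2 c x 9 = x 9 :=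
  ⟨rfl, rfl, rfl, rfl, rfl, rfl, rfl, rfl, rfl, rfl⟩
theorem e2_pos (hc : 0 < c) (hx : ∀ i, 0 < x i) : ∀ i, 0 < e2 c x i := by
  obtain ⟨_, _, _, _, _, _, _, _, _, _⟩ := all_pos x hx
  have := r2_pos c x hc hx
  apply pos_all <;> simp only [e2_co] <;> positivity
theorem e3_co : e3 c x 0 = x 0 ∧ e3 c x 1 = (c31 c x / c3 x) * x 1 ∧ e3 c x 2 = x 2 ∧ e3 c x 3 = x 3 ∧ e3 c x 4 = (c32 c x / c31 c x) * x 4 ∧ e3 c x 5 = x 5 ∧ e3 c x 6 = x 6 ∧ e3 c x 7 = x 7 ∧ e3 c x 8 = (c * c3 x / c32 c x) * x 8 ∧ e3 c x 9 = x 9 :=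
  ⟨rfl, rfl, rfl, rfl, rfl, rfl, rfl, rfl, rfl, rfl⟩
theorem e3_pos (hc : 0 < c) (hx : ∀ i, 0 < x i) : ∀ i, 0 < e3 c x i := by
  obtain ⟨_, _, _, _, _, _, _, _, _, _⟩ := all_pos x hx
  obtain ⟨_, _, _⟩ := e3_aux c x hc hx
  apply pos_all <;> simp only [e3_co] <;> positivity
theorem e4_co : e4 c x 0 = (c41 c x / c4 x) * x 0 ∧ e4 c x 1 = x 1 ∧ e4 c x 2 = (c42 c x / c41 c x) * x 2 ∧ e4 c x 3 = x 3 ∧ e4 c x 4 = x 4 ∧ e4 c x 5 = (c43 c x / c42 c x) * x 5 ∧ e4 c x 6 = x 6 ∧ e4 c x 7 = x 7 ∧ e4 c x 8 = x 8 ∧ e4 c x 9 = (c * c4 x / c43 c x) * x 9 :=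
  ⟨rfl, rfl, rfl, rfl, rfl, rfl, rfl, rfl, rfl, rfl⟩
theorem e4_pos (hc : 0 < c) (hx : ∀ i, 0 < x i) : ∀ i, 0 < e4 c x i := by
  obtain ⟨_, _, _, _, _, _, _, _, _, _⟩ := all_pos x hx
  obtain ⟨_, _, _, _⟩ := e4_aux c x hc hx
  apply pos_all <;> simp only [e4_co] <;> positivity
theorem ε0_def : ε 0 x = m11 x := rfl
theorem ε1_def : ε 1 x = x 3 / x 6 := rfl
theorem ε2_def : ε 2 x = x 1 / x 3 + x 1 * x 4 * x 6 / (x 3 ^ 2 * x 7) := rfl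
theorem ε3_def : ε 3 x = x 0 / x 1 + x 0 * x 2 * x 3 / (x 1 ^ 2 * x 4) +
      x 0 * x 2 * x 5 * x 3 * x 7 / (x 1 ^ 2 * x 4 ^ 2 * x 8) := rfl
theorem ε4_def : ε 4 x = 1 / x 0 + x 1 ^ 2 / (x 2 * x 0 ^ 2) +
      x 1 ^ 2 * x 4 ^ 2 / (x 0 ^ 2 * x 2 ^ 2 * x 5) +
      x 1 ^ 2 * x 4 ^ 2 * x 8 ^ 2 / (x 0 ^ 2 * x 2 ^ 2 * x 5 ^ 2 * x 9) := rfl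
theorem ε0_pos (hx : ∀ i, 0 < x i) : 0 < ε 0 x := by
  obtain ⟨_, _, _, _, _, _, _, _, _, _⟩ := all_pos x hx
  rw [ε0_def, m11, c4p]; positivity
theorem ε1_pos (hx : ∀ i, 0 < x i) : 0 < ε 1 x := by
  obtain ⟨_, _, _, _, _, _, _, _, _, _⟩ := all_pos x hx
  rw [ε1_def]; positivity
theorem ε2_pos (hx : ∀ i, 0 < x i) : 0 < ε 2 x := by
  obtain ⟨_, _, _, _, _, _, _, _, _, _⟩ := all_pos x hx
  rw [ε2_def]; positivity
theorem ε3_pos (hx : ∀ i, 0 < x i) : 0 < ε 3 x := by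
  obtain ⟨_, _, _, _, _, _, _, _, _, _⟩ := all_pos x hx
  rw [ε3_def]; positivity
theorem ε4_pos (hx : ∀ i, 0 < x i) : 0 < ε 4 x := by
  obtain ⟨_, _, _, _, _, _, _, _, _, _⟩ := all_pos x hx
  rw [ε4_def]; positivity
/-! ### The action on the matrix -/
theorem e1_act (hc : 0 < c) (hx : ∀ i, 0 < x i) :
    m44 (e1 c x) = m44 x ∧
    m34 (e1 c x) = m34 x ∧
    m24 (e1 c x) = m24 x ∧
    m14 (e1 c x) = m14 x + (c - 1) / ε 1 x * m24 x ∧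
    m33 (e1 c x) = m33 x ∧
    m23 (e1 c x) = m23 x ∧
    m13 (e1 c x) = m13 x + (c - 1) / ε 1 x * m23 x ∧
    m22 (e1 c x) = m22 x ∧
    m12 (e1 c x) = m12 x + (c - 1) / ε 1 x * m22 x := by
  obtain ⟨_, _, _, _, _, _, _, _, _, _⟩ := all_pos x hx
  have := ε1_pos x hx
  refine ⟨?_, ?_, ?_, ?_, ?_, ?_, ?_, ?_, ?_⟩
  all_goals
    simp only [m44, m34, m24, m14, m33, m23, m13, m22, m12, m11, kk, n3, n2, c4p, e1_co]
    try field_simp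
    try simp only [ε1_def]
    try field_simp
    try ring
theorem e1_m11 (hc : 0 < c) (hx : ∀ i, 0 < x i) :
    m11 (e1 c x) = m11 x + 2 * ((c - 1) / ε 1 x) * m12 x + ((c - 1) / ε 1 x) ^ 2 * m22 x := by
  obtain ⟨_, _, _, _, _, _, _, _, _, _⟩ := all_pos x hx
  have := ε1_pos x hx
  simp only [m44, m34, m24, m14, m33, m23, m13, m22, m12, m11, kk, n3, n2, c4p, e1_co]
  try field_simp
  try simp only [ε1_def]
  try field_simp
  try ring
theorem e1_m22 (hc : 0 < c) (hx : ∀ i, 0 < x i) : m22 (e1 c x) = m22 x := by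
  simp only [e1_act c x hc hx]
theorem e1_m12 (hc : 0 < c) (hx : ∀ i, 0 < x i) : m12 (e1 c x) = m12 x + (c - 1) / ε 1 x * m22 x := by
  simp only [e1_act c x hc hx]
theorem e2_act (hc : 0 < c) (hx : ∀ i, 0 < x i) :
    m44 (e2 c x) = m44 x ∧
    m34 (e2 c x) = m34 x ∧
    m24 (e2 c x) = m24 x + (c - 1) / ε 2 x * m34 x ∧
    m14 (e2 c x) = m14 x ∧
    m33 (e2 c x) = m33 x ∧
    m23 (e2 c x) = m23 x + (c - 1) / ε 2 x * m33 x ∧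
    m13 (e2 c x) = m13 x ∧
    m22 (e2 c x) = m22 x + 2 * ((c - 1) / ε 2 x) * m23 x + ((c - 1) / ε 2 x) ^ 2 * m33 x ∧
    m12 (e2 c x) = m12 x + (c - 1) / ε 2 x * m13 x ∧
    m11 (e2 c x) = m11 x := by
  obtain ⟨_, _, _, _, _, _, _, _, _, _⟩ := all_pos x hx
  have := r2_pos c x hc hx
  have := ε2_pos x hx
  refine ⟨?_, ?_, ?_, ?_, ?_, ?_, ?_, ?_, ?_, ?_⟩
  all_goals
    simp only [m44, m34, m24, m14, m33, m23, m13, m22, m12, m11, kk, n3, n2, c4p, e2_co]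
    try field_simp
    try simp only [r2, ε2_def]
    try field_simp
    try ring
theorem e2_m11 (hc : 0 < c) (hx : ∀ i, 0 < x i) : m11 (e2 c x) = m11 x := by
  simp only [e2_act c x hc hx]
theorem e3_act (hc : 0 < c) (hx : ∀ i, 0 < x i) :
    m44 (e3 c x) = m44 x ∧
    m34 (e3 c x) = m34 x + (c - 1) / ε 3 x * m44 x ∧
    m24 (e3 c x) = m24 x ∧
    m14 (e3 c x) = m14 x ∧
    m33 (e3 c x) = m33 x + 2 * ((c - 1) / ε 3 x) * m34 x + ((c - 1) / ε 3 x) ^ 2 * m44 x ∧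
    m23 (e3 c x) = m23 x + (c - 1) / ε 3 x * m24 x ∧
    m13 (e3 c x) = m13 x + (c - 1) / ε 3 x * m14 x ∧
    m22 (e3 c x) = m22 x ∧
    m12 (e3 c x) = m12 x ∧
    m11 (e3 c x) = m11 x := by
  obtain ⟨_, _, _, _, _, _, _, _, _, _⟩ := all_pos x hx
  obtain ⟨_, _, _⟩ := e3_aux c x hc hx
  have := ε3_pos x hx
  refine ⟨?_, ?_, ?_, ?_, ?_, ?_, ?_, ?_, ?_, ?_⟩
  all_goals
    simp only [m44, m34, m24, m14, m33, m23, m13, m22, m12, m11, kk, n3, n2, c4p, e3_co]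
    try field_simp
    try simp only [c31, c32, c3, ε3_def]
    try field_simp
    try ring
theorem e3_m11 (hc : 0 < c) (hx : ∀ i, 0 < x i) : m11 (e3 c x) = m11 x := by
  simp only [e3_act c x hc hx]
theorem e4_act (hc : 0 < c) (hx : ∀ i, 0 < x i) :
    m44 (e4 c x) = m44 x + (c - 1) / ε 4 x ∧
    m34 (e4 c x) = m34 x ∧
    m24 (e4 c x) = m24 x ∧
    m14 (e4 c x) = m14 x ∧
    m33 (e4 c x) = m33 x ∧
    m23 (e4 c x) = m23 x ∧
    m13 (e4 c x) = m13 x ∧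
    m22 (e4 c x) = m22 x ∧
    m12 (e4 c x) = m12 x ∧
    m11 (e4 c x) = m11 x := by
  obtain ⟨_, _, _, _, _, _, _, _, _, _⟩ := all_pos x hx
  obtain ⟨_, _, _, _⟩ := e4_aux c x hc hx
  have := ε4_pos x hx
  refine ⟨?_, ?_, ?_, ?_, ?_, ?_, ?_, ?_, ?_, ?_⟩
  all_goals
    simp only [m44, m34, m24, m14, m33, m23, m13, m22, m12, m11, kk, n3, n2, c4p, e4_co]
    try field_simp
    try simp only [c41, c42, c43, c4, ε4_def]
    try field_simp
    try ring
theorem e4_m11 (hc : 0 < c) (hx : ∀ i, 0 < x i) : m11 (e4 c x) = m11 x := by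
  simp only [e4_act c x hc hx]
end
/-! ### Auxiliary functions for the rank two relations -/
def P12 (x : Fin 10 → ℝ) : ℝ := x 1 / x 6
def Q12 (x : Fin 10 → ℝ) : ℝ := x 1 * x 4 / (x 3 * x 7)
def P23 (x : Fin 10 → ℝ) : ℝ :=
  x 0 / x 3 * (1 + x 4 * x 6 / (x 3 * x 7) + x 2 * x 6 / (x 1 * x 7))
def Q23 (x : Fin 10 → ℝ) : ℝ :=
  x 0 / x 3 * (x 2 * x 3 / (x 1 * x 4) + x 2 * x 3 * x 5 * x 7 / (x 1 * x 4 ^ 2 * x 8)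
    + x 2 * x 6 * x 5 / (x 1 * x 4 * x 8))
def hh (x : Fin 10 → ℝ) : ℝ :=
  x 8 * x 4 / x 5 + x 3 * x 2 * x 7 / (x 1 * x 4) + x 3 * x 2 * x 8 / (x 1 * x 5)
def mu (x : Fin 10 → ℝ) : ℝ :=
  x 1 / (x 2 * x 0) + kk x * x 1 * x 4 / (x 0 * x 2 ^ 2 * x 5)
    + hh x * x 1 * x 4 * x 8 / (x 0 * x 2 ^ 2 * x 5 * x 9)
def zz (x : Fin 10 → ℝ) : ℝ :=
  1 / x 2 + kk x ^ 2 / (x 5 * x 2 ^ 2) + hh x ^ 2 / (x 2 ^ 2 * x 9)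
section
variable (c : ℝ) (x : Fin 10 → ℝ)
theorem e1_ε1 (hc : 0 < c) (hx : ∀ i, 0 < x i) : ε 1 (e1 c x) = ε 1 x / c := by
  obtain ⟨_, _, _, _, _, _, _, _, _, _⟩ := all_pos x hx
  simp only [ε1_def, e1_co]
  try field_simp
  try ring
theorem e2_ε2 (hc : 0 < c) (hx : ∀ i, 0 < x i) : ε 2 (e2 c x) = ε 2 x / c := by
  obtain ⟨_, _, _, _, _, _, _, _, _, _⟩ := all_pos x hx
  have := r2_pos c x hc hx
  simp only [ε2_def, e2_co]
  try field_simp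
  try simp only [r2]
  try field_simp
  try ring
theorem e3_ε3 (hc : 0 < c) (hx : ∀ i, 0 < x i) : ε 3 (e3 c x) = ε 3 x / c := by
  obtain ⟨_, _, _, _, _, _, _, _, _, _⟩ := all_pos x hx
  obtain ⟨_, _, _⟩ := e3_aux c x hc hx
  simp only [ε3_def, e3_co]
  try field_simp
  try simp only [c31, c32, c3]
  try field_simp
  try ring
theorem e4_ε4 (hc : 0 < c) (hx : ∀ i, 0 < x i) : ε 4 (e4 c x) = ε 4 x / c := by
  obtain ⟨_, _, _, _, _, _, _, _, _, _⟩ := all_pos x hx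
  obtain ⟨_, _, _, _⟩ := e4_aux c x hc hx
  simp only [ε4_def, e4_co]
  try field_simp
  try simp only [c41, c42, c43, c4]
  try field_simp
  try ring
theorem e3_ε1 (hc : 0 < c) (hx : ∀ i, 0 < x i) : ε 1 (e3 c x) = ε 1 x := by
  obtain ⟨_, _, _, _, _, _, _, _, _, _⟩ := all_pos x hx
  obtain ⟨_, _, _⟩ := e3_aux c x hc hx
  simp only [ε1_def, e3_co]
  try field_simp
  try simp only [c31, c32, c3]
  try field_simp
  try ring
theorem e4_ε1 (hc : 0 < c) (hx : ∀ i, 0 < x i) : ε 1 (e4 c x) = ε 1 x := by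
  obtain ⟨_, _, _, _, _, _, _, _, _, _⟩ := all_pos x hx
  obtain ⟨_, _, _, _⟩ := e4_aux c x hc hx
  simp only [ε1_def, e4_co]
  try field_simp
  try simp only [c41, c42, c43, c4]
  try field_simp
  try ring
theorem e4_ε2 (hc : 0 < c) (hx : ∀ i, 0 < x i) : ε 2 (e4 c x) = ε 2 x := by
  obtain ⟨_, _, _, _, _, _, _, _, _, _⟩ := all_pos x hx
  obtain ⟨_, _, _, _⟩ := e4_aux c x hc hx
  simp only [ε2_def, e4_co]
  try field_simp
  try simp only [c41, c42, c43, c4]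
  try field_simp
  try ring
theorem e1_ε3 (hc : 0 < c) (hx : ∀ i, 0 < x i) : ε 3 (e1 c x) = ε 3 x := by
  obtain ⟨_, _, _, _, _, _, _, _, _, _⟩ := all_pos x hx
  simp only [ε3_def, e1_co]
  try field_simp
  try ring
theorem e1_ε4 (hc : 0 < c) (hx : ∀ i, 0 < x i) : ε 4 (e1 c x) = ε 4 x := by
  obtain ⟨_, _, _, _, _, _, _, _, _, _⟩ := all_pos x hx
  simp only [ε4_def, e1_co]
  try field_simp
  try ring
theorem e2_ε4 (hc : 0 < c) (hx : ∀ i, 0 < x i) : ε 4 (e2 c x) = ε 4 x := by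
  obtain ⟨_, _, _, _, _, _, _, _, _, _⟩ := all_pos x hx
  have := r2_pos c x hc hx
  simp only [ε4_def, e2_co]
  try field_simp
  try simp only [r2]
  try field_simp
  try ring
theorem PQ12 (hx : ∀ i, 0 < x i) : ε 1 x * ε 2 x = P12 x + Q12 x := by
  obtain ⟨_, _, _, _, _, _, _, _, _, _⟩ := all_pos x hx
  simp only [ε1_def, ε2_def, P12, Q12]
  try field_simp
  try ring
theorem e1_P12 (hc : 0 < c) (hx : ∀ i, 0 < x i) : P12 (e1 c x) = P12 x / c := by
  obtain ⟨_, _, _, _, _, _, _, _, _, _⟩ := all_pos x hx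
  simp only [P12, e1_co]
  try field_simp
  try ring
theorem e2_P12 (hc : 0 < c) (hx : ∀ i, 0 < x i) : P12 (e2 c x) = P12 x := by
  obtain ⟨_, _, _, _, _, _, _, _, _, _⟩ := all_pos x hx
  have := r2_pos c x hc hx
  simp only [P12, e2_co]
  try field_simp
  try simp only [r2]
  try field_simp
  try ring
theorem e1_Q12 (hc : 0 < c) (hx : ∀ i, 0 < x i) : Q12 (e1 c x) = Q12 x := by
  obtain ⟨_, _, _, _, _, _, _, _, _, _⟩ := all_pos x hx
  simp only [Q12, e1_co]
  try field_simp
  try ring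
theorem e2_Q12 (hc : 0 < c) (hx : ∀ i, 0 < x i) : Q12 (e2 c x) = Q12 x / c := by
  obtain ⟨_, _, _, _, _, _, _, _, _, _⟩ := all_pos x hx
  have := r2_pos c x hc hx
  simp only [Q12, e2_co]
  try field_simp
  try simp only [r2]
  try field_simp
  try ring
theorem PQ23 (hx : ∀ i, 0 < x i) : ε 2 x * ε 3 x = P23 x + Q23 x := by
  obtain ⟨_, _, _, _, _, _, _, _, _, _⟩ := all_pos x hx
  simp only [ε2_def, ε3_def, P23, Q23]
  try field_simp
  try ring
theorem e2_P23 (hc : 0 < c) (hx : ∀ i, 0 < x i) : P23 (e2 c x) = P23 x / c := by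
  obtain ⟨_, _, _, _, _, _, _, _, _, _⟩ := all_pos x hx
  have := r2_pos c x hc hx
  simp only [P23, e2_co]
  try field_simp
  try simp only [r2]
  try field_simp
  try ring
theorem e3_P23 (hc : 0 < c) (hx : ∀ i, 0 < x i) : P23 (e3 c x) = P23 x := by
  obtain ⟨_, _, _, _, _, _, _, _, _, _⟩ := all_pos x hx
  obtain ⟨_, _, _⟩ := e3_aux c x hc hx
  simp only [P23, e3_co]
  try field_simp
  try simp only [c31, c32, c3]
  try field_simp
  try ring
theorem e2_Q23 (hc : 0 < c) (hx : ∀ i, 0 < x i) : Q23 (e2 c x) = Q23 x := by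
  obtain ⟨_, _, _, _, _, _, _, _, _, _⟩ := all_pos x hx
  have := r2_pos c x hc hx
  simp only [Q23, e2_co]
  try field_simp
  try simp only [r2]
  try field_simp
  try ring
theorem e3_Q23 (hc : 0 < c) (hx : ∀ i, 0 < x i) : Q23 (e3 c x) = Q23 x / c := by
  obtain ⟨_, _, _, _, _, _, _, _, _, _⟩ := all_pos x hx
  obtain ⟨_, _, _⟩ := e3_aux c x hc hx
  simp only [Q23, e3_co]
  try field_simp
  try simp only [c31, c32, c3]
  try field_simp
  try ring
theorem e3_mu (hc : 0 < c) (hx : ∀ i, 0 < x i) : mu (e3 c x) = mu x + (c - 1) * zz x / ε 3 x := by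
  obtain ⟨_, _, _, _, _, _, _, _, _, _⟩ := all_pos x hx
  obtain ⟨_, _, _⟩ := e3_aux c x hc hx
  have := ε3_pos x hx
  simp only [mu, zz, kk, hh, e3_co]
  try field_simp
  try simp only [c31, c32, c3, ε3_def]
  try field_simp
  try ring
theorem e3_zz (hc : 0 < c) (hx : ∀ i, 0 < x i) : zz (e3 c x) = zz x := by
  obtain ⟨_, _, _, _, _, _, _, _, _, _⟩ := all_pos x hx
  obtain ⟨_, _, _⟩ := e3_aux c x hc hx
  simp only [zz, kk, hh, e3_co]
  try field_simp
  try simp only [c31, c32, c3]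
  try field_simp
  try ring
theorem e3_ε4 (hc : 0 < c) (hx : ∀ i, 0 < x i) : ε 4 (e3 c x) = ε 4 x + 2 * (c - 1) * mu x / ε 3 x + (c - 1) ^ 2 * zz x / ε 3 x ^ 2 := by
  obtain ⟨_, _, _, _, _, _, _, _, _, _⟩ := all_pos x hx
  obtain ⟨_, _, _⟩ := e3_aux c x hc hx
  have := ε3_pos x hx
  simp only [ε4_def, mu, zz, kk, hh, e3_co]
  try field_simp
  try simp only [c31, c32, c3, ε3_def]
  try field_simp
  try ring
theorem e4_mu (hc : 0 < c) (hx : ∀ i, 0 < x i) : mu (e4 c x) = mu x / c := by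
  obtain ⟨_, _, _, _, _, _, _, _, _, _⟩ := all_pos x hx
  obtain ⟨_, _, _, _⟩ := e4_aux c x hc hx
  simp only [mu, kk, hh, e4_co]
  try field_simp
  try simp only [c41, c42, c43, c4]
  try field_simp
  try ring
theorem e4_zz (hc : 0 < c) (hx : ∀ i, 0 < x i) : zz (e4 c x) = zz x - (1 - 1 / c) * mu x ^ 2 / ε 4 x := by
  obtain ⟨_, _, _, _, _, _, _, _, _, _⟩ := all_pos x hx
  obtain ⟨_, _, _, _⟩ := e4_aux c x hc hx
  have := ε4_pos x hx
  simp only [zz, mu, kk, hh, e4_co]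
  try field_simp
  try simp only [c41, c42, c43, c4, ε4_def]
  try field_simp
  try ring
theorem e4_ε3 (hc : 0 < c) (hx : ∀ i, 0 < x i) : ε 3 (e4 c x) = c * ε 3 x - (c - 1) * mu x / ε 4 x := by
  obtain ⟨_, _, _, _, _, _, _, _, _, _⟩ := all_pos x hx
  obtain ⟨_, _, _, _⟩ := e4_aux c x hc hx
  have := ε4_pos x hx
  simp only [ε3_def, mu, kk, hh, e4_co]
  try field_simp
  try simp only [c41, c42, c43, c4, ε4_def]
  try field_simp
  try ring
end
/-! ### Scalar identities behind the rank two relations -/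
theorem scalA {E F P Q c1 c2 : ℝ} (hE : 0 < E) (hF : 0 < F) (hP : 0 < P) (hQ : 0 < Q)
    (h : E * F = P + Q) (h1 : 0 < c1) (h2 : 0 < c2) :
    (c1 - 1) / ((c1 * P + Q) / ((P + c2 * Q) / E)) + (c2 - 1) / E
        = (c1 * c2 - 1) / ((c1 * P + Q) / F) ∧
      (c1 * c2 - 1) / ((P + c2 * Q) / E)
        = (c2 - 1) / ((P + c2 * Q) / ((c1 * P + Q) / F)) + (c1 - 1) / F ∧
      (c1 - 1) / ((c1 * P + Q) / ((P + c2 * Q) / E)) * ((c1 * c2 - 1) / ((P + c2 * Q) / E))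
        = (c1 * c2 - 1) / ((c1 * P + Q) / F) * ((c1 - 1) / F) := by
  have hp : P = E * F - Q := by linarith
  have ha : 0 < P + c2 * Q := by positivity
  have hb : 0 < c1 * P + Q := by positivity
  refine ⟨?_, ?_, ?_⟩ <;> field_simp <;> rw [hp] <;> ring

def fA1 (e E m c2 : ℝ) : ℝ := c2 * e * E - (c2 - 1) * m
def fA2 (e E m Z c1 c2 : ℝ) : ℝ := c2 * e ^ 2 * E ^ 2 + 2 * (c1 * c2 - c2) * e * E * m
  + (c2 - 1) * (1 - c1 ^ 2 * c2) * m ^ 2 + (c1 * c2 - 1) ^ 2 * Z * e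
def fB1 (e E m Z c1 : ℝ) : ℝ := e * E ^ 2 + 2 * (c1 - 1) * m * E + (c1 - 1) ^ 2 * Z
def fB2 (e E m Z c1 c2 : ℝ) : ℝ := c1 * c2 * e * E ^ 2 + (c1 ^ 2 * c2 - 2 * c1 * c2 + 1) * m * E
  + (c1 - 1) * (1 - c1 * c2) * Z

/-- The successive values of `ε` along both sides of the relation of type `C₂`. -/
theorem scalC {e E m Z c1 c2 E1 e2 E3 e1' E2' e3' : ℝ} (he : 0 < e) (hE : 0 < E)
    (h1 : 0 < c1) (h2 : 0 < c2) (pE1 : 0 < E1) (pe2 : 0 < e2) (pE3 : 0 < E3)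
    (pe1 : 0 < e1') (pE2 : 0 < E2') (pe3 : 0 < e3')
    (hE1 : E1 = c2 * E - (c2 - 1) * m / e)
    (he2 : e2 = e / c2 + 2 * (c1 * c2 - 1) * (m / c2) / E1
      + (c1 * c2 - 1) ^ 2 * (Z - (1 - 1 / c2) * m ^ 2 / e) / E1 ^ 2)
    (hE3 : E3 = c1 ^ 2 * c2 * (E1 / (c1 * c2)) - (c1 ^ 2 * c2 - 1) *
      (m / c2 + (c1 * c2 - 1) * (Z - (1 - 1 / c2) * m ^ 2 / e) / E1) / e2)
    (he1' : e1' = e + 2 * (c1 - 1) * m / E + (c1 - 1) ^ 2 * Z / E ^ 2)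
    (hE2' : E2' = c1 ^ 2 * c2 * (E / c1) - (c1 ^ 2 * c2 - 1) * (m + (c1 - 1) * Z / E) / e1')
    (he3' : e3' = e1' / (c1 ^ 2 * c2)
      + 2 * (c1 * c2 - 1) * ((m + (c1 - 1) * Z / E) / (c1 ^ 2 * c2)) / E2'
      + (c1 * c2 - 1) ^ 2 * (Z - (1 - 1 / (c1 ^ 2 * c2)) * (m + (c1 - 1) * Z / E) ^ 2 / e1')
        / E2' ^ 2) :
    ∃ A1 A2 B1 B2 : ℝ, A1 ≠ 0 ∧ A2 ≠ 0 ∧ B1 ≠ 0 ∧ B2 ≠ 0 ∧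
      A1 = fA1 e E m c2 ∧ A2 = fA2 e E m Z c1 c2 ∧ B1 = fB1 e E m Z c1 ∧ B2 = fB2 e E m Z c1 c2 ∧
      E1 = A1 / e ∧ e2 = e * A2 / A1 ^ 2 ∧ E3 = A1 * B2 / A2 ∧ e1' = B1 / E ^ 2 ∧
      E2' = E * B2 / B1 ∧ e3' = B1 * A2 / B2 ^ 2 := by
  have k1 : E1 = fA1 e E m c2 / e := by rw [hE1, fA1]; field_simp
  have n1 : fA1 e E m c2 ≠ 0 := by
    intro h; rw [h] at k1; simp at k1; exact pE1.ne' k1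
  have k2 : e2 = e * fA2 e E m Z c1 c2 / fA1 e E m c2 ^ 2 := by
    rw [he2, k1]; field_simp; rw [fA1, fA2]; ring
  have n2 : fA2 e E m Z c1 c2 ≠ 0 := by
    intro h; rw [h] at k2; simp at k2; exact pe2.ne' k2
  have k3 : E3 = fA1 e E m c2 * fB2 e E m Z c1 c2 / fA2 e E m Z c1 c2 := by
    rw [hE3, k2, k1]; field_simp; rw [fA1, fA2, fB2]; ring
  have n4 : fB2 e E m Z c1 c2 ≠ 0 := by
    intro h; rw [h] at k3; simp at k3; exact pE3.ne' k3
  have k4 : e1' = fB1 e E m Z c1 / E ^ 2 := by rw [he1', fB1]; field_simp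
  have n3 : fB1 e E m Z c1 ≠ 0 := by
    intro h; rw [h] at k4; simp at k4; exact pe1.ne' k4
  have k5 : E2' = E * fB2 e E m Z c1 c2 / fB1 e E m Z c1 := by
    rw [hE2', k4]; field_simp; rw [fB1, fB2]; ring
  have k6 : e3' = fB1 e E m Z c1 * fA2 e E m Z c1 c2 / fB2 e E m Z c1 c2 ^ 2 := by
    rw [he3', k5, k4]; field_simp; rw [fB1, fA2, fB2]; ring
  exact ⟨_, _, _, _, n1, n2, n3, n4, rfl, rfl, rfl, rfl, k1, k2, k3, k4, k5, k6⟩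

theorem scalC_rel {e E m Z c1 c2 A1 A2 B1 B2 : ℝ} (he : 0 < e) (hE : 0 < E)
    (h1 : 0 < c1) (h2 : 0 < c2) (n1 : A1 ≠ 0) (n2 : A2 ≠ 0) (n3 : B1 ≠ 0) (n4 : B2 ≠ 0)
    (hA1 : A1 = fA1 e E m c2) (hA2 : A2 = fA2 e E m Z c1 c2) (hB1 : B1 = fB1 e E m Z c1)
    (hB2 : B2 = fB2 e E m Z c1 c2) {a b d f a' b' d' f' : ℝ}
    (ha : a = (c1 - 1) / (A1 * B2 / A2)) (hb : b = (c1 ^ 2 * c2 - 1) / (e * A2 / A1 ^ 2))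
    (hd : d = (c1 * c2 - 1) / (A1 / e)) (hf : f = (c2 - 1) / e)
    (ha' : a' = (c1 - 1) / E) (hb' : b' = (c1 ^ 2 * c2 - 1) / (B1 / E ^ 2))
    (hd' : d' = (c1 * c2 - 1) / (E * B2 / B1)) (hf' : f' = (c2 - 1) / (B1 * A2 / B2 ^ 2)) :
    a + d = a' + d' ∧ f + b = b' + f' ∧ d * f + a * (f + b) = d' * b' ∧
      (a + d) ^ 2 * f + a ^ 2 * b = d' ^ 2 * b' := by
  rw [ha, hb, hd, hf, ha', hb', hd', hf']
  refine ⟨?_, ?_, ?_, ?_⟩ <;> field_simp <;> simp only [hA1, hA2, hB1, hB2, fA1, fA2, fB1, fB2] <;> ring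

/-- Entries outside the first row. -/
theorem scal_pq {e E m Z c1 c2 A1 A2 B1 B2 : ℝ} (he : 0 < e) (hE : 0 < E)
    (h1 : 0 < c1) (h2 : 0 < c2) (n1 : A1 ≠ 0) (n2 : A2 ≠ 0) (n3 : B1 ≠ 0) (n4 : B2 ≠ 0)
    (hA1 : A1 = fA1 e E m c2) (hA2 : A2 = fA2 e E m Z c1 c2) (hB1 : B1 = fB1 e E m Z c1)
    (hB2 : B2 = fB2 e E m Z c1 c2) (u1 u2 v1 v2 w : ℝ) {U V U' V' : ℝ}
    (hU : U = u1 / c2 + (c1 * c2 - 1) / (A1 / e) * (u2 - (1 - 1 / c2) * m * u1 / e))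
    (hV : V = v1 / c2 + (c1 * c2 - 1) / (A1 / e) * (v2 - (1 - 1 / c2) * m * v1 / e))
    (hU' : U' = (u1 + (c1 - 1) / E * u2) / (c1 ^ 2 * c2) + (c1 * c2 - 1) / (E * B2 / B1) *
      (u2 - (1 - 1 / (c1 ^ 2 * c2)) * (m + (c1 - 1) / E * Z) * (u1 + (c1 - 1) / E * u2)
        / (B1 / E ^ 2)))
    (hV' : V' = (v1 + (c1 - 1) / E * v2) / (c1 ^ 2 * c2) + (c1 * c2 - 1) / (E * B2 / B1) *
      (v2 - (1 - 1 / (c1 ^ 2 * c2)) * (m + (c1 - 1) / E * Z) * (v1 + (c1 - 1) / E * v2)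
        / (B1 / E ^ 2))) :
    w - (1 - 1 / c2) * u1 * v1 / e - (1 - 1 / (c1 ^ 2 * c2)) * U * V / (e * A2 / A1 ^ 2)
    = w - (1 - 1 / (c1 ^ 2 * c2)) * (u1 + (c1 - 1) / E * u2) * (v1 + (c1 - 1) / E * v2)
        / (B1 / E ^ 2)
      - (1 - 1 / c2) * U' * V' / (B1 * A2 / B2 ^ 2) := by
  rw [hU, hV, hU', hV']
  field_simp
  rw [hA1, hA2, hB1, hB2, fA1, fA2, fB1, fB2]; ring

/-- Entries of the first row, off the diagonal. -/
theorem scal_1p {e E m Z c1 c2 A1 A2 B1 B2 : ℝ} (he : 0 < e) (hE : 0 < E)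
    (h1 : 0 < c1) (h2 : 0 < c2) (n1 : A1 ≠ 0) (n2 : A2 ≠ 0) (n3 : B1 ≠ 0) (n4 : B2 ≠ 0)
    (hA1 : A1 = fA1 e E m c2) (hA2 : A2 = fA2 e E m Z c1 c2) (hB1 : B1 = fB1 e E m Z c1)
    (hB2 : B2 = fB2 e E m Z c1 c2) (u1 u2 : ℝ) {U M2 U' : ℝ}
    (hU : U = u1 / c2 + (c1 * c2 - 1) / (A1 / e) * (u2 - (1 - 1 / c2) * m * u1 / e))
    (hM2 : M2 = m / c2 + (c1 * c2 - 1) / (A1 / e) * (Z - (1 - 1 / c2) * m * m / e))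
    (hU' : U' = (u1 + (c1 - 1) / E * u2) / (c1 ^ 2 * c2) + (c1 * c2 - 1) / (E * B2 / B1) *
      (u2 - (1 - 1 / (c1 ^ 2 * c2)) * (m + (c1 - 1) / E * Z) * (u1 + (c1 - 1) / E * u2)
        / (B1 / E ^ 2))) :
    U / (c1 ^ 2 * c2) + (c1 - 1) / (A1 * B2 / A2) * (u2 - (1 - 1 / c2) * m * u1 / e
        - (1 - 1 / (c1 ^ 2 * c2)) * M2 * U / (e * A2 / A1 ^ 2)) = U' / c2 := by
  rw [hU, hM2, hU']
  field_simp
  rw [hA1, hA2, hB1, hB2, fA1, fA2, fB1, fB2]; ring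

theorem scal_11 {e E m Z c1 c2 A1 A2 B1 B2 : ℝ} (he : 0 < e) (hE : 0 < E)
    (h1 : 0 < c1) (h2 : 0 < c2) (n1 : A1 ≠ 0) (n2 : A2 ≠ 0) (n3 : B1 ≠ 0) (n4 : B2 ≠ 0)
    (hA1 : A1 = fA1 e E m c2) (hA2 : A2 = fA2 e E m Z c1 c2) (hB1 : B1 = fB1 e E m Z c1)
    (hB2 : B2 = fB2 e E m Z c1 c2) {M2 : ℝ}
    (hM2 : M2 = m / c2 + (c1 * c2 - 1) / (A1 / e) * (Z - (1 - 1 / c2) * m * m / e)) :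
    (e * A2 / A1 ^ 2) / (c1 ^ 2 * c2) + 2 * ((c1 - 1) / (A1 * B2 / A2)) * (M2 / (c1 ^ 2 * c2))
      + ((c1 - 1) / (A1 * B2 / A2)) ^ 2 * (Z - (1 - 1 / c2) * m * m / e
        - (1 - 1 / (c1 ^ 2 * c2)) * M2 * M2 / (e * A2 / A1 ^ 2)) = (B1 * A2 / B2 ^ 2) / c2 := by
  rw [hM2]
  field_simp
  rw [hA1, hA2, hB1, hB2, fA1, fA2, fB1, fB2]; ring
/-! ### Bundled form of the action on the matrix -/
section
variable (c : ℝ) (x : Fin 10 → ℝ)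
theorem e0_act (hc : 0 < c) (hx : ∀ i, 0 < x i) :
    m44 (e0 c x) = m44 x - (1 - 1 / c) * m14 x * m14 x / m11 x ∧
    m34 (e0 c x) = m34 x - (1 - 1 / c) * m13 x * m14 x / m11 x ∧
    m24 (e0 c x) = m24 x - (1 - 1 / c) * m12 x * m14 x / m11 x ∧
    m14 (e0 c x) = m14 x / c ∧
    m33 (e0 c x) = m33 x - (1 - 1 / c) * m13 x * m13 x / m11 x ∧
    m23 (e0 c x) = m23 x - (1 - 1 / c) * m12 x * m13 x / m11 x ∧
    m13 (e0 c x) = m13 x / c ∧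
    m22 (e0 c x) = m22 x - (1 - 1 / c) * m12 x * m12 x / m11 x ∧
    m12 (e0 c x) = m12 x / c :=
  ⟨e0_m44 c x hc hx, e0_m34 c x hc hx, e0_m24 c x hc hx, e0_m14 c x hc hx, e0_m33 c x hc hx, e0_m23 c x hc hx, e0_m13 c x hc hx, e0_m22 c x hc hx, e0_m12 c x hc hx⟩

theorem e0_ε1 (hc : 0 < c) (hx : ∀ i, 0 < x i) :
    ε 1 (e0 c x) = c * ε 1 x - (c - 1) * m12 x / m11 x := by
  have := hx 6; have : 0 < m11 x := pos4 x hx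
  have h1 : ε 1 (e0 c x) = m24 (e0 c x) / m14 (e0 c x) := rfl
  have h2 : ε 1 x = m24 x / m14 x := rfl
  have : 0 < m14 x := hx 6
  rw [h1, h2, e0_m24 c x hc hx, e0_m14 c x hc hx]
  field_simp
theorem e1_ε2 (hc : 0 < c) (hx : ∀ i, 0 < x i) :
    ε 2 (e1 c x) = (P12 x + c * Q12 x) / ε 1 x := by
  have := ε1_pos x hx
  have h := PQ12 (e1 c x) (e1_pos c x hc hx)
  rw [e1_ε1 c x hc hx, e1_P12 c x hc hx, e1_Q12 c x hc hx] at h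
  field_simp at h ⊢
  linarith
theorem e2_ε1 (hc : 0 < c) (hx : ∀ i, 0 < x i) :
    ε 1 (e2 c x) = (c * P12 x + Q12 x) / ε 2 x := by
  have := ε2_pos x hx
  have h := PQ12 (e2 c x) (e2_pos c x hc hx)
  rw [e2_ε2 c x hc hx, e2_P12 c x hc hx, e2_Q12 c x hc hx] at h
  field_simp at h ⊢
  linarith
theorem P12_pos (hx : ∀ i, 0 < x i) : 0 < P12 x := by
  have := hx 0; have := hx 1; have := hx 2; have := hx 3; have := hx 4; have := hx 6; have := hx 7
  unfold P12; positivity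
theorem Q12_pos (hx : ∀ i, 0 < x i) : 0 < Q12 x := by
  have := hx 0; have := hx 1; have := hx 2; have := hx 3; have := hx 4; have := hx 5
  have := hx 6; have := hx 7; have := hx 8
  unfold Q12; positivity
theorem e2_ε3 (hc : 0 < c) (hx : ∀ i, 0 < x i) :
    ε 3 (e2 c x) = (P23 x + c * Q23 x) / ε 2 x := by
  have := ε2_pos x hx
  have h := PQ23 (e2 c x) (e2_pos c x hc hx)
  rw [e2_ε2 c x hc hx, e2_P23 c x hc hx, e2_Q23 c x hc hx] at h
  field_simp at h ⊢
  linarith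
theorem e3_ε2 (hc : 0 < c) (hx : ∀ i, 0 < x i) :
    ε 2 (e3 c x) = (c * P23 x + Q23 x) / ε 3 x := by
  have := ε3_pos x hx
  have h := PQ23 (e3 c x) (e3_pos c x hc hx)
  rw [e3_ε3 c x hc hx, e3_P23 c x hc hx, e3_Q23 c x hc hx] at h
  field_simp at h ⊢
  linarith
theorem P23_pos (hx : ∀ i, 0 < x i) : 0 < P23 x := by
  have := hx 0; have := hx 1; have := hx 2; have := hx 3; have := hx 4; have := hx 6; have := hx 7
  unfold P23; positivity
theorem Q23_pos (hx : ∀ i, 0 < x i) : 0 < Q23 x := by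
  have := hx 0; have := hx 1; have := hx 2; have := hx 3; have := hx 4; have := hx 5
  have := hx 6; have := hx 7; have := hx 8
  unfold Q23; positivity

/-! ### Unit and composition -/
theorem e0_one (hx : ∀ i, 0 < x i) : e0 1 x = x := by
  apply m_inj _ _ (e0_pos 1 x one_pos hx) <;>
    simp only [e0_act 1 x one_pos hx, e0_m11 1 x one_pos hx] <;> ring
theorem e0_mul (c1 c2 : ℝ) (h1 : 0 < c1) (h2 : 0 < c2) (hx : ∀ i, 0 < x i) :
    e0 (c1 * c2) x = e0 c1 (e0 c2 x) := by
  have hy := e0_pos c2 x h2 hx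
  have h12 := mul_pos h1 h2
  have : 0 < ε 0 x := ε0_pos x hx
  rw [ε0_def] at this
  apply m_inj _ _ (e0_pos _ x h12 hx) <;>
    simp only [e0_act _ x h12 hx, e0_m11 _ x h12 hx, e0_act c1 _ h1 hy, e0_m11 c1 _ h1 hy,
      e0_act c2 x h2 hx, e0_m11 c2 x h2 hx] <;>
    field_simp <;> ring
theorem e1_one (hx : ∀ i, 0 < x i) : e1 1 x = x := by
  apply m_inj _ _ (e1_pos 1 x one_pos hx) <;>
    simp only [e1_act 1 x one_pos hx, e1_m11 1 x one_pos hx] <;> ring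
theorem e1_mul (c1 c2 : ℝ) (h1 : 0 < c1) (h2 : 0 < c2) (hx : ∀ i, 0 < x i) :
    e1 (c1 * c2) x = e1 c1 (e1 c2 x) := by
  have hy := e1_pos c2 x h2 hx
  have h12 := mul_pos h1 h2
  have : 0 < ε 1 x := ε1_pos x hx
  skip
  apply m_inj _ _ (e1_pos _ x h12 hx) <;>
    simp only [e1_act _ x h12 hx, e1_m11 _ x h12 hx, e1_act c1 _ h1 hy, e1_m11 c1 _ h1 hy,
      e1_act c2 x h2 hx, e1_m11 c2 x h2 hx, e1_ε1 c2 x h2 hx] <;>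
    field_simp <;> ring
theorem e2_one (hx : ∀ i, 0 < x i) : e2 1 x = x := by
  apply m_inj _ _ (e2_pos 1 x one_pos hx) <;>
    simp only [e2_act 1 x one_pos hx] <;> ring
theorem e2_mul (c1 c2 : ℝ) (h1 : 0 < c1) (h2 : 0 < c2) (hx : ∀ i, 0 < x i) :
    e2 (c1 * c2) x = e2 c1 (e2 c2 x) := by
  have hy := e2_pos c2 x h2 hx
  have h12 := mul_pos h1 h2
  have : 0 < ε 2 x := ε2_pos x hx
  skip
  apply m_inj _ _ (e2_pos _ x h12 hx) <;>
    simp only [e2_act _ x h12 hx, e2_act c1 _ h1 hy,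
      e2_act c2 x h2 hx, e2_ε2 c2 x h2 hx] <;>
    field_simp <;> ring
theorem e3_one (hx : ∀ i, 0 < x i) : e3 1 x = x := by
  apply m_inj _ _ (e3_pos 1 x one_pos hx) <;>
    simp only [e3_act 1 x one_pos hx] <;> ring
theorem e3_mul (c1 c2 : ℝ) (h1 : 0 < c1) (h2 : 0 < c2) (hx : ∀ i, 0 < x i) :
    e3 (c1 * c2) x = e3 c1 (e3 c2 x) := by
  have hy := e3_pos c2 x h2 hx
  have h12 := mul_pos h1 h2
  have : 0 < ε 3 x := ε3_pos x hx
  skip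
  apply m_inj _ _ (e3_pos _ x h12 hx) <;>
    simp only [e3_act _ x h12 hx, e3_act c1 _ h1 hy,
      e3_act c2 x h2 hx, e3_ε3 c2 x h2 hx] <;>
    field_simp <;> ring
theorem e4_one (hx : ∀ i, 0 < x i) : e4 1 x = x := by
  apply m_inj _ _ (e4_pos 1 x one_pos hx) <;>
    simp only [e4_act 1 x one_pos hx] <;> ring
theorem e4_mul (c1 c2 : ℝ) (h1 : 0 < c1) (h2 : 0 < c2) (hx : ∀ i, 0 < x i) :
    e4 (c1 * c2) x = e4 c1 (e4 c2 x) := by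
  have hy := e4_pos c2 x h2 hx
  have h12 := mul_pos h1 h2
  have : 0 < ε 4 x := ε4_pos x hx
  skip
  apply m_inj _ _ (e4_pos _ x h12 hx) <;>
    simp only [e4_act _ x h12 hx, e4_act c1 _ h1 hy,
      e4_act c2 x h2 hx, e4_ε4 c2 x h2 hx] <;>
    field_simp <;> ring

/-! ### Commutation -/
theorem comm02 (c1 c2 : ℝ) (h1 : 0 < c1) (h2 : 0 < c2) (hx : ∀ i, 0 < x i) :
    e0 c1 (e2 c2 x) = e2 c2 (e0 c1 x) := by
  have hy := e0_pos c1 x h1 hx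
  have hz := e2_pos c2 x h2 hx
  have : 0 < ε 0 x := ε0_pos x hx
  have : 0 < ε 2 x := ε2_pos x hx
  have : 0 < m11 x := ε0_pos x hx
  apply m_inj _ _ (e0_pos c1 _ h1 hz) <;>
    simp only [e0_act c1 _ h1 hz, e0_m11 c1 _ h1 hz, e2_act c2 x h2 hx,
      e2_act c2 _ h2 hy, e0_act c1 x h1 hx, e0_m11 c1 x h1 hx,
      e0_ε2 c1 x h1 hx] <;>
    try (field_simp <;> ring)
theorem comm03 (c1 c2 : ℝ) (h1 : 0 < c1) (h2 : 0 < c2) (hx : ∀ i, 0 < x i) :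
    e0 c1 (e3 c2 x) = e3 c2 (e0 c1 x) := by
  have hy := e0_pos c1 x h1 hx
  have hz := e3_pos c2 x h2 hx
  have : 0 < ε 0 x := ε0_pos x hx
  have : 0 < ε 3 x := ε3_pos x hx
  have : 0 < m11 x := ε0_pos x hx
  apply m_inj _ _ (e0_pos c1 _ h1 hz) <;>
    simp only [e0_act c1 _ h1 hz, e0_m11 c1 _ h1 hz, e3_act c2 x h2 hx,
      e3_act c2 _ h2 hy, e0_act c1 x h1 hx, e0_m11 c1 x h1 hx,
      e0_ε3 c1 x h1 hx] <;>
    try (field_simp <;> ring)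
theorem comm04 (c1 c2 : ℝ) (h1 : 0 < c1) (h2 : 0 < c2) (hx : ∀ i, 0 < x i) :
    e0 c1 (e4 c2 x) = e4 c2 (e0 c1 x) := by
  have hy := e0_pos c1 x h1 hx
  have hz := e4_pos c2 x h2 hx
  have : 0 < ε 0 x := ε0_pos x hx
  have : 0 < ε 4 x := ε4_pos x hx
  have : 0 < m11 x := ε0_pos x hx
  apply m_inj _ _ (e0_pos c1 _ h1 hz) <;>
    simp only [e0_act c1 _ h1 hz, e0_m11 c1 _ h1 hz, e4_act c2 x h2 hx,
      e4_act c2 _ h2 hy, e0_act c1 x h1 hx, e0_m11 c1 x h1 hx,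
      e0_ε4 c1 x h1 hx] <;>
    try (field_simp <;> ring)
theorem comm13 (c1 c2 : ℝ) (h1 : 0 < c1) (h2 : 0 < c2) (hx : ∀ i, 0 < x i) :
    e1 c1 (e3 c2 x) = e3 c2 (e1 c1 x) := by
  have hy := e1_pos c1 x h1 hx
  have hz := e3_pos c2 x h2 hx
  have : 0 < ε 1 x := ε1_pos x hx
  have : 0 < ε 3 x := ε3_pos x hx
  have : 0 < m11 x := ε0_pos x hx
  apply m_inj _ _ (e1_pos c1 _ h1 hz) <;>
    simp only [e1_act c1 _ h1 hz, e1_m11 c1 _ h1 hz, e3_act c2 x h2 hx,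
      e3_act c2 _ h2 hy, e1_act c1 x h1 hx, e1_m11 c1 x h1 hx,
      e1_ε3 c1 x h1 hx, e3_ε1 c2 x h2 hx] <;>
    try (field_simp <;> ring)
theorem comm14 (c1 c2 : ℝ) (h1 : 0 < c1) (h2 : 0 < c2) (hx : ∀ i, 0 < x i) :
    e1 c1 (e4 c2 x) = e4 c2 (e1 c1 x) := by
  have hy := e1_pos c1 x h1 hx
  have hz := e4_pos c2 x h2 hx
  have : 0 < ε 1 x := ε1_pos x hx
  have : 0 < ε 4 x := ε4_pos x hx
  have : 0 < m11 x := ε0_pos x hx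
  apply m_inj _ _ (e1_pos c1 _ h1 hz) <;>
    simp only [e1_act c1 _ h1 hz, e1_m11 c1 _ h1 hz, e4_act c2 x h2 hx,
      e4_act c2 _ h2 hy, e1_act c1 x h1 hx, e1_m11 c1 x h1 hx,
      e1_ε4 c1 x h1 hx, e4_ε1 c2 x h2 hx] <;>
    try (field_simp <;> ring)
theorem comm24 (c1 c2 : ℝ) (h1 : 0 < c1) (h2 : 0 < c2) (hx : ∀ i, 0 < x i) :
    e2 c1 (e4 c2 x) = e4 c2 (e2 c1 x) := by
  have hy := e2_pos c1 x h1 hx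
  have hz := e4_pos c2 x h2 hx
  have : 0 < ε 2 x := ε2_pos x hx
  have : 0 < ε 4 x := ε4_pos x hx
  have : 0 < m11 x := ε0_pos x hx
  apply m_inj _ _ (e2_pos c1 _ h1 hz) <;>
    simp only [e2_act c1 _ h1 hz, e4_act c2 x h2 hx,
      e4_act c2 _ h2 hy, e2_act c1 x h1 hx,
      e2_ε4 c1 x h1 hx, e4_ε2 c2 x h2 hx] <;>
    try (field_simp <;> ring)
end
/-! ### The rank two relations -/
section
variable (x : Fin 10 → ℝ)
theorem verma12 (c1 c2 : ℝ) (h1 : 0 < c1) (h2 : 0 < c2) (hx : ∀ i, 0 < x i) :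
    e1 c1 (e2 (c1 * c2) (e1 c2 x)) = e2 c2 (e1 (c1 * c2) (e2 c1 x)) := by
  have h12 := mul_pos h1 h2
  have y1 := e1_pos c2 x h2 hx
  have y2 := e2_pos (c1 * c2) _ h12 y1
  have z1 := e2_pos c1 x h1 hx
  have z2 := e1_pos (c1 * c2) _ h12 z1
  have k1 : ε 2 (e1 c2 x) = _ := e1_ε2 c2 x h2 hx
  have k2 : ε 1 (e2 (c1 * c2) (e1 c2 x))
      = (c1 * P12 x + Q12 x) / ((P12 x + c2 * Q12 x) / ε 1 x) := by
    rw [e2_ε1 _ _ h12 y1, e1_P12 c2 x h2 hx, e1_Q12 c2 x h2 hx, k1]; congr 1; field_simp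
  have k3 : ε 1 (e2 c1 x) = _ := e2_ε1 c1 x h1 hx
  have k4 : ε 2 (e1 (c1 * c2) (e2 c1 x))
      = (P12 x + c2 * Q12 x) / ((c1 * P12 x + Q12 x) / ε 2 x) := by
    rw [e1_ε2 _ _ h12 z1, e2_P12 c1 x h1 hx, e2_Q12 c1 x h1 hx, k3]; congr 1; field_simp
  obtain ⟨r1, r2, r3⟩ := scalA (ε1_pos x hx) (ε2_pos x hx) (P12_pos x hx) (Q12_pos x hx)
    (PQ12 x hx) h1 h2
  rw [← k1] at k2
  rw [← k3] at k4
  simp only [← k1, ← k3, ← k2, ← k4] at r1 r2 r3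
  apply m_inj _ _ (e1_pos c1 _ h1 y2) <;>
    simp only [e1_act c1 _ h1 y2, e1_m11 c1 _ h1 y2, e2_act _ _ h12 y1, e1_act c2 x h2 hx,
      e1_m11 c2 x h2 hx, e2_act c2 _ h2 z2, e1_act _ _ h12 z1, e1_m11 _ _ h12 z1,
      e2_act c1 x h1 hx] <;>
    generalize (c1 - 1) / ε 1 (e2 (c1 * c2) (e1 c2 x)) = a at r1 r2 r3 ⊢ <;>
    generalize (c1 * c2 - 1) / ε 2 (e1 c2 x) = b at r1 r2 r3 ⊢ <;>
    generalize (c2 - 1) / ε 1 x = d at r1 r2 r3 ⊢ <;>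
    generalize (c2 - 1) / ε 2 (e1 (c1 * c2) (e2 c1 x)) = a' at r1 r2 r3 ⊢ <;>
    generalize (c1 * c2 - 1) / ε 1 (e2 c1 x) = b' at r1 r2 r3 ⊢ <;>
    generalize (c1 - 1) / ε 2 x = d' at r1 r2 r3 ⊢
  · linear_combination m34 x * r2
  · linear_combination m24 x * r1 + m34 x * r3
  · linear_combination m33 x * r2
  · linear_combination m23 x * r1 + m33 x * r3
  · linear_combination r2 * (2 * m23 x + (b + a' + d') * m33 x)
  · linear_combination r1 * (m22 x + b * m23 x) + r2 * (m13 x + b' * m23 x + b' * d' * m33 x)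
      + r3 * (m23 x + b * m33 x)
  · linear_combination r1 * (2 * m12 x + (a + d + b') * m22 x + 2 * (a * b) * m23 x)
      + r3 * (2 * m13 x + 2 * b' * m23 x + (a * b + b' * d') * m33 x)

theorem verma23 (c1 c2 : ℝ) (h1 : 0 < c1) (h2 : 0 < c2) (hx : ∀ i, 0 < x i) :
    e2 c1 (e3 (c1 * c2) (e2 c2 x)) = e3 c2 (e2 (c1 * c2) (e3 c1 x)) := by
  have h12 := mul_pos h1 h2
  have y1 := e2_pos c2 x h2 hx
  have y2 := e3_pos (c1 * c2) _ h12 y1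
  have z1 := e3_pos c1 x h1 hx
  have z2 := e2_pos (c1 * c2) _ h12 z1
  have k1 : ε 3 (e2 c2 x) = _ := e2_ε3 c2 x h2 hx
  have k2 : ε 2 (e3 (c1 * c2) (e2 c2 x))
      = (c1 * P23 x + Q23 x) / ((P23 x + c2 * Q23 x) / ε 2 x) := by
    rw [e3_ε2 _ _ h12 y1, e2_P23 c2 x h2 hx, e2_Q23 c2 x h2 hx, k1]; congr 1; field_simp
  have k3 : ε 2 (e3 c1 x) = _ := e3_ε2 c1 x h1 hx
  have k4 : ε 3 (e2 (c1 * c2) (e3 c1 x))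
      = (P23 x + c2 * Q23 x) / ((c1 * P23 x + Q23 x) / ε 3 x) := by
    rw [e2_ε3 _ _ h12 z1, e3_P23 c1 x h1 hx, e3_Q23 c1 x h1 hx, k3]; congr 1; field_simp
  obtain ⟨r1, r2, r3⟩ := scalA (ε2_pos x hx) (ε3_pos x hx) (P23_pos x hx) (Q23_pos x hx)
    (PQ23 x hx) h1 h2
  rw [← k1] at k2
  rw [← k3] at k4
  simp only [← k1, ← k3, ← k2, ← k4] at r1 r2 r3
  apply m_inj _ _ (e2_pos c1 _ h1 y2) <;>
    simp only [e2_act c1 _ h1 y2, e3_act _ _ h12 y1, e2_act c2 x h2 hx,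
      e3_act c2 _ h2 z2, e2_act _ _ h12 z1, e3_act c1 x h1 hx] <;>
    generalize (c1 - 1) / ε 2 (e3 (c1 * c2) (e2 c2 x)) = a at r1 r2 r3 ⊢ <;>
    generalize (c1 * c2 - 1) / ε 3 (e2 c2 x) = b at r1 r2 r3 ⊢ <;>
    generalize (c2 - 1) / ε 2 x = d at r1 r2 r3 ⊢ <;>
    generalize (c2 - 1) / ε 3 (e2 (c1 * c2) (e3 c1 x)) = a' at r1 r2 r3 ⊢ <;>
    generalize (c1 * c2 - 1) / ε 2 (e3 c1 x) = b' at r1 r2 r3 ⊢ <;>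
    generalize (c1 - 1) / ε 3 x = d' at r1 r2 r3 ⊢
  · linear_combination m44 x * r2
  · linear_combination m34 x * r1 + m44 x * r3
  · linear_combination r2 * (2 * m34 x + (b + a' + d') * m44 x)
  · linear_combination r1 * (m33 x + b * m34 x) + r2 * (m24 x + b' * m34 x + b' * d' * m44 x)
      + r3 * (m34 x + b * m44 x)
  · linear_combination m14 x * r2
  · linear_combination r1 * (2 * m23 x + (a + d + b') * m33 x + 2 * (a * b) * m34 x)
      + r3 * (2 * m24 x + 2 * b' * m34 x + (a * b + b' * d') * m44 x)
  · linear_combination m13 x * r1 + m14 x * r3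

theorem verma34 (c1 c2 : ℝ) (h1 : 0 < c1) (h2 : 0 < c2) (hx : ∀ i, 0 < x i) :
    e3 c1 (e4 (c1 ^ 2 * c2) (e3 (c1 * c2) (e4 c2 x)))
      = e4 c2 (e3 (c1 * c2) (e4 (c1 ^ 2 * c2) (e3 c1 x))) := by
  have h12 := mul_pos h1 h2
  have h112 : 0 < c1 ^ 2 * c2 := by positivity
  have y1 := e4_pos c2 x h2 hx
  have y2 := e3_pos (c1 * c2) _ h12 y1
  have y3 := e4_pos (c1 ^ 2 * c2) _ h112 y2
  have z1 := e3_pos c1 x h1 hx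
  have z2 := e4_pos (c1 ^ 2 * c2) _ h112 z1
  have z3 := e3_pos (c1 * c2) _ h12 z2
  obtain ⟨A1, A2, B1, B2, n1, n2, n3, n4, hA1, hA2, hB1, hB2, k1, k2, k3, k4, k5, k6⟩ :=
    scalC (ε4_pos x hx) (ε3_pos x hx) h1 h2 (ε3_pos _ y1) (ε4_pos _ y2) (ε3_pos _ y3)
      (ε4_pos _ z1) (ε3_pos _ z2) (ε4_pos _ z3) (e4_ε3 c2 x h2 hx)
      (by rw [e3_ε4 _ _ h12 y1, e4_mu c2 x h2 hx, e4_zz c2 x h2 hx, e4_ε4 c2 x h2 hx])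
      (by rw [e4_ε3 _ _ h112 y2, e3_ε3 _ _ h12 y1, e3_mu _ _ h12 y1, e4_mu c2 x h2 hx,
            e4_zz c2 x h2 hx])
      (e3_ε4 c1 x h1 hx)
      (by rw [e4_ε3 _ _ h112 z1, e3_ε3 c1 x h1 hx, e3_mu c1 x h1 hx])
      (by rw [e3_ε4 _ _ h12 z2, e4_ε4 _ _ h112 z1, e4_mu _ _ h112 z1, e4_zz _ _ h112 z1,
            e3_mu c1 x h1 hx, e3_zz c1 x h1 hx])
  obtain ⟨r1, r2, r3, r4⟩ := scalC_rel (ε4_pos x hx) (ε3_pos x hx) h1 h2 n1 n2 n3 n4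
    hA1 hA2 hB1 hB2 rfl rfl rfl rfl rfl rfl rfl rfl
  simp only [← k1, ← k2, ← k3, ← k4, ← k5, ← k6] at r1 r2 r3 r4
  apply m_inj _ _ (e3_pos c1 _ h1 y3) <;>
    simp only [e3_act c1 _ h1 y3, e4_act _ _ h112 y2, e3_act _ _ h12 y1, e4_act c2 x h2 hx,
      e4_act c2 _ h2 z3, e3_act _ _ h12 z2, e4_act _ _ h112 z1, e3_act c1 x h1 hx] <;>
    generalize (c1 - 1) / ε 3 (e4 (c1 ^ 2 * c2) (e3 (c1 * c2) (e4 c2 x))) = a at r1 r2 r3 r4 ⊢ <;>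
    generalize (c1 ^ 2 * c2 - 1) / ε 4 (e3 (c1 * c2) (e4 c2 x)) = b at r1 r2 r3 r4 ⊢ <;>
    generalize (c1 * c2 - 1) / ε 3 (e4 c2 x) = d at r1 r2 r3 r4 ⊢ <;>
    generalize (c2 - 1) / ε 4 x = f at r1 r2 r3 r4 ⊢ <;>
    generalize (c2 - 1) / ε 4 (e3 (c1 * c2) (e4 (c1 ^ 2 * c2) (e3 c1 x))) = f' at r2 ⊢ <;>
    generalize (c1 * c2 - 1) / ε 3 (e4 (c1 ^ 2 * c2) (e3 c1 x)) = d' at r1 r2 r3 r4 ⊢ <;>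
    generalize (c1 ^ 2 * c2 - 1) / ε 4 (e3 c1 x) = b' at r1 r2 r3 r4 ⊢ <;>
    generalize (c1 - 1) / ε 3 x = a' at r1 r2 r3 r4 ⊢
  · linear_combination r2
  · linear_combination m44 x * r1 + r3
  · linear_combination (2 * m34 x + (a + d + a' + d') * m44 x) * r1 + r4
  · linear_combination m24 x * r1
  · linear_combination m14 x * r1

theorem verma10 (c1 c2 : ℝ) (h1 : 0 < c1) (h2 : 0 < c2) (hx : ∀ i, 0 < x i) :
    e1 c1 (e0 (c1 ^ 2 * c2) (e1 (c1 * c2) (e0 c2 x)))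
      = e0 c2 (e1 (c1 * c2) (e0 (c1 ^ 2 * c2) (e1 c1 x))) := by
  have h12 := mul_pos h1 h2
  have h112 : 0 < c1 ^ 2 * c2 := by positivity
  have y1 := e0_pos c2 x h2 hx
  have y2 := e1_pos (c1 * c2) _ h12 y1
  have y3 := e0_pos (c1 ^ 2 * c2) _ h112 y2
  have z1 := e1_pos c1 x h1 hx
  have z2 := e0_pos (c1 ^ 2 * c2) _ h112 z1
  have z3 := e1_pos (c1 * c2) _ h12 z2
  have pe : 0 < m11 x := pos4 x hx
  have pE := ε1_pos x hx
  obtain ⟨A1, A2, B1, B2, n1, n2, n3, n4, hA1, hA2, hB1, hB2, k1, k2, k3, k4, k5, k6⟩ :=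
    scalC (m := m12 x) (Z := m22 x) pe pE h1 h2 (ε1_pos _ y1) (pos4 _ y2)
      (ε1_pos _ y3) (pos4 _ z1) (ε1_pos _ z2) (pos4 _ z3) (e0_ε1 c2 x h2 hx)
      (by change m11 _ = _
          rw [e1_m11 _ _ h12 y1, e0_m12 c2 x h2 hx, e0_m22 c2 x h2 hx, e0_m11 c2 x h2 hx]; ring)
      (by change _ = _ - _ / m11 _
          rw [e0_ε1 _ _ h112 y2, e1_ε1 _ _ h12 y1, e1_m12 _ _ h12 y1, e0_m12 c2 x h2 hx,
            e0_m22 c2 x h2 hx]; ring)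
      (by change m11 _ = _
          rw [e1_m11 c1 x h1 hx]; ring)
      (by change _ = _ - _ / m11 _
          rw [e0_ε1 _ _ h112 z1, e1_ε1 c1 x h1 hx, e1_m12 c1 x h1 hx]; ring)
      (by change m11 _ = m11 _ / _ + _ + _ * (_ - _ / m11 _) / _
          rw [e1_m11 _ _ h12 z2, e0_m11 _ _ h112 z1, e0_m12 _ _ h112 z1, e0_m22 _ _ h112 z1,
            e1_m12 c1 x h1 hx, e1_m22 c1 x h1 hx]; ring)
  change m11 _ = _ at k2 k4 k6
  have Spq := scal_pq pe pE h1 h2 n1 n2 n3 n4 hA1 hA2 hB1 hB2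
  have S1p := scal_1p pe pE h1 h2 n1 n2 n3 n4 hA1 hA2 hB1 hB2
  have S11 := scal_11 pe pE h1 h2 n1 n2 n3 n4 hA1 hA2 hB1 hB2 rfl
  apply m_inj _ _ (e1_pos c1 _ h1 y3)
  all_goals
    simp only [e1_act c1 _ h1 y3, e1_m11 c1 _ h1 y3, e0_act _ _ h112 y2, e0_m11 _ _ h112 y2,
      e1_act _ _ h12 y1, e0_act c2 x h2 hx, e0_act c2 _ h2 z3, e0_m11 c2 _ h2 z3,
      e1_act _ _ h12 z2, e0_act _ _ h112 z1, e1_act c1 x h1 hx, k1, k2, k3, k4, k5, k6]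
  · exact Spq (m14 x) (m24 x) (m14 x) (m24 x) (m44 x) rfl rfl rfl rfl
  · exact Spq (m13 x) (m23 x) (m14 x) (m24 x) (m34 x) rfl rfl rfl rfl
  · exact Spq (m12 x) (m22 x) (m14 x) (m24 x) (m24 x) rfl rfl rfl rfl
  · exact S1p (m14 x) (m24 x) rfl rfl rfl
  · exact Spq (m13 x) (m23 x) (m13 x) (m23 x) (m33 x) rfl rfl rfl rfl
  · exact Spq (m12 x) (m22 x) (m13 x) (m23 x) (m23 x) rfl rfl rfl rfl
  · exact S1p (m13 x) (m23 x) rfl rfl rfl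
  · exact Spq (m12 x) (m22 x) (m12 x) (m22 x) (m22 x) rfl rfl rfl rfl
  · exact S1p (m12 x) (m22 x) rfl rfl rfl
  · exact S11
end
/-! ### The functions `γ` -/
section
variable (c : ℝ) (x : Fin 10 → ℝ)
theorem γ_e0 (hc : 0 < c) (hx : ∀ i, 0 < x i) (j : Fin 5) :
    γ j (e0 c x) = c ^ A 0 j * γ j x := by
  have := pos4 x hx; have := pos41 c x hc hx; have := pos42 c x hc hx; have := pos43 c x hc hx
  have := posqa c x hc hx; have := posqc c x hc hx; have := posqg c x hc hx
  obtain ⟨_, _, _, _, _, _, _, _, _, _⟩ := all_pos x hx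
  have i0 : c ^ (-1 : ℤ) = c⁻¹ := zpow_neg_one c
  have i1 : c ^ (-2 : ℤ) = (c ^ 2)⁻¹ := zpow_neg c 2
  have i2 : c ^ (2 : ℤ) = c ^ 2 := zpow_natCast c 2
  fin_cases j <;>
    simp [γ, A, i0, i1, i2, e0_0 c x hc hx, e0_1 c x hc hx, e0_2 c x hc hx, e0_3 c x hc hx,
      e0_4 c x hc hx, e0_5 c x hc hx, e0_6 c x hc hx, e0_7 c x hc hx, e0_8 c x hc hx,
      e0_9 c x hc hx] <;> field_simp
theorem γ_e (hc : 0 < c) (hx : ∀ i, 0 < x i) (i j : Fin 5) :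
    γ j (e i c x) = c ^ A i j * γ j x := by
  have := r2_pos c x hc hx
  obtain ⟨_, _, _⟩ := e3_aux c x hc hx
  obtain ⟨_, _, _, _⟩ := e4_aux c x hc hx
  obtain ⟨_, _, _, _, _, _, _, _, _, _⟩ := all_pos x hx
  have i0 : c ^ (-1 : ℤ) = c⁻¹ := zpow_neg_one c
  have i1 : c ^ (-2 : ℤ) = (c ^ 2)⁻¹ := zpow_neg c 2
  have i2 : c ^ (2 : ℤ) = c ^ 2 := zpow_natCast c 2
  obtain rfl | hi := eq_or_ne i 0
  · exact γ_e0 c x hc hx j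
  fin_cases i
  · exact absurd rfl hi
  all_goals clear hi; fin_cases j <;> simp [γ, A, e, i0, i1, i2, e1, e2, e3, e4] <;> field_simp
end

/-- `(e_0, …, e_4, γ_0, …, γ_4, ε_0, …, ε_4)` is a positive geometric crystal
for `C_4^{(1)}`. -/
theorem geometric_crystal_C4 :
    ∀ x : Fin 10 → ℝ, (∀ i, 0 < x i) → ∀ c c1 c2 : ℝ, 0 < c → 0 < c1 → 0 < c2 →
      ((∀ i : Fin 5, e i 1 x = x ∧ e i (c1 * c2) x = e i c1 (e i c2 x)) ∧
       (∀ i j : Fin 5, γ j (e i c x) = c ^ (A i j) * γ j x) ∧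
       ((∀ i : Fin 5, ε i (e i c x) = c⁻¹ * ε i x) ∧
        (∀ i j : Fin 5, A i j = 0 ∧ A j i = 0 → ε i (e j c x) = ε i x)) ∧
       ((∀ i j : Fin 5, A i j = 0 ∧ A j i = 0 →
          e i c1 (e j c2 x) = e j c2 (e i c1 x)) ∧
        (∀ p : Fin 5 × Fin 5, p = (1, 2) ∨ p = (2, 3) →
          e p.1 c1 (e p.2 (c1 * c2) (e p.1 c2 x)) =
            e p.2 c2 (e p.1 (c1 * c2) (e p.2 c1 x))) ∧
        (∀ p : Fin 5 × Fin 5, p = (1, 0) ∨ p = (3, 4) →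
          e p.1 c1 (e p.2 (c1 ^ 2 * c2) (e p.1 (c1 * c2) (e p.2 c2 x))) =
            e p.2 c2 (e p.1 (c1 * c2) (e p.2 (c1 ^ 2 * c2) (e p.1 c1 x)))))) := by
  intro x hx c c1 c2 hc h1 h2
  refine ⟨?_, γ_e c x hc hx, ⟨?_, ?_⟩, ?_, ?_, ?_⟩
  · intro i
    fin_cases i
    · exact ⟨e0_one x hx, e0_mul x c1 c2 h1 h2 hx⟩
    · exact ⟨e1_one x hx, e1_mul x c1 c2 h1 h2 hx⟩
    · exact ⟨e2_one x hx, e2_mul x c1 c2 h1 h2 hx⟩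
    · exact ⟨e3_one x hx, e3_mul x c1 c2 h1 h2 hx⟩
    · exact ⟨e4_one x hx, e4_mul x c1 c2 h1 h2 hx⟩
  · intro i
    rw [inv_mul_eq_div]
    fin_cases i
    · exact e0_m11 c x hc hx
    · exact e1_ε1 c x hc hx
    · exact e2_ε2 c x hc hx
    · exact e3_ε3 c x hc hx
    · exact e4_ε4 c x hc hx
  · rintro i j ⟨h, h'⟩
    fin_cases i <;> fin_cases j <;> try (exfalso; revert h; decide)
    · exact e2_m11 c x hc hx
    · exact e3_m11 c x hc hx
    · exact e4_m11 c x hc hx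
    · exact e3_ε1 c x hc hx
    · exact e4_ε1 c x hc hx
    · exact e0_ε2 c x hc hx
    · exact e4_ε2 c x hc hx
    · exact e0_ε3 c x hc hx
    · exact e1_ε3 c x hc hx
    · exact e0_ε4 c x hc hx
    · exact e1_ε4 c x hc hx
    · exact e2_ε4 c x hc hx
  · rintro i j ⟨h, h'⟩
    fin_cases i <;> fin_cases j <;> try (exfalso; revert h; decide)
    · exact comm02 x c1 c2 h1 h2 hx
    · exact comm03 x c1 c2 h1 h2 hx
    · exact comm04 x c1 c2 h1 h2 hx
    · exact comm13 x c1 c2 h1 h2 hx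
    · exact comm14 x c1 c2 h1 h2 hx
    · exact (comm02 x c2 c1 h2 h1 hx).symm
    · exact comm24 x c1 c2 h1 h2 hx
    · exact (comm03 x c2 c1 h2 h1 hx).symm
    · exact (comm13 x c2 c1 h2 h1 hx).symm
    · exact (comm04 x c2 c1 h2 h1 hx).symm
    · exact (comm14 x c2 c1 h2 h1 hx).symm
    · exact (comm24 x c2 c1 h2 h1 hx).symm
  · have E1 : e 1 = e1 := rfl
    have E2 : e 2 = e2 := rfl
    have E3 : e 3 = e3 := rfl
    rintro p (rfl | rfl) <;> simp only [E1, E2, E3]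
    · exact verma12 x c1 c2 h1 h2 hx
    · exact verma23 x c1 c2 h1 h2 hx
  · have E0 : e 0 = e0 := rfl
    have E1 : e 1 = e1 := rfl
    have E3 : e 3 = e3 := rfl
    have E4 : e 4 = e4 := rfl
    rintro p (rfl | rfl) <;> simp only [E0, E1, E3, E4]
    · exact verma10 x c1 c2 h1 h2 hx
    · exact verma34 x c1 c2 h1 h2 hx


end

end Stmt11
end
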